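/- Assume the Riemann Hypothesis. Fix ε > 0. There exists x₀ = x₀(ε) such that for all x ≥ x₀ and all y satisfying either (log x)^{2+ε} ≤ y ≤ (1−ε)x or 2 ≤ y ≤ (log x)^{2−ε}, one has Ψ(x,y) ≥ x · ρ(log x / log y). -/

import Mathlib

open Real Filter


/-- `Psi x y` is the number of `y`-friable integers up to `x`. -/
noncomputable def Psi (x y : ℝ) : ℕ :=
  Set.ncard {n : ℕ | 1 ≤ n ∧ (n : ℝ) ≤ x ∧ ∀ p : ℕ, p.Prime → p ∣ n → (p : ℝ) ≤ y}


/-- Mellin-type transform over `(1,∞)`. -/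
noncomputable def TT (g : ℝ → ℝ) (s : ℂ) : ℂ :=
  ∫ t in Set.Ioi (1:ℝ), (g t : ℂ) * (t:ℂ) ^ (-(s + 1))

lemma TT_integrable {g : ℝ → ℝ} (hg : Measurable g) {C a : ℝ}
    (hC : ∀ t > (1:ℝ), |g t| ≤ C * t ^ a) {s : ℂ} (hs : a < s.re) :
    MeasureTheory.IntegrableOn (fun t : ℝ => (g t : ℂ) * (t:ℂ) ^ (-(s + 1))) (Set.Ioi 1) := by
  have h1 : MeasureTheory.IntegrableOn (fun t : ℝ => C * t ^ (a - s.re - 1)) (Set.Ioi 1) :=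
    (integrableOn_Ioi_rpow_of_lt (by linarith) one_pos).const_mul C
  refine MeasureTheory.Integrable.mono' h1 ?_ ?_
  · refine MeasureTheory.AEStronglyMeasurable.mul ?_ ?_
    · exact (Complex.measurable_ofReal.comp hg).aestronglyMeasurable
    · refine ContinuousOn.aestronglyMeasurable ?_ measurableSet_Ioi
      intro t ht
      exact (Complex.continuousAt_ofReal_cpow_const t _ (Or.inr (by
        have := Set.mem_Ioi.1 ht; linarith))).continuousWithinAt
  · refine (MeasureTheory.ae_restrict_iff' measurableSet_Ioi).2 (Eventually.of_forall ?_)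
    intro t ht
    have ht : 1 < t := ht
    have ht0 : 0 < t := by linarith
    rw [norm_mul, Complex.norm_cpow_eq_rpow_re_of_pos ht0, Complex.norm_real, Real.norm_eq_abs]
    calc |g t| * t ^ (-(s+1)).re ≤ (C * t ^ a) * t ^ (-(s+1)).re := by
          gcongr; exact hC t ht
      _ = C * t ^ (a - s.re - 1) := by
          rw [mul_assoc, ← Real.rpow_add ht0]; congr 2; simp; ring

lemma TT_norm_le {g : ℝ → ℝ} {C a : ℝ}
    (hC : ∀ t > (1:ℝ), |g t| ≤ C * t ^ a) {s : ℂ} (hs : a < s.re) :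
    ‖TT g s‖ ≤ C / (s.re - a) := by
  have h1 : MeasureTheory.IntegrableOn (fun t : ℝ => C * t ^ (a - s.re - 1)) (Set.Ioi 1) :=
    (integrableOn_Ioi_rpow_of_lt (by linarith) one_pos).const_mul C
  have h2 : ∫ t in Set.Ioi (1:ℝ), C * t ^ (a - s.re - 1) = C / (s.re - a) := by
    rw [MeasureTheory.integral_const_mul, integral_Ioi_rpow_of_lt (by linarith) one_pos]
    have : s.re - a ≠ 0 := by linarith
    have : a - s.re ≠ 0 := by intro h; apply this; linarith
    simp
    rw [← neg_sub s.re a]; field_simp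
  rw [← h2]
  refine MeasureTheory.norm_integral_le_of_norm_le h1 ?_
  refine (MeasureTheory.ae_restrict_iff' measurableSet_Ioi).2 (Eventually.of_forall ?_)
  intro t ht
  have ht : 1 < t := ht
  have ht0 : 0 < t := by linarith
  rw [norm_mul, Complex.norm_cpow_eq_rpow_re_of_pos ht0, Complex.norm_real, Real.norm_eq_abs]
  calc |g t| * t ^ (-(s+1)).re ≤ (C * t ^ a) * t ^ (-(s+1)).re := by
        gcongr; exact hC t ht
    _ = C * t ^ (a - s.re - 1) := by
        rw [mul_assoc, ← Real.rpow_add ht0]; congr 2; simp; ring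

lemma TT_diff {g : ℝ → ℝ} (hg : Measurable g) {C a : ℝ}
    (hC : ∀ t > (1:ℝ), |g t| ≤ C * t ^ a) {s : ℂ} (hs : a < s.re) :
    DifferentiableAt ℂ (TT g) s := by
  set f : ℝ → ℂ := (Set.Ioi (1:ℝ)).indicator (fun t => (g t : ℂ)) with hf
  have hfm : Measurable f := (Complex.measurable_ofReal.comp hg).indicator measurableSet_Ioi
  have hm : ∀ z, TT g z = mellin f (-z) := by
    intro z
    rw [mellin, TT, hf]
    rw [← MeasureTheory.integral_indicator measurableSet_Ioi,
      ← MeasureTheory.integral_indicator measurableSet_Ioi]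
    congr 1
    ext t
    by_cases h : 1 < t
    · have h0 : 0 < t := by linarith
      simp [Set.indicator, h, h0, mul_comm]
      left; congr 1; ring
    · simp [Set.indicator, h]
  have hfb : ∀ t > (0:ℝ), ‖f t‖ ≤ |C| * t ^ a := by
    intro t ht
    by_cases h : 1 < t
    · simp only [hf, Set.indicator, Set.mem_Ioi, h, if_true, Complex.norm_real, Real.norm_eq_abs]
      refine (hC t h).trans ?_
      gcongr; exact le_abs_self C
    · simp [hf, Set.indicator, h]; positivity
  have hloc : MeasureTheory.LocallyIntegrableOn f (Set.Ioi 0) := by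
    have h1 : MeasureTheory.LocallyIntegrableOn (fun t : ℝ => |C| * t ^ a) (Set.Ioi 0) := by
      refine ContinuousOn.locallyIntegrableOn ?_ measurableSet_Ioi
      intro t ht
      exact ((Real.continuousAt_rpow_const t a (Or.inl (ne_of_gt ht))).const_mul |C| |>.continuousWithinAt)
    rw [MeasureTheory.locallyIntegrableOn_iff (isOpen_Ioi.isLocallyClosed)] at h1 ⊢
    intro k hk hkc
    refine MeasureTheory.Integrable.mono' (h1 k hk hkc) hfm.aestronglyMeasurable ?_
    refine (MeasureTheory.ae_restrict_iff' hkc.measurableSet).2 (Eventually.of_forall ?_)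
    intro t ht
    exact hfb t (hk ht)
  have h2 : DifferentiableAt ℂ (mellin f) (-s) := by
    refine mellin_differentiableAt_of_isBigO_rpow (a := -a) (b := (-s).re - 1) hloc ?_ (by simpa) ?_ (by linarith)
    · refine Asymptotics.IsBigO.of_bound |C| ?_
      filter_upwards [eventually_gt_atTop 0] with t ht
      rw [Real.norm_of_nonneg (by positivity), neg_neg]
      exact hfb t ht
    · refine Asymptotics.IsBigO.of_bound 1 ?_
      have : Set.Iio (1:ℝ) ∈ nhdsWithin 0 (Set.Ioi (0:ℝ)) :=
        mem_nhdsWithin_of_mem_nhds (Iio_mem_nhds one_pos)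
      filter_upwards [this] with t ht
      have : ¬ 1 < t := not_lt.2 (le_of_lt ht)
      simp [hf, Set.indicator, this]
  have h3 : TT g = fun z => mellin f (-z) := funext hm
  rw [h3]
  exact DifferentiableAt.comp (g := mellin f) (f := fun z => -z) s h2 (by fun_prop)


lemma TT_id {s : ℂ} (hs : 1 < s.re) : TT (fun t => t) s = 1 / (s - 1) := by
  have h0 : s - 1 ≠ 0 := by
    intro h
    have := congrArg Complex.re h
    simp at this; linarith
  have h1 : TT (fun t => t) s = ∫ t in Set.Ioi (1:ℝ), (t:ℂ) ^ (-s) := by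
    rw [TT]
    refine MeasureTheory.setIntegral_congr_fun measurableSet_Ioi ?_
    intro t ht
    have ht : (1:ℝ) < t := ht
    have ht0 : (t:ℂ) ≠ 0 := by norm_cast; linarith
    show (t:ℂ) * (t:ℂ) ^ (-(s + 1)) = _
    rw [neg_add, Complex.cpow_add _ _ ht0, Complex.cpow_neg_one]; field_simp
  rw [h1, integral_Ioi_cpow_of_lt (by simpa) one_pos]
  have h2 : -s + 1 ≠ 0 := by intro h; apply h0; linear_combination -h
  simp
  rw [div_eq_iff h2]; field_simp; ring

lemma zeta_floor {s : ℂ} (hs : 1 < s.re) :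
    riemannZeta s = s * TT (fun t => (⌊t⌋₊ : ℝ)) s := by
  have h := LSeries_eq_mul_integral_of_nonneg (fun n => 1) (r := 1) (by norm_num) hs
    (by
      refine Asymptotics.IsBigO.of_bound 1 (Eventually.of_forall ?_)
      intro n; simp) (by intro n; norm_num)
  have h2 : LSeries (fun n => (((1:ℝ)):ℂ)) s = riemannZeta s := by
    rw [← LSeries_one_eq_riemannZeta hs]; congr 1
  rw [h2] at h
  rw [h, TT]
  simp

lemma TT_sub {f g : ℝ → ℝ} {s : ℂ}
    (hf : MeasureTheory.IntegrableOn (fun t : ℝ => (f t : ℂ) * (t:ℂ) ^ (-(s + 1))) (Set.Ioi 1))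
    (hg : MeasureTheory.IntegrableOn (fun t : ℝ => (g t : ℂ) * (t:ℂ) ^ (-(s + 1))) (Set.Ioi 1)) :
    TT (fun t => f t - g t) s = TT f s - TT g s := by
  rw [TT, TT, TT, ← MeasureTheory.integral_sub hf hg]
  congr 1; ext t; push_cast; ring

lemma psi_measurable : Measurable Chebyshev.psi := Chebyshev.psi_mono.measurable

lemma fract_bd : ∀ t > (1:ℝ), |Int.fract t| ≤ 1 * t ^ (0:ℝ) := by
  intro t _
  rw [Real.rpow_zero, mul_one, abs_of_nonneg (Int.fract_nonneg t)]
  exact (Int.fract_lt_one t).le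

lemma id_bd : ∀ t > (1:ℝ), |t| ≤ 1 * t ^ (1:ℝ) := by
  intro t ht
  rw [Real.rpow_one, one_mul, abs_of_pos (by linarith)]

lemma zeta1_fract_aux {s : ℂ} (hs : 1 < s.re) :
    riemannZeta₁ s = s - s * (s - 1) * TT (fun t => Int.fract t) s := by
  have h0 : s - 1 ≠ 0 := by
    intro h
    have := congrArg Complex.re h
    simp at this; linarith
  have h1 : s ≠ 1 := sub_ne_zero.1 h0
  have e1 : riemannZeta₁ s = (s - 1) * riemannZeta s := by
    rw [riemannZeta_eq_inv_sub_mul h1]; field_simp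
  have e2 : TT (fun t => (⌊t⌋₊ : ℝ)) s = TT (fun t => t - Int.fract t) s := by
    rw [TT, TT]
    refine MeasureTheory.setIntegral_congr_fun measurableSet_Ioi ?_
    intro t ht
    have ht : (1:ℝ) < t := ht
    have : (⌊t⌋₊ : ℝ) = t - Int.fract t := by
      rw [natCast_floor_eq_intCast_floor (by linarith)]
      linarith [Int.floor_add_fract t]
    simp only [this]
  have e3 := TT_sub (TT_integrable (g := fun t => t) measurable_id id_bd hs)
    (TT_integrable (g := fun t => Int.fract t) measurable_fract fract_bd
      (show (0:ℝ) < s.re by linarith))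
  rw [e1, zeta_floor hs, e2, e3, TT_id hs]
  field_simp

lemma halfplane_preconn (a : ℝ) : IsPreconnected {s : ℂ | a < s.re} :=
  (convex_halfSpace_re_gt a).isPreconnected

lemma zeta1_fract {s : ℂ} (hs : 0 < s.re) :
    riemannZeta₁ s = s - s * (s - 1) * TT (fun t => Int.fract t) s := by
  have hU : IsOpen {s : ℂ | (0:ℝ) < s.re} := isOpen_lt continuous_const Complex.continuous_re
  have hf : AnalyticOnNhd ℂ riemannZeta₁ {s : ℂ | (0:ℝ) < s.re} :=
    differentiable_riemannZeta₁.differentiableOn.analyticOnNhd hU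
  have hg : AnalyticOnNhd ℂ (fun s : ℂ => s - s * (s - 1) * TT (fun t => Int.fract t) s)
      {s : ℂ | (0:ℝ) < s.re} := by
    refine DifferentiableOn.analyticOnNhd ?_ hU
    intro z hz
    have := TT_diff (g := fun t => Int.fract t) measurable_fract fract_bd (s := z) hz
    exact DifferentiableAt.differentiableWithinAt (by fun_prop)
  refine hf.eqOn_of_preconnected_of_eventuallyEq hg (halfplane_preconn 0) (z₀ := 2)
    (by simp) ?_ hs
  have : {s : ℂ | (1:ℝ) < s.re} ∈ nhds (2:ℂ) :=
    (isOpen_lt continuous_const Complex.continuous_re).mem_nhds (by simp)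
  filter_upwards [this] with z hz
  exact zeta1_fract_aux hz

lemma zeta1_ne_zero_of_one_lt {s : ℂ} (hs : 1 < s.re) : riemannZeta₁ s ≠ 0 := by
  intro h
  have h1 : s ≠ 1 := by rintro rfl; simp at hs
  have := riemannZeta_ne_zero_of_one_lt_re hs
  rw [riemannZeta_eq_inv_sub_mul h1, h] at this
  simp at this

lemma zeta1_ne_zero (hRH : RiemannHypothesis) {s : ℂ} (hs : 1/2 < s.re) : riemannZeta₁ s ≠ 0 := by
  intro h
  have h1 : s ≠ 1 := by rintro rfl; simp [riemannZeta₁_one] at h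
  have h2 : riemannZeta s = 0 := by rw [riemannZeta_eq_inv_sub_mul h1, h]; simp
  have := hRH s h2 (by
    rintro ⟨n, rfl⟩
    simp at hs
    have : (0:ℝ) ≤ n := Nat.cast_nonneg n
    linarith) h1
  linarith

/-- `ψ t - t`. -/
noncomputable def Dl (t : ℝ) : ℝ := Chebyshev.psi t - t

lemma Dl_measurable : Measurable Dl := psi_measurable.sub measurable_id

lemma psi_bd : ∀ t > (1:ℝ), |Chebyshev.psi t| ≤ (Real.log 4 + 4) * t ^ (1:ℝ) := by
  intro t ht
  rw [Real.rpow_one, abs_of_nonneg (Chebyshev.psi_nonneg t)]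
  exact Chebyshev.psi_le_const_mul_self (by linarith)

lemma TT_Dl_formula {s : ℂ} (hs : 1 < s.re) :
    s * TT Dl s = - (deriv riemannZeta₁ s / riemannZeta₁ s) - 1 := by
  have h0 : s - 1 ≠ 0 := by
    intro h
    have := congrArg Complex.re h
    simp at this; linarith
  have h1 : s ≠ 1 := sub_ne_zero.1 h0
  have hs0 : s ≠ 0 := by rintro rfl; simp at hs; linarith
  have hz := zeta1_ne_zero_of_one_lt hs
  have h := LSeries_eq_mul_integral_of_nonneg (fun n => ArithmeticFunction.vonMangoldt n)
    (r := 1) (by norm_num) hs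
    (by
      refine Asymptotics.IsBigO.of_bound (Real.log 4 + 4) (Eventually.of_forall ?_)
      intro n
      have e : ∑ k ∈ Finset.Icc 1 n, ArithmeticFunction.vonMangoldt k = Chebyshev.psi n := by
        rw [Chebyshev.psi, Nat.floor_natCast]; rfl
      rw [e, Real.rpow_one, Real.norm_of_nonneg (Chebyshev.psi_nonneg _),
        Real.norm_of_nonneg (Nat.cast_nonneg n)]
      exact Chebyshev.psi_le_const_mul_self (Nat.cast_nonneg n))
    (by intro n; exact ArithmeticFunction.vonMangoldt_nonneg)
  rw [ArithmeticFunction.LSeries_vonMangoldt_eq_deriv_riemannZeta_div hs] at h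
  have e1 : ∫ (t : ℝ) in Set.Ioi 1, (∑ k ∈ Finset.Icc 1 ⌊t⌋₊,
      ((ArithmeticFunction.vonMangoldt k : ℝ) : ℂ)) * (t:ℂ) ^ (-(s + 1)) = TT Chebyshev.psi s := by
    rw [TT]
    congr 1; ext t
    rw [Chebyshev.psi]
    push_cast
    rfl
  rw [e1] at h
  have e3 := TT_sub (TT_integrable psi_measurable psi_bd hs)
    (TT_integrable (g := fun t => t) measurable_id id_bd hs)
  have e4 : TT Dl s = TT Chebyshev.psi s - 1 / (s - 1) := by
    rw [← TT_id hs, ← e3]; rfl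
  have e5 : deriv riemannZeta s = deriv (fun s => (s - 1)⁻¹ * riemannZeta₁ s) s := by
    apply EventuallyEq.deriv_eq
    filter_upwards [isOpen_ne.mem_nhds h1] with z hz
    exact riemannZeta_eq_inv_sub_mul hz
  have e6 : deriv (fun s => (s - 1)⁻¹ * riemannZeta₁ s) s =
      -1 / (s - 1)^2 * riemannZeta₁ s + (s - 1)⁻¹ * deriv riemannZeta₁ s := by
    have ha : HasDerivAt (fun s : ℂ => (s - 1)⁻¹) (-1 / (s-1)^2) s := by
      exact (((hasDerivAt_id s).sub_const 1).fun_inv h0)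
    exact (ha.mul differentiable_riemannZeta₁.differentiableAt.hasDerivAt).deriv
  rw [e5, e6, riemannZeta_eq_inv_sub_mul h1] at h
  rw [e4, mul_sub, ← h]
  field_simp
  ring


lemma zeta1_inv_bd : ∃ K : ℝ, 1 ≤ K ∧ ∀ s : ℂ, s.re = 2 → ‖(riemannZeta₁ s)⁻¹‖ ≤ K := by
  set F : ℕ → ℂ := fun n => ((ArithmeticFunction.moebius n : ℤ) : ℂ) with hF
  refine ⟨max 1 (∑' n, ‖LSeries.term F 2 n‖), le_max_left _ _, ?_⟩
  intro s hs
  have hs1 : 1 < s.re := by rw [hs]; norm_num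
  have h1 : s ≠ 1 := by rintro rfl; simp at hs
  have hterm : ∀ n, ‖LSeries.term F s n‖ = ‖LSeries.term F 2 n‖ := by
    intro n; rw [LSeries.norm_term_eq, LSeries.norm_term_eq, hs]; simp
  have hsum : Summable (fun n => ‖LSeries.term F s n‖) :=
    (ArithmeticFunction.LSeriesSummable_moebius_iff.2 hs1).norm
  have hb : ‖LSeries F s‖ ≤ ∑' n, ‖LSeries.term F 2 n‖ := by
    rw [LSeries]
    refine (norm_tsum_le_tsum_norm hsum).trans (le_of_eq ?_)
    exact tsum_congr hterm
  have hz : riemannZeta s * LSeries F s = 1 := by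
    rw [← LSeries_one_eq_riemannZeta hs1]
    exact LSeries_one_mul_Lseries_moebius hs1
  have hinv : (riemannZeta s)⁻¹ = LSeries F s := by
    have h9 : riemannZeta s ≠ 0 := left_ne_zero_of_mul_eq_one hz
    field_simp; exact hz.symm
  have h0 : s - 1 ≠ 0 := sub_ne_zero.2 h1
  have e1 : (riemannZeta₁ s)⁻¹ = (s - 1)⁻¹ * LSeries F s := by
    rw [← hinv, riemannZeta_eq_inv_sub_mul h1]; field_simp
  rw [e1, norm_mul, norm_inv]
  have h2 : 1 ≤ ‖s - 1‖ := by
    have := Complex.abs_re_le_norm (s - 1)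
    simp [hs] at this
    norm_num at this; exact this
  refine le_trans ?_ (le_max_right _ _)
  calc ‖s - 1‖⁻¹ * ‖LSeries F s‖ ≤ 1 * ‖LSeries F s‖ := by
        gcongr; exact inv_le_one_of_one_le₀ h2
    _ ≤ _ := by rw [one_mul]; exact hb

lemma zeta1_bd {s : ℂ} (hs : 1/2 < s.re) (hs2 : s.re ≤ 4) :
    ‖riemannZeta₁ s‖ ≤ 20 * (3 + |s.im|) ^ 2 := by
  rw [zeta1_fract (by linarith)]
  have hJ := TT_norm_le (g := fun t => Int.fract t) fract_bd (show (0:ℝ) < s.re by linarith)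
  have hJ2 : ‖TT (fun t => Int.fract t) s‖ ≤ 2 := by
    refine hJ.trans ?_
    rw [div_le_iff₀ (by linarith)]; linarith
  have hs0 : ‖s‖ ≤ 4 + |s.im| := by
    refine (Complex.norm_le_abs_re_add_abs_im s).trans ?_
    rw [abs_of_pos (by linarith : 0 < s.re)]; linarith
  have hs1 : ‖s - 1‖ ≤ 4 + |s.im| := by
    refine (Complex.norm_le_abs_re_add_abs_im (s-1)).trans ?_
    simp only [Complex.sub_re, Complex.one_re, Complex.sub_im, Complex.one_im, sub_zero]
    have : |s.re - 1| ≤ 4 := by rw [abs_le]; constructor <;> linarith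
    linarith
  have ha := abs_nonneg s.im
  calc ‖s - s * (s - 1) * TT (fun t => Int.fract t) s‖
      ≤ ‖s‖ + ‖s‖ * ‖s - 1‖ * ‖TT (fun t => Int.fract t) s‖ := by
        refine (norm_sub_le _ _).trans ?_
        rw [norm_mul, norm_mul]
    _ ≤ (4 + |s.im|) + (4 + |s.im|) * (4 + |s.im|) * 2 := by gcongr
    _ ≤ 20 * (3 + |s.im|) ^ 2 := by nlinarith

lemma one_le_log3 (a : ℝ) : 1 ≤ Real.log (3 + |a|) := by
  rw [Real.le_log_iff_exp_le (by positivity)]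
  have := Real.exp_one_lt_d9
  have := abs_nonneg a
  linarith

lemma logder_bd (hRH : RiemannHypothesis) {δ : ℝ} (hδ : 0 < δ) (hδ1 : δ < 1) :
    ∃ C : ℝ, 0 < C ∧ ∀ s : ℂ, 1/2 + δ ≤ s.re → s.re ≤ 2 →
      ‖deriv riemannZeta₁ s / riemannZeta₁ s‖ ≤ C * Real.log (3 + |s.im|) := by
  obtain ⟨K, hK1, hK⟩ := zeta1_inv_bd
  set C1 : ℝ := Real.log (20 * K) + 4 with hC1
  have hlogK : 0 ≤ Real.log (20 * K) := Real.log_nonneg (by linarith)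
  refine ⟨24 * C1 / δ ^ 2, by positivity, ?_⟩
  intro s hs1 hs2
  set c : ℂ := ⟨2, s.im⟩ with hc
  have hcre : c.re = 2 := rfl
  have hcim : c.im = s.im := rfl
  set R : ℝ := 3/2 - δ/4 with hR
  set g : ℂ → ℂ := fun z => riemannZeta₁ (c + z) * (riemannZeta₁ c)⁻¹ with hg
  have hcne : riemannZeta₁ c ≠ 0 := zeta1_ne_zero hRH (by rw [hcre]; norm_num)
  have hre : ∀ z ∈ Metric.ball (0:ℂ) R, 1/2 < (c + z).re ∧ (c+z).re ≤ 4 := by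
    intro z hz
    rw [mem_ball_zero_iff] at hz
    have := Complex.abs_re_le_norm z
    have h2 := abs_le.1 (this.trans hz.le)
    rw [Complex.add_re, hcre]; constructor <;> linarith [h2.1, h2.2]
  have hgd : Differentiable ℂ g := by
    have := differentiable_riemannZeta₁
    intro z
    have h := this (c + z)
    have : DifferentiableAt ℂ (fun z => riemannZeta₁ (c + z)) z :=
      DifferentiableAt.comp (g := riemannZeta₁) (f := fun z => c + z) z h (by fun_prop)
    exact this.mul_const _
  have hgne : ∀ z ∈ Metric.ball (0:ℂ) R, g z ≠ 0 := by
    intro z hz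
    exact mul_ne_zero (zeta1_ne_zero hRH (hre z hz).1) (inv_ne_zero hcne)
  have hg0 : g 0 = 1 := by simp [hg, hcne]
  have hq : DifferentiableOn ℂ (fun z => deriv g z / g z) (Metric.ball 0 R) := by
    intro z hz
    exact (DifferentiableAt.div (hgd.analyticAt z).deriv.differentiableAt (hgd z) (hgne z hz)).differentiableWithinAt
  obtain ⟨L, hL0, hL⟩ := hq.isExactOn_ball.with_val_at 0 0
  have hLd : DifferentiableOn ℂ L (Metric.ball 0 R) :=
    fun z hz => (hL z hz).differentiableAt.differentiableWithinAt
  have hexp : ∀ z ∈ Metric.ball (0:ℂ) R, g z = Complex.exp (L z) := by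
    intro z hz
    have hRpos : 0 < R := by rw [hR]; linarith
    have key : ∀ w ∈ Metric.ball (0:ℂ) R, HasDerivAt (fun w => g w * Complex.exp (- L w)) 0 w := by
      intro w hw
      have h1 := (hgd w).hasDerivAt.fun_mul ((hL w hw).fun_neg.cexp)
      refine h1.congr_deriv ?_
      have h9 : g w * (deriv g w / g w) = deriv g w := by field_simp [hgne w hw]
      linear_combination -Complex.exp (- L w) * h9
    have hconst : g z * Complex.exp (- L z) = g 0 * Complex.exp (- L 0) := by
      refine (convex_ball (0:ℂ) R).is_const_of_fderivWithin_eq_zero (𝕜 := ℂ)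
        (f := fun w => g w * Complex.exp (- L w)) ?_ ?_ hz (Metric.mem_ball_self hRpos)
      · intro w hw; exact (key w hw).differentiableAt.differentiableWithinAt
      · intro w hw
        rw [fderivWithin_of_isOpen Metric.isOpen_ball hw]
        have := (key w hw).hasFDerivAt.fderiv
        rw [this]; ext; simp
    rw [hg0, hL0] at hconst
    simp at hconst
    rw [Complex.exp_neg] at hconst
    field_simp [Complex.exp_ne_zero] at hconst
    exact hconst
  set M : ℝ := C1 * Real.log (3 + |s.im|) with hM
  have hlog := one_le_log3 s.im
  have hMpos : 0 < M := by positivity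
  have hmaps : Set.MapsTo L (Metric.ball 0 R) {z | z.re ≤ M} := by
    intro z hz
    show (L z).re ≤ M
    have h1 : ‖g z‖ = Real.exp (L z).re := by rw [hexp z hz, Complex.norm_exp]
    have h2 : (L z).re = Real.log ‖g z‖ := by rw [h1, Real.log_exp]
    have him : |(c+z).im| ≤ |s.im| + 2 := by
      rw [Complex.add_im, hcim]
      have := Complex.abs_im_le_norm z
      rw [mem_ball_zero_iff] at hz
      refine (abs_add_le _ _).trans ?_
      have : R ≤ 2 := by rw [hR]; linarith
      linarith
    have h3 : ‖g z‖ ≤ (20 * K) * (3 + |s.im|) ^ 4 := by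
      rw [hg]
      simp only [norm_mul]
      have hz1 := zeta1_bd (hre z hz).1 (hre z hz).2
      have hz2 := hK c hcre
      have ha := abs_nonneg s.im
      have hp : (3 + |(c+z).im|) ^ 2 ≤ (3 + |s.im|) ^ 4 := by
        have h5 : 3 + |(c+z).im| ≤ (3 + |s.im|) ^ 2 := by nlinarith
        calc (3 + |(c+z).im|) ^ 2 ≤ ((3 + |s.im|) ^ 2) ^ 2 := by gcongr
          _ = _ := by ring
      calc ‖riemannZeta₁ (c + z)‖ * ‖(riemannZeta₁ c)⁻¹‖
          ≤ (20 * (3 + |(c+z).im|) ^ 2) * K := by gcongr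
        _ ≤ (20 * (3 + |s.im|) ^ 4) * K := by gcongr
        _ = _ := by ring
    rw [h2]
    have h4 : 0 < ‖g z‖ := norm_pos_iff.2 (hgne z hz)
    refine (Real.log_le_log h4 h3).trans ?_
    have ha := abs_nonneg s.im
    rw [Real.log_mul (by positivity) (by positivity), Real.log_pow, hM, hC1]
    push_cast
    nlinarith
  have hBC : ∀ z : ℂ, ‖z‖ ≤ 3/2 - δ/2 → ‖L z‖ ≤ 12 * M / δ := by
    intro z hz
    have hzb : z ∈ Metric.ball (0:ℂ) R := by rw [mem_ball_zero_iff, hR]; linarith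
    have h := Complex.borelCaratheodory_zero hMpos hLd hmaps (by rw [hR]; linarith) hzb hL0
    refine h.trans ?_
    rw [div_le_div_iff₀ (by rw [hR]; linarith) hδ, hR]
    have h5 : ‖z‖ ≤ 3/2 := by linarith
    have h6 : δ / 4 ≤ 3 / 2 - δ / 4 - ‖z‖ := by linarith
    calc 2 * M * ‖z‖ * δ ≤ 2 * M * (3/2) * δ := by gcongr
      _ = 12 * M * (δ / 4) := by ring
      _ ≤ _ := by gcongr
  set z0 : ℂ := s - c with hz0
  have hz0n : ‖z0‖ ≤ 3/2 - δ := by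
    have : z0 = ((s.re - 2 : ℝ) : ℂ) := by
      apply Complex.ext <;> simp [hz0, hc]
    rw [this, Complex.norm_real, Real.norm_eq_abs, abs_le]; constructor <;> linarith
  have hz0b : z0 ∈ Metric.ball (0:ℂ) R := by rw [mem_ball_zero_iff, hR]; linarith
  have hsub : Metric.closedBall z0 (δ/2) ⊆ Metric.ball 0 R := by
    intro w hw
    rw [mem_closedBall_iff_norm] at hw
    rw [mem_ball_zero_iff]
    have := norm_add_le (w - z0) z0
    rw [sub_add_cancel] at this
    rw [hR]; linarith
  have hder := Complex.norm_deriv_le_of_forall_mem_sphere_norm_le (c := z0) (R := δ/2) (f := L)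
    (C := 12 * M / δ) (by positivity) (DifferentiableOn.diffContOnCl (hLd.mono
      (Metric.closure_ball_subset_closedBall.trans hsub))) (by
      intro w hw
      rw [mem_sphere_iff_norm] at hw
      apply hBC
      have := norm_add_le (w - z0) z0
      rw [sub_add_cancel] at this
      linarith)
  rw [(hL z0 hz0b).deriv] at hder
  have hgz : deriv g z0 / g z0 = deriv riemannZeta₁ s / riemannZeta₁ s := by
    have hcs : c + z0 = s := by rw [hz0]; ring
    have h1 : deriv g z0 = deriv riemannZeta₁ s * (riemannZeta₁ c)⁻¹ := by
      rw [hg, deriv_mul_const_field, deriv_comp_const_add, hcs]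
    rw [h1, hg]
    simp only [hcs]
    have := zeta1_ne_zero hRH (show 1/2 < s.re by linarith)
    field_simp
  rw [hgz] at hder
  refine hder.trans (le_of_eq ?_)
  rw [hM]; field_simp; ring


lemma Dl_intervalIntegrable (a b : ℝ) : IntervalIntegrable Dl MeasureTheory.volume a b :=
  (Chebyshev.psi_mono.intervalIntegrable).sub intervalIntegral.intervalIntegrable_id

/-- The integral of `Dl`. -/
noncomputable def AA (x : ℝ) : ℝ := ∫ t in (1:ℝ)..x, Dl t

lemma AA_cont : Continuous AA := intervalIntegral.continuous_primitive Dl_intervalIntegrable 1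

lemma AA_one : AA 1 = 0 := by simp [AA]

lemma Dl_bd : ∀ t > (1:ℝ), |Dl t| ≤ 7 * t ^ (1:ℝ) := by
  intro t ht
  rw [Real.rpow_one, Dl, abs_le]
  have h1 := Chebyshev.psi_nonneg t
  have h2 := Chebyshev.psi_le_const_mul_self (x := t) (by linarith)
  have h3 : Real.log 4 ≤ 2 := by
    have : Real.log 4 = 2 * Real.log 2 := by
      rw [show (4:ℝ) = 2 ^ 2 by norm_num, Real.log_pow]; norm_num
    have := Real.log_two_lt_d9
    linarith
  constructor <;> nlinarith

lemma AA_bd : ∀ t > (1:ℝ), |AA t| ≤ 7 * t ^ (2:ℝ) := by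
  intro t ht
  have h : ‖∫ v in (1:ℝ)..t, Dl v‖ ≤ (7 * t) * |t - 1| := by
    refine intervalIntegral.norm_integral_le_of_norm_le_const ?_
    intro v hv
    rw [Set.uIoc_of_le ht.le] at hv
    have := Dl_bd v hv.1
    rw [Real.rpow_one] at this
    rw [Real.norm_eq_abs]
    linarith [hv.2]
  rw [AA, ← Real.norm_eq_abs]
  refine h.trans ?_
  rw [abs_of_pos (by linarith), Real.rpow_two]
  nlinarith

lemma AA_hasDeriv {t : ℝ} (ht : ContinuousAt Chebyshev.psi t) : HasDerivAt AA (Dl t) t := by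
  refine intervalIntegral.integral_hasDerivAt_right (Dl_intervalIntegrable _ _) ?_ ?_
  · exact Dl_measurable.stronglyMeasurable.stronglyMeasurableAtFilter
  · exact ht.sub continuousAt_id

lemma TT_AA {s : ℂ} (hs : 1 < s.re) : (s + 1) * TT AA (s + 1) = TT Dl s := by
  have hs1 : (2:ℝ) < (s+1).re := by simp; linarith
  have i1 := TT_integrable AA_cont.measurable AA_bd hs1
  have i2 := TT_integrable Dl_measurable Dl_bd hs
  have key : ∀ N ≥ (1:ℝ), ∫ t in (1:ℝ)..N, ((Dl t : ℂ) * (t:ℂ) ^ (-(s+1)) -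
      (s + 1) * ((AA t : ℂ) * (t:ℂ) ^ (-(s+1+1)))) = (AA N : ℂ) * (N:ℂ) ^ (-(s+1)) := by
    intro N hN
    have h := MeasureTheory.integral_eq_of_hasDerivAt_off_countable
      (fun t : ℝ => (AA t : ℂ) * (t:ℂ) ^ (-(s+1)))
      (fun t : ℝ => (Dl t : ℂ) * (t:ℂ) ^ (-(s+1)) -
      (s + 1) * ((AA t : ℂ) * (t:ℂ) ^ (-(s+1+1)))) (a := 1) (b := N)
      Chebyshev.psi_mono.countable_not_continuousAt ?_ ?_ ?_
    · rw [h, AA_one]; simp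
    · rw [Set.uIcc_of_le hN]
      intro t ht
      refine ContinuousAt.continuousWithinAt ?_
      refine ContinuousAt.mul (Complex.continuous_ofReal.comp AA_cont).continuousAt ?_
      exact Complex.continuousAt_ofReal_cpow_const t _ (Or.inr (by linarith [ht.1]))
    · rw [min_eq_left hN, max_eq_right hN]
      intro t ht
      have ht1 : 1 < t := ht.1.1
      have hc : ContinuousAt Chebyshev.psi t := by
        have := ht.2; simpa using this
      have h1 := (AA_hasDeriv hc).ofReal_comp
      have h2 : HasDerivAt (fun t : ℝ => (t:ℂ) ^ (-(s+1))) (-(s+1) * (t:ℂ) ^ (-(s+1) - 1)) t := by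
        have hne : -(s+1) ≠ 0 := by
          intro h; have := congrArg Complex.re h; simp at this; linarith
        exact hasDerivAt_ofReal_cpow_const (by linarith) hne
      refine (h1.mul h2).congr_deriv ?_
      rw [show -(s+1+1) = -(s+1) - 1 by ring]
      ring
    · rw [intervalIntegrable_iff_integrableOn_Ioc_of_le hN]
      exact ((i2.sub (i1.const_mul (s+1))).mono_set Set.Ioc_subset_Ioi_self)
  have hlim := MeasureTheory.intervalIntegral_tendsto_integral_Ioi (1:ℝ) (i2.sub (i1.const_mul (s+1))) tendsto_id
  have hlim2 : Tendsto (fun N : ℝ => (AA N : ℂ) * (N:ℂ) ^ (-(s+1))) atTop (nhds 0) := by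
    rw [tendsto_zero_iff_norm_tendsto_zero]
    have hb : Tendsto (fun N : ℝ => 7 * N ^ (-(s.re - 1))) atTop (nhds 0) := by
      simpa using (tendsto_rpow_neg_atTop (show 0 < s.re - 1 by linarith)).const_mul 7
    refine squeeze_zero' (Eventually.of_forall fun _ => norm_nonneg _) ?_ hb
    filter_upwards [eventually_gt_atTop 1] with N hN
    have hN0 : 0 < N := by linarith
    rw [norm_mul, Complex.norm_cpow_eq_rpow_re_of_pos hN0, Complex.norm_real, Real.norm_eq_abs]
    calc |AA N| * N ^ (-(s+1)).re ≤ 7 * N ^ (2:ℝ) * N ^ (-(s+1)).re := by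
          gcongr; exact AA_bd N hN
      _ = 7 * N ^ (-(s.re - 1)) := by
          rw [mul_assoc, ← Real.rpow_add hN0]; congr 2; simp; ring
  have heq : ∫ t in Set.Ioi (1:ℝ), ((Dl t : ℂ) * (t:ℂ) ^ (-(s+1)) -
      (s + 1) * ((AA t : ℂ) * (t:ℂ) ^ (-(s+1+1)))) = 0 := by
    refine tendsto_nhds_unique hlim (hlim2.congr' ?_)
    filter_upwards [eventually_ge_atTop 1] with N hN
    exact (key N hN).symm
  rw [MeasureTheory.integral_sub i2 (i1.const_mul _), MeasureTheory.integral_const_mul] at heq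
  rw [TT, TT]
  exact (sub_eq_zero.1 heq).symm


/-- The kernel `𝒟(s)/(s+1)`. -/
noncomputable def HH (s : ℂ) : ℂ := -(deriv riemannZeta₁ s / riemannZeta₁ s + 1) / (s * (s + 1))

lemma HH_diff (hRH : RiemannHypothesis) {s : ℂ} (hs : 1/2 < s.re) : DifferentiableAt ℂ HH s := by
  have h1 := (differentiable_riemannZeta₁.analyticAt s).deriv.differentiableAt
  have h2 := differentiable_riemannZeta₁ s
  have h3 := zeta1_ne_zero hRH hs
  have h4 : s * (s + 1) ≠ 0 := by
    refine mul_ne_zero ?_ ?_ <;> intro h <;> have := congrArg Complex.re h <;> simp at this <;> linarith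
  unfold HH
  exact (((h1.div h2 h3).add_const 1).neg).div (by fun_prop) h4

lemma HH_num_bd (hRH : RiemannHypothesis) {δ κ : ℝ} (hδ : 0 < δ) (hδ1 : δ < 1) (hκ : 0 < κ) :
    ∃ C : ℝ, 0 < C ∧ ∀ s : ℂ, 1/2 + δ ≤ s.re → s.re ≤ 2 →
      ‖deriv riemannZeta₁ s / riemannZeta₁ s + 1‖ ≤ C * (1 + s.im ^ 2) ^ κ := by
  obtain ⟨C, hC, h⟩ := logder_bd hRH hδ hδ1
  refine ⟨(C + 1) * (5 ^ (2 * κ) / (2 * κ)), by positivity, ?_⟩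
  intro s h1 h2
  have hl := one_le_log3 s.im
  have hw : 3 + |s.im| ≤ 5 * (1 + s.im ^ 2) ^ (1/2 : ℝ) := by
    rw [← Real.sqrt_eq_rpow]
    have h5 : (1 + |s.im|) / 2 ≤ √(1 + s.im ^ 2) := by
      apply Real.le_sqrt_of_sq_le
      nlinarith [sq_abs s.im, sq_nonneg (|s.im| - 1)]
    have h6 : 1 ≤ √(1 + s.im ^ 2) := by
      apply Real.le_sqrt_of_sq_le; nlinarith [sq_nonneg s.im]
    linarith
  have hlog : Real.log (3 + |s.im|) ≤ (5 ^ (2 * κ) / (2 * κ)) * (1 + s.im ^ 2) ^ κ := by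
    refine (Real.log_le_rpow_div (by positivity) (show 0 < 2 * κ by positivity)).trans ?_
    have : (3 + |s.im|) ^ (2 * κ) ≤ 5 ^ (2 * κ) * (1 + s.im ^ 2) ^ κ := by
      calc (3 + |s.im|) ^ (2 * κ) ≤ (5 * (1 + s.im ^ 2) ^ (1/2 : ℝ)) ^ (2 * κ) :=
            Real.rpow_le_rpow (by positivity) hw (by positivity)
        _ = _ := by
            rw [Real.mul_rpow (by positivity) (by positivity), ← Real.rpow_mul (by positivity)]
            congr 2; ring
    calc (3 + |s.im|) ^ (2 * κ) / (2 * κ) ≤ (5 ^ (2 * κ) * (1 + s.im ^ 2) ^ κ) / (2 * κ) := by gcongr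
      _ = _ := by ring
  calc _ ≤ ‖deriv riemannZeta₁ s / riemannZeta₁ s‖ + 1 := by
        refine (norm_add_le _ _).trans ?_; simp
    _ ≤ C * Real.log (3 + |s.im|) + Real.log (3 + |s.im|) := add_le_add (h s h1 h2) hl
    _ = (C + 1) * Real.log (3 + |s.im|) := by ring
    _ ≤ (C + 1) * ((5 ^ (2 * κ) / (2 * κ)) * (1 + s.im ^ 2) ^ κ) := by gcongr
    _ = _ := by ring

lemma norm_s_lower {s : ℂ} (hs : 1/2 ≤ s.re) : (1 + s.im ^ 2) ^ (1/2:ℝ) / 2 ≤ ‖s‖ := by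
  rw [← Real.sqrt_eq_rpow]
  have h : ‖s‖ = √(s.re ^ 2 + s.im ^ 2) := by
    rw [Complex.norm_eq_sqrt_sq_add_sq]
  rw [h]
  apply Real.le_sqrt_of_sq_le
  rw [div_pow, Real.sq_sqrt (by positivity)]
  nlinarith [sq_nonneg s.im]

lemma norm_s1_lower {s : ℂ} (hs : 0 ≤ s.re) : (1 + s.im ^ 2) ^ (1/2:ℝ) ≤ ‖s + 1‖ := by
  rw [← Real.sqrt_eq_rpow]
  have h : ‖s + 1‖ = √((s.re + 1) ^ 2 + s.im ^ 2) := by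
    rw [Complex.norm_eq_sqrt_sq_add_sq]; simp
  rw [h]
  apply Real.sqrt_le_sqrt
  nlinarith [sq_nonneg s.im]

lemma HH_bd (hRH : RiemannHypothesis) {δ : ℝ} (hδ : 0 < δ) (hδ1 : δ < 1) :
    ∃ C : ℝ, 0 < C ∧ ∀ s : ℂ, 1/2 + δ ≤ s.re → s.re ≤ 2 →
      ‖HH s‖ ≤ C * (1 + s.im ^ 2) ^ (-(3/2:ℝ)/2) := by
  obtain ⟨C, hC, h⟩ := HH_num_bd hRH hδ hδ1 (show (0:ℝ) < 1/4 by norm_num)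
  refine ⟨2 * C, by positivity, ?_⟩
  intro s h1 h2
  have hw : 0 < 1 + s.im ^ 2 := by positivity
  have e1 := norm_s_lower (s := s) (by linarith)
  have e2 := norm_s1_lower (s := s) (by linarith)
  have e3 : (1 + s.im ^ 2) / 2 ≤ ‖s * (s + 1)‖ := by
    rw [norm_mul]
    calc (1 + s.im ^ 2) / 2 = ((1 + s.im ^ 2) ^ (1/2:ℝ) / 2) * (1 + s.im ^ 2) ^ (1/2:ℝ) := by
          rw [div_mul_eq_mul_div, ← Real.rpow_add hw]; norm_num
      _ ≤ _ := by gcongr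
  rw [HH, norm_div, norm_neg]
  calc _ ≤ (C * (1 + s.im ^ 2) ^ (1/4:ℝ)) / ((1 + s.im ^ 2) / 2) := by
        gcongr; exact h s h1 h2
    _ = 2 * C * ((1 + s.im ^ 2) ^ (1/4:ℝ) * (1 + s.im ^ 2) ^ (-1:ℝ)) := by
        rw [Real.rpow_neg_one]; field_simp
    _ = _ := by rw [← Real.rpow_add hw]; norm_num

lemma TT_AA_eq {s : ℂ} (hs : 1 < s.re) : TT AA (s + 1) = HH s := by
  have h1 : s ≠ 0 := by rintro rfl; simp at hs; linarith
  have h2 : s + 1 ≠ 0 := by intro h; have := congrArg Complex.re h; simp at this; linarith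
  have e1 := TT_AA hs
  have e2 := TT_Dl_formula hs
  rw [HH, eq_div_iff (mul_ne_zero h1 h2)]
  linear_combination e2 + s * e1

/-- Vertical line integral. -/
noncomputable def VI (x σ : ℝ) : ℂ :=
  ∫ τ : ℝ, HH (σ + τ * Complex.I) * (x:ℂ) ^ ((σ + τ * Complex.I : ℂ) + 1)

lemma w_integrable {r : ℝ} (hr : 1 < r) :
    MeasureTheory.Integrable (fun τ : ℝ => (1 + τ ^ 2) ^ (-r / 2)) := by
  have := integrable_rpow_neg_one_add_norm_sq (E := ℝ) (μ := MeasureTheory.volume) (r := r) (by simpa)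
  simpa using this

lemma VI_integrand_bd (hRH : RiemannHypothesis) {δ x : ℝ} (hδ : 0 < δ) (hδ1 : δ < 1) (hx : 1 ≤ x) :
    ∃ C : ℝ, 0 < C ∧ ∀ s : ℂ, 1/2 + δ ≤ s.re → s.re ≤ 2 →
      ‖HH s * (x:ℂ) ^ (s + 1)‖ ≤ C * (1 + s.im ^ 2) ^ (-(3/2:ℝ)/2) := by
  obtain ⟨C, hC, h⟩ := HH_bd hRH hδ hδ1
  refine ⟨C * x ^ (3:ℝ), by positivity, ?_⟩
  intro s h1 h2
  rw [norm_mul, Complex.norm_cpow_eq_rpow_re_of_pos (by linarith)]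
  calc _ ≤ (C * (1 + s.im ^ 2) ^ (-(3/2:ℝ)/2)) * x ^ (3:ℝ) := by
        gcongr
        · exact h s h1 h2
        · simp; linarith
    _ = _ := by ring

lemma VI_diff (hRH : RiemannHypothesis) {x : ℝ} (hx : 1 ≤ x) {s : ℂ} (hs : 1/2 < s.re) :
    DifferentiableAt ℂ (fun s : ℂ => HH s * (x:ℂ) ^ (s + 1)) s := by
  have h1 := HH_diff hRH hs
  have hx0 : (x:ℂ) ≠ 0 := by norm_cast; linarith
  refine h1.mul ?_
  exact DifferentiableAt.const_cpow (by fun_prop) (Or.inl hx0)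

lemma VI_integrable (hRH : RiemannHypothesis) {δ x σ : ℝ} (hδ : 0 < δ) (hδ1 : δ < 1) (hx : 1 ≤ x)
    (h1 : 1/2 + δ ≤ σ) (h2 : σ ≤ 2) :
    MeasureTheory.Integrable (fun τ : ℝ => HH (σ + τ * Complex.I) * (x:ℂ) ^ ((σ + τ * Complex.I : ℂ) + 1)) := by
  obtain ⟨C, hC, h⟩ := VI_integrand_bd hRH hδ hδ1 hx
  refine MeasureTheory.Integrable.mono' ((w_integrable (show (1:ℝ) < 3/2 by norm_num)).const_mul C) ?_ ?_
  · refine Continuous.aestronglyMeasurable ?_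
    rw [continuous_iff_continuousAt]
    intro τ
    have hc := (VI_diff hRH hx (s := σ + τ * Complex.I) (by simp; linarith)).continuousAt
    exact ContinuousAt.comp (f := fun τ : ℝ => (σ + τ * Complex.I : ℂ))
      (g := fun s : ℂ => HH s * (x:ℂ) ^ (s + 1)) hc (by fun_prop)
  · refine Eventually.of_forall ?_
    intro τ
    have := h (σ + τ * Complex.I) (by simpa using h1) (by simpa using h2)
    simpa using this

lemma VI_shift (hRH : RiemannHypothesis) {δ x : ℝ} (hδ : 0 < δ) (hδ1 : δ < 1) (hx : 1 ≤ x) :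
    VI x 2 = VI x (1/2 + δ) := by
  set F : ℂ → ℂ := fun s => HH s * (x:ℂ) ^ (s + 1) with hF
  set σ : ℝ := 1/2 + δ with hσ
  obtain ⟨C, hC, hb⟩ := VI_integrand_bd hRH hδ hδ1 hx
  have i1 := VI_integrable hRH hδ hδ1 hx (le_refl σ) (by rw [hσ]; linarith)
  have i2 := VI_integrable hRH hδ hδ1 hx (show 1/2 + δ ≤ 2 by linarith) (le_refl 2)
  have l1 := MeasureTheory.intervalIntegral_tendsto_integral i1 tendsto_neg_atTop_atBot tendsto_id
  have l2 := MeasureTheory.intervalIntegral_tendsto_integral i2 tendsto_neg_atTop_atBot tendsto_id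
  have hor : ∀ T : ℝ, ‖∫ v in σ..2, F (v + T * Complex.I)‖ ≤ C * (1 + T ^ 2) ^ (-(3/2:ℝ)/2) * |2 - σ| := by
    intro T
    refine intervalIntegral.norm_integral_le_of_norm_le_const ?_
    intro v hv
    rw [Set.uIoc_of_le (by rw [hσ]; linarith)] at hv
    have := hb (v + T * Complex.I) (by simp; linarith [hv.1]) (by simpa using hv.2)
    simpa [hF] using this
  have lim0 : Tendsto (fun T : ℝ => C * (1 + T ^ 2) ^ (-(3/2:ℝ)/2) * |2 - σ|) atTop (nhds 0) := by
    have h1 : Tendsto (fun T : ℝ => 1 + T ^ 2) atTop atTop :=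
      tendsto_atTop_add_const_left _ _ (tendsto_pow_atTop (by norm_num))
    have h2 := (tendsto_rpow_neg_atTop (show (0:ℝ) < 3/2/2 by norm_num)).comp h1
    have h3 := (h2.const_mul C).mul_const |2 - σ|
    simp only [mul_zero, zero_mul] at h3
    refine h3.congr ?_
    intro T; simp only [Function.comp]; norm_num
  have lh1 : Tendsto (fun T : ℝ => ∫ v in σ..2, F (v + T * Complex.I)) atTop (nhds 0) :=
    squeeze_zero_norm hor lim0
  have lh2 : Tendsto (fun T : ℝ => ∫ v in σ..2, F (v + (-T : ℝ) * Complex.I)) atTop (nhds 0) := by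
    refine squeeze_zero_norm (fun T => ?_) lim0
    have := hor (-T)
    rwa [neg_sq] at this
  have rect : ∀ T : ℝ, ((∫ v in σ..2, F (v + (-T : ℝ) * Complex.I)) - ∫ v in σ..2, F (v + T * Complex.I)) +
      Complex.I • (∫ τ in (-T)..T, F ((2:ℝ) + τ * Complex.I)) - Complex.I • (∫ τ in (-T)..T, F (σ + τ * Complex.I)) = 0 := by
    intro T
    have := Complex.integral_boundary_rect_eq_zero_of_differentiableOn F ⟨σ, -T⟩ ⟨2, T⟩ (by
      intro s hs
      have h1 := hs.1
      simp only [Set.mem_preimage] at h1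
      rw [Set.uIcc_of_le (by rw [hσ]; linarith)] at h1
      exact (VI_diff hRH hx (by have := h1.1; rw [hσ] at this; linarith)).differentiableWithinAt)
    exact this
  have lim := (((lh2.sub lh1).add (l2.const_smul Complex.I)).sub (l1.const_smul Complex.I))
  have hz := tendsto_nhds_unique (lim.congr (fun T => rect T)) tendsto_const_nhds
  simp only [sub_zero, zero_add, smul_eq_mul] at hz
  have h3 := mul_left_cancel₀ Complex.I_ne_zero (sub_eq_zero.1 hz)
  exact h3

lemma AA_inv (hRH : RiemannHypothesis) {x : ℝ} (hx : 1 < x) :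
    (AA x : ℂ) = (1 / (2 * π) : ℝ) * VI x 2 := by
  set f : ℝ → ℂ := (Set.Ioi (1:ℝ)).indicator (fun t => (AA t : ℂ)) with hf
  have hm : ∀ z, mellin f z = TT AA (-z) := by
    intro z
    rw [mellin, TT, hf]
    rw [← MeasureTheory.integral_indicator measurableSet_Ioi,
      ← MeasureTheory.integral_indicator measurableSet_Ioi]
    congr 1
    ext t
    by_cases h : 1 < t
    · have h0 : 0 < t := by linarith
      simp [Set.indicator, h, h0, mul_comm]
      left; congr 1; ring
    · simp [Set.indicator, h]
  have hline : ∀ τ : ℝ, mellin f ((-3:ℝ) + τ * Complex.I) = HH ((2:ℝ) + (-τ : ℝ) * Complex.I) := by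
    intro τ
    rw [hm, ← TT_AA_eq (by simp)]
    congr 1; push_cast; ring
  have hconv : MellinConvergent f ((-3:ℝ) : ℂ) := by
    rw [MellinConvergent]
    have i1 := TT_integrable AA_cont.measurable AA_bd (s := 3) (by norm_num)
    have : (fun t : ℝ => (t:ℂ) ^ (((-3:ℝ):ℂ) - 1) • f t) = (Set.Ioi (1:ℝ)).indicator
        (fun t : ℝ => (AA t : ℂ) * (t:ℂ) ^ (-((3:ℂ) + 1))) := by
      ext t
      by_cases h : 1 < t
      · simp [hf, Set.indicator, h, mul_comm]
        left; congr 1; norm_num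
      · simp [hf, Set.indicator, h]
    rw [this]
    exact (MeasureTheory.IntegrableOn.integrable_indicator i1 measurableSet_Ioi).integrableOn
  have i2 := VI_integrable hRH (show (0:ℝ) < 1/2 by norm_num) (by norm_num) (le_refl (1:ℝ)) (show (1/2 + 1/2 : ℝ) ≤ 2 by norm_num) (le_refl 2)
  have hvert : Complex.VerticalIntegrable (mellin f) (-3) := by
    rw [Complex.VerticalIntegrable]
    simp only [hline]
    have := i2.comp_neg
    simpa using this
  have hcont : ContinuousAt f x := by
    have : f =ᶠ[nhds x] fun t => (AA t : ℂ) := by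
      filter_upwards [Ioi_mem_nhds hx] with t ht
      simp only [hf, Set.indicator, ht, if_true]
    exact (continuousAt_congr this).2 (Complex.continuous_ofReal.comp AA_cont).continuousAt
  have h := mellinInv_mellin_eq (-3) f (by linarith) hconv hvert hcont
  have hfx : f x = AA x := by simp [hf, Set.indicator, hx]
  rw [hfx, mellinInv] at h
  have e : VI x 2 = ∫ τ : ℝ, HH ((2:ℝ) + ((-τ : ℝ) : ℂ) * Complex.I) *
      (x:ℂ) ^ ((((2:ℝ):ℂ) + ((-τ : ℝ):ℂ) * Complex.I) + 1) :=
    (MeasureTheory.integral_neg_eq_self (fun τ : ℝ => HH ((2:ℝ) + (τ : ℂ) * Complex.I) *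
      (x:ℂ) ^ ((((2:ℝ):ℂ) + (τ :ℂ) * Complex.I) + 1)) _).symm
  rw [← h, e]
  simp only [hline]
  rw [Complex.real_smul]
  congr 2
  ext τ
  rw [smul_eq_mul, mul_comm]
  congr 2
  push_cast; ring


lemma cpow_diff_bd {x κ : ℝ} (hx : 1 ≤ x) (hκ : 0 < κ) (hκ1 : κ < 1) {s : ℂ} (hs : 0 ≤ s.re) :
    ‖((x + 1 : ℝ):ℂ) ^ (s + 1) - (x:ℂ) ^ (s + 1)‖ ≤
      2 * ‖s + 1‖ ^ (1 - κ) * (x + 1) ^ (s.re + κ) := by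
  have hs1 : s + 1 ≠ 0 := by intro h; have := congrArg Complex.re h; simp at this; linarith
  set m := ‖((x + 1 : ℝ):ℂ) ^ (s + 1) - (x:ℂ) ^ (s + 1)‖ with hm
  have hm0 : 0 ≤ m := norm_nonneg _
  have ha : m ≤ ‖s + 1‖ * (x + 1) ^ s.re := by
    have := Convex.norm_image_sub_le_of_norm_hasDerivWithin_le (𝕜 := ℝ)
      (f := fun t : ℝ => (t:ℂ) ^ (s + 1)) (f' := fun t : ℝ => (s + 1) * (t:ℂ) ^ (s + 1 - 1))
      (s := Set.Icc x (x + 1)) (C := ‖s + 1‖ * (x + 1) ^ s.re) (x := x) (y := x + 1)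
      (by
        intro t ht
        exact (hasDerivAt_ofReal_cpow_const (by linarith [ht.1]) hs1).hasDerivWithinAt)
      (by
        intro t ht
        have ht0 : 0 < t := by linarith [ht.1]
        rw [norm_mul, Complex.norm_cpow_eq_rpow_re_of_pos ht0]
        simp only [add_sub_cancel_right]
        gcongr
        exact ht.2)
      (convex_Icc _ _) (by simp) (by simp)
    simpa [hm] using this
  have hb : m ≤ 2 * (x + 1) ^ (s.re + 1) := by
    refine (norm_sub_le _ _).trans ?_
    rw [Complex.norm_cpow_eq_rpow_re_of_pos (by linarith), Complex.norm_cpow_eq_rpow_re_of_pos (by linarith)]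
    have : x ^ (s + 1).re ≤ (x + 1) ^ (s + 1).re :=
      Real.rpow_le_rpow (by linarith) (by linarith) (by simp; linarith)
    simp only [Complex.add_re, Complex.one_re] at this ⊢
    linarith
  have hx1 : 0 < x + 1 := by linarith
  have hsp : 0 < ‖s + 1‖ := norm_pos_iff.2 hs1
  calc m = m ^ (1 - κ) * m ^ κ := by
        rw [← Real.rpow_add_of_nonneg hm0 (by linarith) hκ.le]; simp
    _ ≤ (‖s + 1‖ * (x + 1) ^ s.re) ^ (1 - κ) * (2 * (x + 1) ^ (s.re + 1)) ^ κ := by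
        gcongr
    _ = 2 ^ κ * ‖s + 1‖ ^ (1 - κ) * (x + 1) ^ (s.re + κ) := by
        rw [Real.mul_rpow (by positivity) (by positivity), Real.mul_rpow (by positivity) (by positivity),
          ← Real.rpow_mul hx1.le, ← Real.rpow_mul hx1.le]
        rw [show s.re + κ = s.re * (1 - κ) + (s.re + 1) * κ by ring, Real.rpow_add hx1]
        ring
    _ ≤ 2 ^ (1:ℝ) * ‖s + 1‖ ^ (1 - κ) * (x + 1) ^ (s.re + κ) := by
        gcongr
        · norm_num
    _ = _ := by rw [Real.rpow_one]

lemma AA_diff_bd (hRH : RiemannHypothesis) {δ : ℝ} (hδ : 0 < δ) (hδ1 : δ < 1) :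
    ∃ C : ℝ, 0 < C ∧ ∀ x > (1:ℝ), |AA (x + 1) - AA x| ≤ C * (x + 1) ^ (1/2 + 2 * δ) := by
  obtain ⟨C1, hC1, h1⟩ := HH_num_bd hRH hδ hδ1 (show 0 < δ / 4 by positivity)
  set I : ℝ := ∫ τ : ℝ, (1 + τ ^ 2) ^ (-(1 + δ/2) / 2) with hI
  have hI0 : 0 ≤ I := MeasureTheory.integral_nonneg (fun τ => by positivity)
  refine ⟨4 * C1 * I + 1, by positivity, ?_⟩
  intro x hx
  set σ : ℝ := 1/2 + δ with hσ
  have iw := (w_integrable (show 1 < 1 + δ/2 by linarith)).const_mul (4 * C1 * (x + 1) ^ (σ + δ))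
  have i1 := VI_integrable hRH hδ hδ1 hx.le (le_refl σ) (by rw [hσ]; linarith)
  have i2 := VI_integrable hRH hδ hδ1 (show 1 ≤ x + 1 by linarith) (le_refl σ) (by rw [hσ]; linarith)
  have e : ((AA (x + 1) - AA x : ℝ) : ℂ) = (1 / (2 * π) : ℝ) *
      ∫ τ : ℝ, (HH (σ + τ * Complex.I) * ((x+1:ℝ):ℂ) ^ ((σ + τ * Complex.I : ℂ) + 1) -
        HH (σ + τ * Complex.I) * (x:ℂ) ^ ((σ + τ * Complex.I : ℂ) + 1)) := by
    rw [MeasureTheory.integral_sub i2 i1, Complex.ofReal_sub, AA_inv hRH hx,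
      AA_inv hRH (show 1 < x + 1 by linarith), VI_shift hRH hδ hδ1 hx.le,
      VI_shift hRH hδ hδ1 (show 1 ≤ x + 1 by linarith), VI, VI]
    ring
  have hbd : ‖∫ τ : ℝ, (HH (σ + τ * Complex.I) * ((x+1:ℝ):ℂ) ^ ((σ + τ * Complex.I : ℂ) + 1) -
        HH (σ + τ * Complex.I) * (x:ℂ) ^ ((σ + τ * Complex.I : ℂ) + 1))‖ ≤
        4 * C1 * (x + 1) ^ (σ + δ) * I := by
    rw [hI, ← MeasureTheory.integral_const_mul]
    refine MeasureTheory.norm_integral_le_of_norm_le iw (Eventually.of_forall ?_)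
    intro τ
    rw [← mul_sub, norm_mul]
    set s : ℂ := σ + τ * Complex.I with hs
    have hre : s.re = σ := by simp [hs]
    have him : s.im = τ := by simp [hs]
    have hσ0 : 1/2 < σ := by rw [hσ]; linarith
    have hd := cpow_diff_bd hx.le hδ hδ1 (s := s) (by rw [hre]; linarith)
    have hn := h1 s (by rw [hre]) (by rw [hre, hσ]; linarith)
    have e1 := norm_s_lower (s := s) (by rw [hre]; linarith)
    have e2 := norm_s1_lower (s := s) (by rw [hre]; linarith)
    rw [him] at hn e1 e2
    rw [hre] at hd
    have hw : 0 < 1 + τ ^ 2 := by positivity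
    have hsp1 : 0 < ‖s + 1‖ := lt_of_lt_of_le (by positivity) e2
    have hsp : 0 < ‖s‖ := lt_of_lt_of_le (by positivity) e1
    rw [HH, norm_div, norm_neg, norm_mul]
    calc _ ≤ (C1 * (1 + τ^2) ^ (δ/4)) / (‖s‖ * ‖s + 1‖) *
          (2 * ‖s + 1‖ ^ (1 - δ) * (x + 1) ^ (σ + δ)) := by gcongr
      _ = 2 * C1 * (x+1) ^ (σ + δ) * (1 + τ^2) ^ (δ/4) * (‖s‖⁻¹ * (‖s + 1‖ ^ δ)⁻¹) := by
          rw [Real.rpow_sub hsp1, Real.rpow_one]; field_simp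
      _ ≤ 2 * C1 * (x+1) ^ (σ + δ) * (1 + τ^2) ^ (δ/4) * (((1 + τ ^ 2) ^ (1/2:ℝ) / 2)⁻¹ *
            (((1 + τ ^ 2) ^ (1/2:ℝ)) ^ δ)⁻¹) := by gcongr
      _ = 4 * C1 * (x + 1) ^ (σ + δ) * (1 + τ ^ 2) ^ (-(1 + δ / 2) / 2) := by
          rw [← Real.rpow_mul hw.le, inv_div, div_eq_mul_inv (2:ℝ) ((1 + τ^2)^(1/2:ℝ)), ← Real.rpow_neg hw.le, ← Real.rpow_neg hw.le]
          rw [show -(1 + δ/2)/2 = δ/4 + (-(1/2) + -(1/2*δ)) by ring, Real.rpow_add hw, Real.rpow_add hw]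
          ring
  have hfin : |AA (x + 1) - AA x| ≤ 4 * C1 * (x + 1) ^ (σ + δ) * I := by
    rw [← Real.norm_eq_abs, ← Complex.norm_real, e, norm_mul]
    have hp : ‖((1 / (2 * π) : ℝ):ℂ)‖ ≤ 1 := by
      rw [Complex.norm_real, Real.norm_of_nonneg (by positivity)]
      rw [div_le_one (by positivity)]; linarith [Real.pi_gt_three]
    calc _ ≤ 1 * (4 * C1 * (x + 1) ^ (σ + δ) * I) := by gcongr
      _ = _ := one_mul _
  refine hfin.trans ?_
  rw [show σ + δ = 1/2 + 2 * δ by rw [hσ]; ring]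
  have : 0 ≤ (x + 1) ^ (1/2 + 2 * δ) := by positivity
  nlinarith

lemma psi_RH (hRH : RiemannHypothesis) {δ : ℝ} (hδ : 0 < δ) :
    ∃ C : ℝ, 0 < C ∧ ∀ x ≥ (1:ℝ), |Dl x| ≤ C * x ^ (1/2 + δ) := by
  set d : ℝ := min δ 1 / 4 with hd
  have hd0 : 0 < d := by rw [hd]; positivity
  have hd1 : d < 1 := by
    have := min_le_right δ 1
    rw [hd]; linarith
  have hdδ : 2 * d ≤ δ := by
    have := min_le_left δ 1
    rw [hd]; linarith
  obtain ⟨C, hC, h⟩ := AA_diff_bd hRH hd0 hd1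
  have h2e : 0 ≤ (2:ℝ) ^ (1/2 + 2 * d) := by positivity
  refine ⟨C * 2 ^ (1/2 + 2 * d) + 30, by positivity, ?_⟩
  intro x hx
  have hxp : 1 ≤ x ^ (1/2 + δ) := Real.one_le_rpow hx (by positivity)
  have hpow : ∀ z, 0 ≤ z → z ≤ 2 * x → z ^ (1/2 + 2 * d) ≤ 2 ^ (1/2 + 2*d) * x ^ (1/2 + δ) := by
    intro z hz hzx
    calc z ^ (1/2 + 2 * d) ≤ (2 * x) ^ (1/2 + 2 * d) := Real.rpow_le_rpow hz hzx (by positivity)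
      _ = 2 ^ (1/2 + 2*d) * x ^ (1/2 + 2 * d) := Real.mul_rpow (by norm_num) (by linarith)
      _ ≤ _ := by gcongr
  have hint : ∀ z : ℝ, AA (z + 1) - AA z = ∫ t in z..(z+1), Dl t := by
    intro z
    rw [AA, AA, intervalIntegral.integral_interval_sub_left (Dl_intervalIntegrable _ _) (Dl_intervalIntegrable _ _)]
  rcases le_or_gt x 3 with h3 | h3
  · have hb : |Dl x| ≤ 21 := by
      rcases eq_or_lt_of_le hx with rfl | hx'
      · rw [Dl, Chebyshev.psi_eq_zero_of_lt_two (by norm_num)]; norm_num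
      · have := Dl_bd x hx'
        rw [Real.rpow_one] at this; linarith
    have : 0 ≤ C * 2 ^ (1/2 + 2 * d) := by positivity
    nlinarith
  · rw [abs_le]
    constructor
    · have h4 := h (x - 1) (by linarith)
      rw [sub_add_cancel] at h4
      have h5 := hint (x - 1)
      rw [sub_add_cancel] at h5
      have h6 : ∫ t in (x-1)..x, Dl t ≤ ∫ t in (x-1)..x, (Dl x + 1) := by
        refine intervalIntegral.integral_mono_on (by linarith) (Dl_intervalIntegrable _ _) (by simp) ?_
        intro t ht
        have := Chebyshev.psi_mono ht.2
        simp only [Dl]; linarith [ht.1]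
      rw [intervalIntegral.integral_const] at h6
      simp at h6
      have h7 := hpow x (by linarith) (by linarith)
      have h8 := (abs_le.1 h4).1
      have h9 : C * x ^ (1/2 + 2*d) ≤ C * (2 ^ (1/2 + 2*d) * x ^ (1/2 + δ)) := by gcongr
      nlinarith
    · have h4 := h x (by linarith)
      have h5 := hint x
      have h6 : ∫ t in x..(x+1), (Dl x - 1) ≤ ∫ t in x..(x+1), Dl t := by
        refine intervalIntegral.integral_mono_on (by linarith) (by simp) (Dl_intervalIntegrable _ _) ?_
        intro t ht
        have := Chebyshev.psi_mono ht.1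
        simp only [Dl]; linarith [ht.2]
      rw [intervalIntegral.integral_const] at h6
      simp at h6
      have h7 := hpow (x + 1) (by linarith) (by linarith)
      have h8 := (abs_le.1 h4).2
      have h9 : C * (x+1) ^ (1/2 + 2*d) ≤ C * (2 ^ (1/2 + 2*d) * x ^ (1/2 + δ)) := by gcongr
      nlinarith


lemma TT_real (g : ℝ → ℝ) (α : ℝ) :
    TT g (α:ℂ) = ((∫ t in Set.Ioi (1:ℝ), g t * t ^ (-(α + 1)) : ℝ) : ℂ) := by
  rw [TT, ← integral_complex_ofReal]
  refine MeasureTheory.setIntegral_congr_fun measurableSet_Ioi ?_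
  intro t ht
  have ht : (1:ℝ) < t := ht
  simp only
  rw [Complex.ofReal_mul, Complex.ofReal_cpow (by linarith)]
  push_cast
  rfl

lemma real_integrable {g : ℝ → ℝ} (hg : Measurable g) {C a : ℝ}
    (hC : ∀ t > (1:ℝ), |g t| ≤ C * t ^ a) {α : ℝ} (hs : a < α) :
    MeasureTheory.IntegrableOn (fun t : ℝ => g t * t ^ (-(α + 1))) (Set.Ioi 1) := by
  have h := (TT_integrable hg hC (s := (α:ℂ)) (by simpa using hs)).re
  refine h.congr ?_
  refine (MeasureTheory.ae_restrict_mem measurableSet_Ioi).mono ?_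
  intro t ht
  have ht : (1:ℝ) < t := ht
  have : ((g t : ℝ) : ℂ) * (t:ℂ) ^ (-((α:ℂ) + 1)) = ((g t * t ^ (-(α + 1)) : ℝ) : ℂ) := by
    rw [Complex.ofReal_mul, Complex.ofReal_cpow (by linarith)]; push_cast; rfl
  simp only [this]
  exact RCLike.ofReal_re (K := ℂ) _

lemma TT_Dl_formula2 (hRH : RiemannHypothesis) {s : ℂ} (hs : 1/2 < s.re) :
    s * TT Dl s = - (deriv riemannZeta₁ s / riemannZeta₁ s) - 1 := by
  have hU : IsOpen {s : ℂ | (1/2:ℝ) < s.re} := isOpen_lt continuous_const Complex.continuous_re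
  have hf : AnalyticOnNhd ℂ (fun s : ℂ => s * TT Dl s) {s : ℂ | (1/2:ℝ) < s.re} := by
    refine DifferentiableOn.analyticOnNhd ?_ hU
    intro z hz
    have hz : 1/2 < z.re := hz
    obtain ⟨C, hC, h⟩ := psi_RH hRH (show 0 < (z.re - 1/2)/2 by linarith)
    have := TT_diff Dl_measurable (fun t ht => h t (le_of_lt ht)) (s := z) (by linarith)
    exact DifferentiableAt.differentiableWithinAt (by fun_prop)
  have hg : AnalyticOnNhd ℂ (fun s : ℂ => - (deriv riemannZeta₁ s / riemannZeta₁ s) - 1)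
      {s : ℂ | (1/2:ℝ) < s.re} := by
    intro z hz
    have h1 : AnalyticAt ℂ riemannZeta₁ z := differentiable_riemannZeta₁.analyticAt z
    exact ((h1.deriv.div h1 (zeta1_ne_zero hRH hz)).neg).sub analyticAt_const
  refine hf.eqOn_of_preconnected_of_eventuallyEq hg (halfplane_preconn (1/2)) (z₀ := 2)
    (by simp; norm_num) ?_ hs
  have : {s : ℂ | (1:ℝ) < s.re} ∈ nhds (2:ℂ) :=
    (isOpen_lt continuous_const Complex.continuous_re).mem_nhds (by simp)
  filter_upwards [this] with z hz
  exact TT_Dl_formula hz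

noncomputable def JJ (α : ℝ) : ℝ := ∫ t in Set.Ioi (1:ℝ), Int.fract t * t ^ (-(α + 1))

lemma JJ_integrable {α : ℝ} (hα : 0 < α) :
    MeasureTheory.IntegrableOn (fun t : ℝ => Int.fract t * t ^ (-(α + 1))) (Set.Ioi 1) :=
  real_integrable measurable_fract fract_bd hα

lemma JJ_anti {a b : ℝ} (ha : 0 < a) (hab : a ≤ b) : JJ b ≤ JJ a := by
  refine MeasureTheory.setIntegral_mono_on (JJ_integrable (by linarith)) (JJ_integrable ha)
    measurableSet_Ioi ?_
  intro t ht
  have ht : (1:ℝ) < t := ht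
  have := Int.fract_nonneg t
  gcongr
  exact ht.le

lemma JJ_one_pos : 0 < JJ 1 := by
  have h1 : ∫ t in Set.Ioc (3/2:ℝ) (7/4), (1/16:ℝ) ≤ JJ 1 := by
    calc _ ≤ ∫ t in Set.Ioc (3/2:ℝ) (7/4), Int.fract t * t ^ (-((1:ℝ) + 1)) := by
          refine MeasureTheory.setIntegral_mono_on (by simp)
            ((JJ_integrable one_pos).mono_set ?_) measurableSet_Ioc ?_
          · intro t ht; exact lt_trans (by norm_num) ht.1
          · intro t ht
            have ht1 := ht.1
            have ht2 := ht.2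
            have hf : Int.fract t = t - 1 := by
              rw [Int.fract_eq_iff]
              refine ⟨by linarith, by linarith, 1, by simp⟩
            have h4 : (1/4:ℝ) ≤ t ^ (-((1:ℝ)+1)) := by
              rw [Real.rpow_neg (by linarith), show (1:ℝ)+1 = (2:ℕ) by norm_num, Real.rpow_natCast]
              rw [one_div]
              gcongr
              nlinarith
            rw [hf]; nlinarith
      _ ≤ JJ 1 := by
          refine MeasureTheory.setIntegral_mono_set (JJ_integrable one_pos) ?_ ?_
          · refine (MeasureTheory.ae_restrict_mem measurableSet_Ioi).mono ?_
            intro t ht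
            have ht : (1:ℝ) < t := ht
            have := Int.fract_nonneg t
            simp only [Pi.zero_apply]
            positivity
          · refine Filter.Eventually.of_forall ?_
            intro t ht
            exact lt_trans (by norm_num) ht.1
  have h2 : ∫ t in Set.Ioc (3/2:ℝ) (7/4), (1/16:ℝ) = 1/64 := by
    rw [MeasureTheory.setIntegral_const]; norm_num
  linarith

lemma JJ_le {α : ℝ} (hα : 0 < α) : JJ α ≤ 1 / α := by
  have := TT_norm_le (g := fun t => Int.fract t) fract_bd (s := (α:ℂ)) (by simpa using hα)
  rw [TT_real, Complex.norm_real] at this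
  simp only [Complex.ofReal_re, sub_zero] at this
  exact (le_abs_self _).trans this

lemma JJ_hasDeriv {α : ℝ} (hα : 0 < α) : ∃ d, d ≤ 0 ∧ HasDerivAt JJ d α := by
  have h := TT_diff (g := fun t => Int.fract t) measurable_fract fract_bd (s := (α:ℂ)) (by simpa using hα)
  have h2 := h.hasDerivAt.real_of_complex
  have h3 : (fun x : ℝ => (TT (fun t => Int.fract t) (x:ℂ)).re) = JJ := by
    ext x; rw [TT_real, Complex.ofReal_re]; rfl
  rw [h3] at h2
  refine ⟨_, ?_, h2⟩
  have hanti : AntitoneOn JJ (Set.Ioi 0) := fun a ha b hb hab => JJ_anti ha hab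
  have h4 := hanti.derivWithin_nonpos (x := α)
  have h5 := h2.hasDerivWithinAt (s := Set.Ioi 0)
  rw [h5.derivWithin (uniqueDiffOn_Ioi 0 α hα)] at h4
  exact h4

lemma lemmaP (hRH : RiemannHypothesis) : ∃ c : ℝ, 0 < c ∧ ∀ α : ℝ, 1/2 < α → α ≤ 1 →
    c ≤ 1/α + 1 + α * ∫ t in Set.Ioi (1:ℝ), Dl t * t ^ (-(α + 1)) := by
  refine ⟨JJ 1 / 2, by linarith [JJ_one_pos], ?_⟩
  intro α h1 h2
  have hα : 0 < α := by linarith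
  obtain ⟨d, hd, hJ⟩ := JJ_hasDeriv hα
  have hz : HasDerivAt (fun x : ℝ => (riemannZeta₁ (x:ℂ)).re) (deriv riemannZeta₁ (α:ℂ)).re α :=
    (differentiable_riemannZeta₁ _).hasDerivAt.real_of_complex
  have hzr : ∀ x : ℝ, 0 < x → riemannZeta₁ (x:ℂ) = ((x - x * (x - 1) * JJ x : ℝ) : ℂ) := by
    intro x hx
    rw [zeta1_fract (by simpa using hx), TT_real]
    push_cast [JJ]; rfl
  have hF : HasDerivAt (fun x : ℝ => x - x * (x - 1) * JJ x)
      (1 - ((1 * (α - 1) + α * 1) * JJ α + α * (α - 1) * d)) α :=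
    (hasDerivAt_id α).sub (((hasDerivAt_id α).mul ((hasDerivAt_id α).sub_const 1)).mul hJ)
  have hder : (deriv riemannZeta₁ (α:ℂ)).re = 1 - ((1 * (α - 1) + α * 1) * JJ α + α * (α - 1) * d) := by
    refine hz.unique (hF.congr_of_eventuallyEq ?_)
    filter_upwards [lt_mem_nhds hα] with x hx
    rw [hzr x hx, Complex.ofReal_re]
  have hform := TT_Dl_formula2 hRH (s := (α:ℂ)) (by simpa using h1)
  rw [TT_real, hzr α hα] at hform
  have hform := congrArg Complex.re hform
  rw [← Complex.ofReal_mul, Complex.ofReal_re, Complex.sub_re, Complex.neg_re, Complex.div_ofReal_re,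
    hder, Complex.one_re] at hform
  rw [add_assoc, hform]
  have hJ1 := JJ_anti hα h2
  have hJp := JJ_one_pos
  have hJle := JJ_le hα
  set j := JJ α
  have hj2 : j ≤ 2 := hJle.trans (by rw [div_le_iff₀ hα]; linarith)
  have hFp : 0 < 1 + (1 - α) * j := by nlinarith
  have hF2 : 1 + (1 - α) * j ≤ 2 := by nlinarith
  have e : 1/α + (1 + (-((1 - ((1 * (α - 1) + α * 1) * j + α * (α - 1) * d)) / (α - α * (α - 1) * j)) - 1))
      = (j + (1 - α) * (-d)) / (1 + (1 - α) * j) := by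
    rw [show α - α * (α - 1) * j = α * (1 + (1 - α) * j) by ring,
      show 1 - ((1 * (α - 1) + α * 1) * j + α * (α - 1) * d) =
        (1 + (1 - α) * j) - α * (j + (1 - α) * (-d)) by ring]
    generalize 1 + (1 - α) * j = w at *
    field_simp
    ring
  rw [e, le_div_iff₀ hFp]
  nlinarith [mul_nonneg (sub_nonneg.2 h2) (neg_nonneg.2 hd)]


lemma mono_Icc {F F' : ℝ → ℝ} {a b : ℝ} (hab : a ≤ b) (hc : ContinuousOn F (Set.Icc a b))
    (hd : ∀ x ∈ Set.Ioo a b, HasDerivAt F (F' x) x) (hp : ∀ x ∈ Set.Ioo a b, 0 ≤ F' x) :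
    F a ≤ F b := by
  refine monotoneOn_of_deriv_nonneg (convex_Icc a b) hc ?_ ?_ ⟨le_rfl, hab⟩ ⟨hab, le_rfl⟩ hab
  · rw [interior_Icc]; intro x hx; exact (hd x hx).differentiableAt.differentiableWithinAt
  · rw [interior_Icc]; intro x hx; rw [(hd x hx).deriv]; exact hp x hx

lemma smono_Icc {F F' : ℝ → ℝ} {a b : ℝ} (hab : a < b) (hc : ContinuousOn F (Set.Icc a b))
    (hd : ∀ x ∈ Set.Ioo a b, HasDerivAt F (F' x) x) (hp : ∀ x ∈ Set.Ioo a b, 0 < F' x) :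
    F a < F b := by
  refine strictMonoOn_of_deriv_pos (convex_Icc a b) hc ?_ ⟨le_rfl, hab.le⟩ ⟨hab.le, le_rfl⟩ hab
  rw [interior_Icc]; intro x hx; rw [(hd x hx).deriv]; exact hp x hx

lemma const_Icc {F : ℝ → ℝ} {a b : ℝ} (hab : a ≤ b) (hc : ContinuousOn F (Set.Icc a b))
    (hd : ∀ x ∈ Set.Ioo a b, HasDerivAt F 0 x) : F a = F b := by
  refine le_antisymm (mono_Icc hab hc hd (fun _ _ => le_rfl)) ?_
  have := mono_Icc (F := fun x => - F x) (F' := fun x => -0) hab hc.neg (fun x hx => (hd x hx).fun_neg) (by simp)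
  linarith

structure IsDick (ρ : ℝ → ℝ) : Prop where
  cont : ContinuousOn ρ (Set.Ici 0)
  one : ∀ t ∈ Set.Icc (0 : ℝ) 1, ρ t = 1
  eq : ∀ t ≥ (1 : ℝ), ρ t = 1 - ∫ v in (1 : ℝ)..t, ρ (v - 1) / v

namespace IsDick
variable {ρ : ℝ → ℝ}

lemma contAt (h : IsDick ρ) {t : ℝ} (ht : 0 < t) : ContinuousAt ρ t :=
  h.cont.continuousAt (Ici_mem_nhds ht)

lemma deriv1 (h : IsDick ρ) {t : ℝ} (ht : 1 < t) : HasDerivAt ρ (-(ρ (t - 1) / t)) t := by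
  have hc : ContinuousOn (fun v => ρ (v - 1) / v) (Set.Ici 1) := by
    refine ContinuousOn.div (h.cont.comp (by fun_prop) ?_) continuousOn_id ?_
    · intro v hv; have : (1:ℝ) ≤ v := hv; exact sub_nonneg.2 this
    · intro v hv; have : (1:ℝ) ≤ v := hv; exact (show v ≠ 0 by linarith)
  have hi : IntervalIntegrable (fun v => ρ (v - 1) / v) MeasureTheory.volume 1 t := by
    refine (hc.mono ?_).intervalIntegrable
    rw [Set.uIcc_of_le ht.le]; exact fun v hv => hv.1
  have hca : ContinuousAt (fun v => ρ (v - 1) / v) t := hc.continuousAt (Ici_mem_nhds ht)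
  have hm : StronglyMeasurableAtFilter (fun v => ρ (v - 1) / v) (nhds t) MeasureTheory.volume :=
    ContinuousOn.stronglyMeasurableAtFilter isOpen_Ioi (hc.mono Set.Ioi_subset_Ici_self) t ht
  have := (intervalIntegral.integral_hasDerivAt_right hi hm hca).const_sub 1
  refine this.congr_of_eventuallyEq ?_
  filter_upwards [lt_mem_nhds ht] with x hx
  exact h.eq x hx.le

lemma ii (h : IsDick ρ) {a b : ℝ} (ha : 0 ≤ a) (hb : 0 ≤ b) :
    IntervalIntegrable ρ MeasureTheory.volume a b := by
  refine (h.cont.mono ?_).intervalIntegrable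
  intro v hv
  exact le_trans (le_min ha hb) hv.1

lemma int_deriv (h : IsDick ρ) {t : ℝ} (ht : 0 < t) :
    HasDerivAt (fun u => ∫ v in (0:ℝ)..u, ρ v) (ρ t) t :=
  intervalIntegral.integral_hasDerivAt_right (h.ii le_rfl ht.le)
    (ContinuousOn.stronglyMeasurableAtFilter isOpen_Ioi (h.cont.mono Set.Ioi_subset_Ici_self) t ht)
    (h.contAt ht)

lemma int_cont (h : IsDick ρ) : ContinuousOn (fun u => ∫ v in (0:ℝ)..u, ρ v) (Set.Ici 0) := by
  intro t ht
  have ht : 0 ≤ t := ht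
  have := intervalIntegral.continuousWithinAt_primitive (μ := MeasureTheory.volume) (f := ρ)
    (a := 0) (b₁ := 0) (b₂ := t + 1) (b₀ := t) (by simp) (by
      rw [min_self, max_eq_right (by linarith)]; exact h.ii le_rfl (by linarith))
  refine this.mono_of_mem_nhdsWithin ?_
  rw [mem_nhdsWithin]
  exact ⟨Set.Iio (t+1), isOpen_Iio, by simp, fun x hx => ⟨hx.2, hx.1.le⟩⟩

lemma mul_eq (h : IsDick ρ) {u : ℝ} (hu : 1 ≤ u) : u * ρ u = ∫ v in (u-1)..u, ρ v := by
  set P := fun u => ∫ v in (0:ℝ)..u, ρ v with hP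
  have hsub : Set.Icc 1 u ⊆ Set.Ici 0 := fun x hx => le_trans (by norm_num) hx.1
  have key : (fun u => u * ρ u - (P u - P (u - 1))) 1 = (fun u => u * ρ u - (P u - P (u - 1))) u := by
    refine const_Icc (F := fun u => u * ρ u - (P u - P (u - 1))) hu ?_ ?_
    · refine (continuousOn_id.mul (h.cont.mono hsub)).sub ((h.int_cont.mono hsub).sub ?_)
      refine h.int_cont.comp (by fun_prop) ?_
      intro v hv; exact sub_nonneg.2 hv.1
    · intro t ht
      have h1 := h.deriv1 ht.1
      have h2 := h.int_deriv (show 0 < t by linarith [ht.1])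
      have h3 := (h.int_deriv (show 0 < t - 1 by linarith [ht.1])).comp_sub_const t 1
      refine (((hasDerivAt_id t).mul h1).sub (h2.sub h3)).congr_deriv ?_
      have : t ≠ 0 := by linarith [ht.1]
      simp only [id]; field_simp; ring
  have h1 : P 1 = 1 := by
    simp only [hP]
    rw [intervalIntegral.integral_congr (g := fun _ => (1:ℝ))]
    · simp
    · intro v hv; rw [Set.uIcc_of_le zero_le_one] at hv; exact h.one v hv
  have h2 : P 0 = 0 := by simp [hP]
  simp only [sub_self, h1, h2, h.one 1 (by simp)] at key
  have : (∫ v in (u-1)..u, ρ v) = P u - P (u-1) := by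
    simp only [hP]
    rw [intervalIntegral.integral_interval_sub_left (h.ii le_rfl (by linarith)) (h.ii le_rfl (by linarith))]
  rw [this]; linarith

lemma pos (h : IsDick ρ) {t : ℝ} (ht : 0 ≤ t) : 0 < ρ t := by
  by_contra hneg
  set S := Set.Ici (0:ℝ) ∩ ρ ⁻¹' (Set.Iic 0) with hS
  have hcl : IsClosed S := h.cont.preimage_isClosed_of_isClosed isClosed_Ici isClosed_Iic
  have hne : S.Nonempty := ⟨t, ht, not_lt.1 hneg⟩
  have hbd : BddBelow S := ⟨0, fun x hx => hx.1⟩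
  have hA := hcl.csInf_mem hne hbd
  set A := sInf S
  have hA0 : 0 ≤ A := hA.1
  have hA2 : ρ A ≤ 0 := hA.2
  have hlt : ∀ x, 0 ≤ x → x < A → 0 < ρ x := by
    intro x hx hxA
    by_contra hc
    exact absurd (csInf_le hbd (show x ∈ S from ⟨hx, not_lt.1 hc⟩)) (not_le.2 hxA)
  have hA1 : 1 < A := by
    by_contra hc
    have := h.one A ⟨hA0, not_lt.1 hc⟩
    linarith
  have hm := h.mul_eq hA1.le
  have : 0 < ∫ v in (A-1)..A, ρ v := by
    refine intervalIntegral.intervalIntegral_pos_of_pos_on (h.ii (by linarith) (by linarith)) ?_ (by linarith)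
    intro x hx
    exact hlt x (by linarith [hx.1]) hx.2
  nlinarith

lemma anti (h : IsDick ρ) {a b : ℝ} (ha : 0 ≤ a) (hab : a ≤ b) : ρ b ≤ ρ a := by
  have key : ∀ a b, 1 ≤ a → a ≤ b → ρ b ≤ ρ a := by
    intro a b ha hab
    have := mono_Icc (F := fun x => - ρ x) (F' := fun t => -(-(ρ (t - 1) / t))) hab
      (h.cont.mono (fun x hx => le_trans (by linarith) hx.1)).neg
      (fun x hx => (h.deriv1 (lt_of_le_of_lt ha hx.1)).fun_neg) (by
        intro x hx
        have h1 := hx.1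
        have := h.pos (t := x - 1) (by linarith)
        rw [neg_neg]
        exact div_nonneg this.le (by linarith))
    linarith
  rcases le_total b 1 with hb | hb
  · rw [h.one a ⟨ha, by linarith⟩, h.one b ⟨by linarith, hb⟩]
  · rcases le_total a 1 with ha1 | ha1
    · rw [h.one a ⟨ha, ha1⟩, ← h.one 1 (by simp)]
      exact key 1 b le_rfl hb
    · exact key a b ha1 hab

lemma le_one (h : IsDick ρ) {a : ℝ} (ha : 0 ≤ a) : ρ a ≤ 1 := by
  rw [← h.one 0 (by simp)]; exact h.anti le_rfl ha

lemma lt_one (h : IsDick ρ) {a : ℝ} (ha : 1 < a) : ρ a < 1 := by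
  have := smono_Icc (F := fun x => - ρ x) (F' := fun t => -(-(ρ (t - 1) / t))) ha
      (h.cont.mono (fun x hx => le_trans (by linarith) hx.1)).neg
      (fun x hx => (h.deriv1 hx.1).fun_neg) (by
        intro x hx
        have h1 := hx.1
        have := h.pos (t := x - 1) (by linarith)
        rw [neg_neg]
        exact div_pos this (by linarith))
  simp only [h.one 1 (by simp)] at this
  linarith

end IsDick


noncomputable def rr (ρ : ℝ → ℝ) (v : ℝ) : ℝ := if v < 1 then 0 else ρ (v - 1) / (v * ρ v)

namespace IsDick
variable {ρ : ℝ → ℝ}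

lemma rr_lt {v : ℝ} (hv : v < 1) : rr ρ v = 0 := by simp [rr, hv]
lemma rr_ge {v : ℝ} (hv : 1 ≤ v) : rr ρ v = ρ (v - 1) / (v * ρ v) := by simp [rr, not_lt.2 hv]

lemma rr_mul (h : IsDick ρ) {v : ℝ} (hv : 1 ≤ v) : ρ (v - 1) = v * rr ρ v * ρ v := by
  have := h.pos (show 0 ≤ v by linarith)
  have hv0 : v ≠ 0 := by linarith
  rw [rr_ge hv]; field_simp

lemma rr_one (h : IsDick ρ) : rr ρ 1 = 1 := by
  rw [rr_ge le_rfl, h.one 1 (by simp)]; simp [h.one 0 (by simp)]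

lemma rr_pos (h : IsDick ρ) {v : ℝ} (hv : 1 ≤ v) : 0 < rr ρ v := by
  rw [rr_ge hv]
  have := h.pos (show 0 ≤ v by linarith)
  have := h.pos (show 0 ≤ v - 1 by linarith)
  positivity

lemma rr_nonneg (h : IsDick ρ) (v : ℝ) : 0 ≤ rr ρ v := by
  rcases lt_or_ge v 1 with hv | hv
  · rw [rr_lt hv]
  · exact (h.rr_pos hv).le

lemma deriv_rr (h : IsDick ρ) {t : ℝ} (ht : 0 < t) (ht1 : t ≠ 1) :
    HasDerivAt ρ (-(rr ρ t * ρ t)) t := by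
  rcases lt_or_gt_of_ne ht1 with h1 | h1
  · rw [rr_lt h1, zero_mul, neg_zero]
    refine (hasDerivAt_const t (1:ℝ)).congr_of_eventuallyEq ?_
    filter_upwards [lt_mem_nhds ht, gt_mem_nhds h1] with x hx hx1
    exact h.one x ⟨hx.le, hx1.le⟩
  · refine (h.deriv1 h1).congr_deriv ?_
    have := h.pos ht.le
    rw [h.rr_mul h1.le]; field_simp

lemma rr_cont (h : IsDick ρ) : ContinuousOn (rr ρ) (Set.Ici 1) := by
  have : ContinuousOn (fun v => ρ (v - 1) / (v * ρ v)) (Set.Ici 1) := by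
    refine ContinuousOn.div (h.cont.comp (by fun_prop) ?_) (continuousOn_id.mul (h.cont.mono ?_)) ?_
    · intro v hv; exact sub_nonneg.2 (show (1:ℝ) ≤ v from hv)
    · intro v hv; exact le_trans zero_le_one (show (1:ℝ) ≤ v from hv)
    · intro v hv
      have hv : (1:ℝ) ≤ v := hv
      have := h.pos (show 0 ≤ v by linarith)
      exact (mul_pos (show 0 < v by linarith) this).ne'
  exact this.congr (fun v hv => rr_ge hv)

noncomputable def gg (ρ : ℝ → ℝ) (u : ℝ) : ℝ := rr ρ u - rr ρ (u - 1) - 1 / u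

lemma rr_deriv (h : IsDick ρ) {u : ℝ} (hu : 1 < u) (hu2 : u ≠ 2) :
    HasDerivAt (rr ρ) (rr ρ u * gg ρ u) u := by
  have h0 : 0 < u := by linarith
  have hp := h.pos h0.le
  have h1 := h.deriv_rr h0 hu.ne'
  have h2 := (h.deriv_rr (t := u - 1) (by linarith) (by intro hc; apply hu2; linarith)).comp_sub_const u 1
  have h3 := h2.div ((hasDerivAt_id u).mul h1) (mul_pos h0 hp).ne'
  refine (h3.congr_of_eventuallyEq ?_).congr_deriv ?_
  · filter_upwards [lt_mem_nhds hu] with x hx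
    rw [rr_ge hx.le]; rfl
  · simp only [id, Pi.mul_apply]
    rw [h.rr_mul hu.le, gg]
    field_simp
    ring

lemma gg_pos_12 (h : IsDick ρ) {u : ℝ} (hu : 1 < u) (hu2 : u < 2) : 0 < gg ρ u := by
  rw [gg, rr_lt (show u - 1 < 1 by linarith), rr_ge hu.le, h.one (u-1) ⟨by linarith, by linarith⟩]
  have h1 := h.lt_one hu
  have h2 := h.pos (show 0 ≤ u by linarith)
  have : 1 / u < 1 / (u * ρ u) := by
    apply one_div_lt_one_div_of_lt (by positivity)
    nlinarith
  linarith

lemma rr_smono_upto (h : IsDick ρ) {A : ℝ} (hg : ∀ u, 2 ≤ u → u < A → 0 < gg ρ u) {a b : ℝ}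
    (ha : 1 ≤ a) (hab : a < b) (hb : b ≤ A) : rr ρ a < rr ρ b := by
  have key : ∀ a b, 1 ≤ a → a < b → b ≤ A → (b ≤ 2 ∨ 2 ≤ a) → rr ρ a < rr ρ b := by
    intro a b ha hab hb h2
    refine smono_Icc hab (h.rr_cont.mono (fun x hx => le_trans ha hx.1))
      (fun x hx => h.rr_deriv (lt_of_le_of_lt ha hx.1) ?_) ?_
    · rintro rfl; rcases h2 with h2 | h2 <;> linarith [hx.1, hx.2]
    · intro x hx
      refine mul_pos (h.rr_pos (by linarith [hx.1])) ?_
      rcases h2 with h2 | h2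
      · exact h.gg_pos_12 (by linarith [hx.1]) (by linarith [hx.2])
      · exact hg x (by linarith [hx.1]) (by linarith [hx.2])
  rcases le_or_gt b 2 with h2 | h2
  · exact key a b ha hab hb (Or.inl h2)
  · rcases le_or_gt 2 a with h3 | h3
    · exact key a b ha hab hb (Or.inr h3)
    · exact (key a 2 ha h3 (by linarith) (Or.inl le_rfl)).trans (key 2 b (by norm_num) h2 hb (Or.inr le_rfl))

lemma gg_pos (h : IsDick ρ) {u : ℝ} (hu : 2 ≤ u) : 0 < gg ρ u := by
  by_contra hneg
  have hgc : ContinuousOn (gg ρ) (Set.Ici 2) := by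
    refine ((h.rr_cont.mono ?_).sub (h.rr_cont.comp (by fun_prop) ?_)).sub
      (continuousOn_const.div continuousOn_id ?_)
    · intro v hv; exact le_trans one_le_two (show (2:ℝ) ≤ v from hv)
    · intro v hv; have : (2:ℝ) ≤ v := hv; exact (show (1:ℝ) ≤ v - 1 by linarith)
    · intro v hv; have : (2:ℝ) ≤ v := hv; exact (show v ≠ 0 by linarith)
  set S := Set.Ici (2:ℝ) ∩ gg ρ ⁻¹' (Set.Iic 0) with hS
  have hcl : IsClosed S := hgc.preimage_isClosed_of_isClosed isClosed_Ici isClosed_Iic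
  have hbd : BddBelow S := ⟨2, fun x hx => hx.1⟩
  have hA := hcl.csInf_mem ⟨u, hu, not_lt.1 hneg⟩ hbd
  set A := sInf S
  have hA0 : 2 ≤ A := hA.1
  have hA2 : gg ρ A ≤ 0 := hA.2
  have hlt : ∀ x, 2 ≤ x → x < A → 0 < gg ρ x := by
    intro x hx hxA
    by_contra hc
    exact absurd (csInf_le hbd (show x ∈ S from ⟨hx, not_lt.1 hc⟩)) (not_le.2 hxA)
  have hsm := fun a b => h.rr_smono_upto hlt (a := a) (b := b)
  set P := fun u => ∫ v in (0:ℝ)..u, ρ v with hP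
  have key := smono_Icc (F := fun s => - ρ s - rr ρ (A-1) * P s)
    (F' := fun s => - (-(rr ρ s * ρ s)) - rr ρ (A-1) * ρ s) (show A - 1 < A by linarith)
    ((h.cont.mono (fun x hx => show (0:ℝ) ≤ x by linarith [hx.1])).neg.sub (continuousOn_const.mul
      (h.int_cont.mono (fun x hx => show (0:ℝ) ≤ x by linarith [hx.1]))))
    (fun x hx => (h.deriv_rr (by linarith [hx.1]) (by intro hc; linarith [hx.1])).fun_neg.fun_sub
      ((h.int_deriv (by linarith [hx.1])).const_mul _))
    (by
      intro x hx
      have h1 := hsm (A-1) x (by linarith) hx.1 hx.2.le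
      have h2 := h.pos (show 0 ≤ x by linarith [hx.1])
      nlinarith)
  have hm := h.mul_eq (show 1 ≤ A by linarith)
  have : (∫ v in (A-1)..A, ρ v) = P A - P (A-1) := by
    simp only [hP]
    rw [intervalIntegral.integral_interval_sub_left (h.ii le_rfl (by linarith)) (h.ii le_rfl (by linarith))]
  rw [this] at hm
  have h5 : rr ρ (A-1) * (A * ρ A) < ρ (A-1) - ρ A := by rw [hm]; linarith
  have h6 := h.pos (show 0 ≤ A by linarith)
  rw [h.rr_mul (show 1 ≤ A by linarith)] at h5
  have h7 : 0 < gg ρ A * (A * ρ A) := by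
    have : gg ρ A * (A * ρ A) = A * rr ρ A * ρ A - ρ A - rr ρ (A-1) * (A * ρ A) := by
      have hA0' : A ≠ 0 := by linarith
      rw [gg]; field_simp; ring
    linarith
  have h8 : 0 < A * ρ A := by positivity
  nlinarith

lemma rr_mono (h : IsDick ρ) : Monotone (rr ρ) := by
  intro a b hab
  rcases lt_or_ge a 1 with ha | ha
  · rw [rr_lt ha]; exact h.rr_nonneg b
  · rcases eq_or_lt_of_le hab with rfl | hab
    · exact le_rfl
    · exact (h.rr_smono_upto (A := b) (fun u hu _ => h.gg_pos hu) ha hab le_rfl).le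

lemma one_le_rr (h : IsDick ρ) {u : ℝ} (hu : 1 ≤ u) : 1 ≤ rr ρ u := by
  rw [← h.rr_one]; exact h.rr_mono hu

/-- two-sided comparison -/
lemma le_exp (h : IsDick ρ) {a b : ℝ} (ha : 0 ≤ a) (hab : a ≤ b) :
    ρ a ≤ ρ b * exp (rr ρ b * (b - a)) := by
  have key : ∀ a, 0 ≤ a → a ≤ b → (b ≤ 1 ∨ 1 ≤ a) → ρ a ≤ ρ b * exp (rr ρ b * (b - a)) := by
    intro a ha hab h2
    have := mono_Icc (F := fun s => ρ s * exp (rr ρ b * s)) (F' := fun s => -(rr ρ s * ρ s) * exp (rr ρ b * s)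
        + ρ s * (exp (rr ρ b * s) * (rr ρ b * 1))) hab
      ((h.cont.mono (fun x hx => le_trans ha hx.1)).mul (by fun_prop))
      (fun x hx => (h.deriv_rr (by linarith [hx.1]) (by
        rintro rfl; rcases h2 with h2 | h2 <;> linarith [hx.1, hx.2])).fun_mul
          (((hasDerivAt_id x).const_mul _).exp)) (by
        intro x hx
        have h3 := h.rr_mono hx.2.le
        have h4 := h.pos (show 0 ≤ x by linarith [hx.1])
        have h5 := exp_pos (rr ρ b * x)
        have : 0 ≤ (rr ρ b - rr ρ x) * (ρ x * exp (rr ρ b * x)) :=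
          mul_nonneg (by linarith) (by positivity)
        nlinarith)
    rw [mul_sub, Real.exp_sub, mul_div_assoc', le_div_iff₀ (exp_pos _)]
    exact this
  rcases le_or_gt b 1 with h1 | h1
  · exact key a ha hab (Or.inl h1)
  · rcases le_or_gt 1 a with h2 | h2
    · exact key a ha hab (Or.inr h2)
    · rw [h.one a ⟨ha, h2.le⟩, ← h.one 1 (by simp)]
      refine (key 1 zero_le_one h1.le (Or.inr le_rfl)).trans ?_
      have := h.pos (show 0 ≤ b by linarith)
      have := h.rr_nonneg b
      gcongr

lemma exp_le (h : IsDick ρ) {a b : ℝ} (ha : 0 ≤ a) (hab : a ≤ b) :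
    ρ b * exp (rr ρ a * (b - a)) ≤ ρ a := by
  have key : ∀ a, 1 ≤ a → a ≤ b → ρ b * exp (rr ρ a * (b - a)) ≤ ρ a := by
    intro a ha hab
    have := mono_Icc (F := fun s => - (ρ s * exp (rr ρ a * s))) (F' := fun s => - (-(rr ρ s * ρ s) * exp (rr ρ a * s)
        + ρ s * (exp (rr ρ a * s) * (rr ρ a * 1)))) hab
      ((h.cont.mono (fun x hx => show (0:ℝ) ≤ x by linarith [hx.1])).mul (by fun_prop)).neg
      (fun x hx => ((h.deriv_rr (by linarith [hx.1]) (by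
        rintro rfl; linarith [hx.1, hx.2])).fun_mul
          (((hasDerivAt_id x).const_mul _).exp)).fun_neg) (by
        intro x hx
        have h3 := h.rr_mono hx.1.le
        have h4 := h.pos (show 0 ≤ x by linarith [hx.1])
        have h5 := exp_pos (rr ρ a * x)
        have : 0 ≤ (rr ρ x - rr ρ a) * (ρ x * exp (rr ρ a * x)) :=
          mul_nonneg (by linarith) (by positivity)
        nlinarith)
    rw [mul_sub, Real.exp_sub, mul_div_assoc', div_le_iff₀ (exp_pos _)]
    linarith
  rcases le_or_gt 1 a with h2 | h2
  · exact key a h2 hab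
  · rw [rr_lt h2]; simp only [zero_mul, exp_zero, mul_one]
    exact h.anti ha hab

lemma mul_rr_le_exp (h : IsDick ρ) {u : ℝ} (hu : 1 ≤ u) : u * rr ρ u ≤ exp (rr ρ u) := by
  have h1 := h.le_exp (a := u - 1) (b := u) (by linarith) (by linarith)
  have h2 := h.pos (show 0 ≤ u by linarith)
  rw [h.rr_mul hu] at h1
  rw [show rr ρ u * (u - (u - 1)) = rr ρ u by ring] at h1
  nlinarith

lemma log_le_rr (h : IsDick ρ) {u : ℝ} (hu : 1 ≤ u) : log u ≤ rr ρ u := by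
  rw [Real.log_le_iff_le_exp (by linarith)]
  refine le_trans ?_ (h.mul_rr_le_exp hu)
  have := h.one_le_rr hu
  nlinarith

lemma rr_le_four (h : IsDick ρ) {u : ℝ} (hu : 1 ≤ u) : rr ρ u ≤ 4 * u := by
  have low : ∀ w, 1 ≤ w → 1/2 * ρ (w - 1/2) ≤ w * ρ w := by
    intro w hw
    rw [h.mul_eq hw]
    have h1 : ∫ v in (w-1)..(w-1/2), ρ (w - 1/2) ≤ ∫ v in (w-1)..(w-1/2), ρ v := by
      refine intervalIntegral.integral_mono_on (by linarith) (by simp) (h.ii (by linarith) (by linarith)) ?_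
      intro t ht; exact h.anti (by linarith [ht.1]) ht.2
    have h2 : 0 ≤ ∫ v in (w-1/2)..w, ρ v :=
      intervalIntegral.integral_nonneg (by linarith) (fun t ht => (h.pos (by linarith [ht.1])).le)
    rw [intervalIntegral.integral_const] at h1
    have h3 := intervalIntegral.integral_add_adjacent_intervals (h.ii (show 0 ≤ w - 1 by linarith)
      (show 0 ≤ w - 1/2 by linarith)) (h.ii (show 0 ≤ w - 1/2 by linarith) (show 0 ≤ w by linarith))
    rw [smul_eq_mul] at h1
    linarith
  have hp := h.pos (show 0 ≤ u by linarith)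
  rw [rr_ge hu, div_le_iff₀ (by positivity)]
  have l1 := low u hu
  rcases le_or_gt (3/2) u with h3 | h3
  · have l2 : 1/2 * ρ (u - 1) ≤ (u - 1/2) * ρ (u - 1/2) := by
      have := low (u - 1/2) (by linarith)
      rwa [show u - 1/2 - 1/2 = u - 1 by ring] at this
    have := h.pos (show 0 ≤ u - 1/2 by linarith)
    nlinarith
  · rw [h.one (u-1) ⟨by linarith, by linarith⟩]
    rw [h.one (u-1/2) ⟨by linarith, by linarith⟩] at l1
    nlinarith

lemma rr_pred_le (h : IsDick ρ) {u : ℝ} (hu : 1 ≤ u) : rr ρ (u - 1) ≤ log u + log (rr ρ u) := by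
  have h1 := h.exp_le (a := u - 1) (b := u) (by linarith) (by linarith)
  have h2 := h.pos (show 0 ≤ u by linarith)
  have h3 := h.rr_pos hu
  rw [h.rr_mul hu, show rr ρ (u-1) * (u - (u - 1)) = rr ρ (u-1) by ring] at h1
  rw [← Real.log_mul (by linarith) h3.ne', Real.le_log_iff_exp_le (by positivity)]
  nlinarith

lemma rr_le_log (h : IsDick ρ) {η : ℝ} (hη : 0 < η) :
    ∃ C : ℝ, 0 < C ∧ ∀ u ≥ (1:ℝ), rr ρ u ≤ (1 + η) * log u + C := by
  -- first: rr u ≤ log 4 + 2 log (u+1)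
  have s1 : ∀ u ≥ (0:ℝ), rr ρ u ≤ log 4 + 2 * log (u + 1) := by
    intro u hu
    have h1 := h.rr_pred_le (u := u + 1) (by linarith)
    rw [add_sub_cancel_right] at h1
    have h2 : log (rr ρ (u+1)) ≤ log (4 * (u+1)) :=
      Real.log_le_log (h.rr_pos (by linarith)) (h.rr_le_four (by linarith))
    rw [Real.log_mul (by norm_num) (by linarith)] at h2
    linarith
  set K : ℝ := log 4 + 2 * log 3 + 2 with hK
  have hK0 : 0 < K := by have := Real.log_pos (show (1:ℝ) < 4 by norm_num); have := Real.log_pos (show (1:ℝ) < 3 by norm_num); positivity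
  refine ⟨log 2 + |log (K/η)| + η + 1 + K, by have := Real.log_pos (show (1:ℝ) < 2 by norm_num); positivity, ?_⟩
  intro u hu
  have h1 := h.rr_pred_le (u := u + 1) (by linarith)
  rw [add_sub_cancel_right] at h1
  have hl0 : 0 ≤ log u := Real.log_nonneg hu
  have h2 := s1 (u + 1) (by linarith)
  have h3 : log (u + 1) ≤ log 2 + log u := by
    rw [← Real.log_mul (by norm_num) (by linarith)]
    exact Real.log_le_log (by linarith) (by linarith)
  have h4 : log (u + 1 + 1) ≤ log 3 + log u := by
    rw [← Real.log_mul (by norm_num) (by linarith)]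
    exact Real.log_le_log (by linarith) (by linarith)
  have h5 : rr ρ (u+1) ≤ K * (1 + log u) := by
    have e4 := Real.log_pos (show (1:ℝ) < 4 by norm_num)
    have e3 := Real.log_pos (show (1:ℝ) < 3 by norm_num)
    nlinarith
  have h6 : log (rr ρ (u+1)) ≤ log (K/η) + log (η * (1 + log u)) := by
    rw [← Real.log_mul (by positivity) (by positivity)]
    refine Real.log_le_log (h.rr_pos (by linarith)) ?_
    rw [show K / η * (η * (1 + log u)) = K * (1 + log u) by field_simp]
    exact h5
  have h7 := Real.log_le_sub_one_of_pos (show 0 < η * (1 + log u) by positivity)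
  have h8 := le_abs_self (log (K/η))
  linarith

lemma rho_le (h : IsDick ρ) {u : ℝ} (hu : 2 ≤ u) : ρ u * exp (log (u/2) * (u/2)) ≤ 1 := by
  have h1 := h.exp_le (a := u/2) (b := u) (by linarith) (by linarith)
  rw [show u - u/2 = u/2 by ring] at h1
  refine le_trans ?_ (h1.trans (h.le_one (by linarith)))
  have h2 := h.log_le_rr (u := u/2) (by linarith)
  have := h.pos (show 0 ≤ u by linarith)
  gcongr

end IsDick


open Classical in
noncomputable def Sm (x y : ℝ) : Finset ℕ :=
  (Finset.Icc 1 ⌊x⌋₊).filter (fun n => ∀ p : ℕ, p.Prime → p ∣ n → (p:ℝ) ≤ y)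

lemma mem_Sm {x y : ℝ} {n : ℕ} : n ∈ Sm x y ↔
    1 ≤ n ∧ (n:ℝ) ≤ x ∧ ∀ p : ℕ, p.Prime → p ∣ n → (p:ℝ) ≤ y := by
  classical
  rw [Sm, Finset.mem_filter, Finset.mem_Icc]
  constructor
  · rintro ⟨⟨h1, h2⟩, h3⟩
    exact ⟨h1, (Nat.le_floor_iff' (by omega)).1 h2, h3⟩
  · rintro ⟨h1, h2, h3⟩
    exact ⟨⟨h1, (Nat.le_floor_iff' (by omega)).2 h2⟩, h3⟩

lemma Psi_eq (x y : ℝ) : Psi x y = (Sm x y).card := by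
  rw [Psi, ← Set.ncard_coe_finset]
  congr 1
  ext n
  rw [Finset.mem_coe, mem_Sm]; rfl

lemma Psi_mono {x x' y : ℝ} (h : x ≤ x') : Psi x y ≤ Psi x' y := by
  rw [Psi_eq, Psi_eq]
  refine Finset.card_le_card ?_
  intro n hn
  rw [mem_Sm] at hn ⊢
  exact ⟨hn.1, hn.2.1.trans h, hn.2.2⟩

lemma one_le_Psi {x y : ℝ} (h : 1 ≤ x) : 1 ≤ Psi x y := by
  rw [Psi_eq, Nat.succ_le_iff, Finset.card_pos]
  refine ⟨1, mem_Sm.2 ⟨le_rfl, by simpa using h, ?_⟩⟩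
  intro p hp hd
  exact absurd (Nat.dvd_one.1 hd) hp.one_lt.ne'

lemma Psi_ii (y a b : ℝ) (ha : 0 < a) (hb : 0 < b) :
    IntervalIntegrable (fun t => (Psi t y : ℝ) / t) MeasureTheory.volume a b := by
  have h1 : IntervalIntegrable (fun t => (Psi t y : ℝ)) MeasureTheory.volume a b := by
    refine Monotone.intervalIntegrable ?_
    intro s t hst
    exact Nat.cast_le.2 (Psi_mono hst)
  have h2 : ContinuousOn (fun t : ℝ => t⁻¹) (Set.uIcc a b) := by
    refine continuousOn_inv₀.mono ?_
    intro t ht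
    have : 0 < t := lt_of_lt_of_le (lt_min ha hb) ht.1
    exact this.ne'
  simpa [div_eq_mul_inv] using h1.mul_continuousOn h2

lemma int_Psi {x y : ℝ} (hx : 1 ≤ x) :
    ∫ t in (1:ℝ)..x, (Psi t y : ℝ) / t = ∑ n ∈ Sm x y, (log x - log n) := by
  have h1 : ∀ t ∈ Set.uIcc 1 x, (Psi t y : ℝ) / t =
      ∑ n ∈ Sm x y, Set.indicator (Set.Ici (n:ℝ)) (fun t : ℝ => t⁻¹) t := by
    intro t ht
    rw [Set.uIcc_of_le hx] at ht
    have e : Sm t y = (Sm x y).filter (fun n : ℕ => (n:ℝ) ≤ t) := by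
      ext n
      rw [Finset.mem_filter, mem_Sm, mem_Sm]
      constructor
      · rintro ⟨a, b, c⟩; exact ⟨⟨a, b.trans ht.2, c⟩, b⟩
      · rintro ⟨⟨a, b, c⟩, d⟩; exact ⟨a, d, c⟩
    rw [Psi_eq, e, Finset.card_filter]
    push_cast
    rw [Finset.sum_div]
    refine Finset.sum_congr rfl ?_
    intro n _
    rw [Set.indicator_apply]
    simp only [Set.mem_Ici]
    split_ifs <;> simp
  have ci : ∀ a b : ℝ, 0 < a → 0 < b → IntervalIntegrable (fun t : ℝ => t⁻¹) MeasureTheory.volume a b := by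
    intro a b ha hb
    refine (continuousOn_inv₀.mono ?_).intervalIntegrable
    intro t ht
    have : 0 < t := lt_of_lt_of_le (lt_min ha hb) ht.1
    exact this.ne'
  have hii : ∀ n : ℕ, IntervalIntegrable (Set.indicator (Set.Ici (n:ℝ)) (fun t : ℝ => t⁻¹))
      MeasureTheory.volume 1 x := by
    intro n
    rw [intervalIntegrable_iff_integrableOn_Ioc_of_le hx]
    exact MeasureTheory.IntegrableOn.indicator
      ((intervalIntegrable_iff_integrableOn_Ioc_of_le hx).1 (ci 1 x one_pos (by linarith))) measurableSet_Ici
  rw [intervalIntegral.integral_congr h1, intervalIntegral.integral_finsetSum (fun n _ => hii n)]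
  refine Finset.sum_congr rfl ?_
  intro n hn
  rw [mem_Sm] at hn
  have hn1 : (1:ℝ) ≤ n := by exact_mod_cast hn.1
  rw [← intervalIntegral.integral_add_adjacent_intervals (b := (n:ℝ))
    ((hii n).mono_set (by rw [Set.uIcc_of_le hn1, Set.uIcc_of_le hx]; exact Set.Icc_subset_Icc_right hn.2.1))
    ((hii n).mono_set (by rw [Set.uIcc_of_le hn.2.1, Set.uIcc_of_le hx]; exact Set.Icc_subset_Icc_left hn1))]
  have z : ∫ t in (1:ℝ)..n, Set.indicator (Set.Ici (n:ℝ)) (fun t : ℝ => t⁻¹) t = 0 := by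
    rw [intervalIntegral.integral_of_le hn1, MeasureTheory.integral_Ioc_eq_integral_Ioo]
    rw [MeasureTheory.setIntegral_congr_fun (g := fun _ => (0:ℝ)) measurableSet_Ioo]
    · simp
    · intro t ht
      exact Set.indicator_of_notMem (by simpa using ht.2) _
  have z2 : ∫ t in (n:ℝ)..x, Set.indicator (Set.Ici (n:ℝ)) (fun t : ℝ => t⁻¹) t = ∫ t in (n:ℝ)..x, t⁻¹ := by
    refine intervalIntegral.integral_congr ?_
    intro t ht
    rw [Set.uIcc_of_le hn.2.1] at ht
    exact Set.indicator_of_mem (by simpa using ht.1) _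
  rw [z, z2, integral_inv_of_pos (by linarith) (by linarith), zero_add, Real.log_div (by linarith) (by linarith)]

lemma sum_log_ge {x y : ℝ} (D : Finset ℕ)
    (hD : ∀ d ∈ D, 1 ≤ d ∧ ∀ p : ℕ, p.Prime → p ∣ d → (p:ℝ) ≤ y) :
    ∑ d ∈ D, ArithmeticFunction.vonMangoldt d * (Psi (x / d) y : ℝ) ≤ ∑ n ∈ Sm x y, log n := by
  classical
  have h1 : ∀ n ∈ Sm x y, ∑ d ∈ D, (if d ∣ n then ArithmeticFunction.vonMangoldt d else 0) ≤ log n := by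
    intro n hn
    rw [mem_Sm] at hn
    rw [← ArithmeticFunction.vonMangoldt_sum, ← Finset.sum_filter]
    refine Finset.sum_le_sum_of_subset_of_nonneg ?_ ?_
    · intro d hd
      rw [Finset.mem_filter] at hd
      rw [Nat.mem_divisors]
      exact ⟨hd.2, by omega⟩
    · intro d _ _; exact ArithmeticFunction.vonMangoldt_nonneg
  refine le_trans ?_ (Finset.sum_le_sum h1)
  rw [Finset.sum_comm]
  refine Finset.sum_le_sum ?_
  intro d hd
  obtain ⟨hd1, hd2⟩ := hD d hd
  rw [← Finset.sum_filter, Finset.sum_const, nsmul_eq_mul, mul_comm]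
  refine mul_le_mul_of_nonneg_right ?_ ArithmeticFunction.vonMangoldt_nonneg
  norm_cast
  rw [Psi_eq]
  refine Finset.card_le_card_of_injOn (fun m => d * m) ?_ ?_
  · intro m hm
    have hm := mem_Sm.1 (Finset.mem_coe.1 hm)
    rw [Finset.mem_coe, Finset.mem_filter, mem_Sm]
    have hd0 : (0:ℝ) < d := by exact_mod_cast hd1
    refine ⟨⟨Nat.mul_pos hd1 hm.1, ?_, ?_⟩, dvd_mul_right _ _⟩
    · push_cast
      have := hm.2.1
      rw [le_div_iff₀ hd0] at this
      linarith
    · intro p hp hpd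
      rcases (Nat.Prime.dvd_mul hp).1 hpd with h | h
      · exact hd2 p hp h
      · exact hm.2.2 p hp h
  · intro a _ b _ hab
    exact Nat.eq_of_mul_eq_mul_left hd1 hab

lemma Psi_ineq {x y : ℝ} (hx : 1 ≤ x) (D : Finset ℕ)
    (hD : ∀ d ∈ D, 1 ≤ d ∧ ∀ p : ℕ, p.Prime → p ∣ d → (p:ℝ) ≤ y) :
    (∫ t in (1:ℝ)..x, (Psi t y : ℝ) / t) +
      ∑ d ∈ D, ArithmeticFunction.vonMangoldt d * (Psi (x / d) y : ℝ) ≤ (Psi x y : ℝ) * log x := by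
  have h1 := sum_log_ge (x := x) D hD
  rw [int_Psi hx, Finset.sum_sub_distrib, Finset.sum_const, nsmul_eq_mul, ← Psi_eq]
  linarith


noncomputable def RR (ρ : ℝ → ℝ) (y x : ℝ) : ℝ := x * ρ (log x / log y)

noncomputable def KK (ρ : ℝ → ℝ) (y x t : ℝ) : ℝ :=
  x / t ^ 2 * ρ (log (x / t) / log y) * (1 - rr ρ (log (x / t) / log y) / log y)

namespace IsDick
variable {ρ : ℝ → ℝ}

lemma vcont {x y t : ℝ} (hx : 0 < x) (ht : 0 < t) : ContinuousAt (fun t => log (x/t) / log y) t := by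
  have : x / t ≠ 0 := by positivity
  have h2 : t ≠ 0 := ht.ne'
  fun_prop (disch := assumption)

lemma vderiv {x y t : ℝ} (hx : 0 < x) (ht : 0 < t) :
    HasDerivAt (fun t => log (x/t) / log y) (-(1 / (t * log y))) t := by
  have h1 : HasDerivAt (fun t => (log x - log t) / log y) ((0 - t⁻¹) / log y) t :=
    ((hasDerivAt_const t (log x)).sub (Real.hasDerivAt_log ht.ne')).div_const _
  refine (h1.congr_of_eventuallyEq ?_).congr_deriv ?_
  · filter_upwards [lt_mem_nhds ht] with s hs
    rw [Real.log_div hx.ne' hs.ne']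
  · by_cases hy : log y = 0
    · simp [hy]
    · field_simp; ring

lemma v_nonneg {x y t : ℝ} (hy : 1 < y) (ht : 0 < t) (htx : t ≤ x) : 0 ≤ log (x/t) / log y :=
  div_nonneg (Real.log_nonneg ((one_le_div ht).2 htx)) (Real.log_pos hy).le

lemma v_pos {x y t : ℝ} (hy : 1 < y) (ht : 0 < t) (htx : t < x) : 0 < log (x/t) / log y :=
  div_pos (Real.log_pos ((one_lt_div ht).2 htx)) (Real.log_pos hy)

lemma hderiv (h : IsDick ρ) {x y t : ℝ} (hy : 1 < y) (ht : 0 < t) (htx : t < x) (hne : t ≠ x / y) :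
    HasDerivAt (fun t => RR ρ y (x / t)) (-(KK ρ y x t)) t := by
  have hL := Real.log_pos hy
  have hv1 : log (x/t) / log y ≠ 1 := by
    intro hc
    rw [div_eq_one_iff_eq hL.ne'] at hc
    have := Real.log_injOn_pos (Set.mem_Ioi.2 (div_pos (by linarith) ht)) (Set.mem_Ioi.2 (by linarith)) hc
    apply hne
    have hx0 : x ≠ 0 := by linarith
    rw [← this]; field_simp
  have h1 := (h.deriv_rr (v_pos hy ht htx) hv1).comp t (vderiv (y := y) (by linarith) ht)
  have h2 := ((hasDerivAt_const t x).div (hasDerivAt_id t) ht.ne').mul h1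
  refine (h2.congr_of_eventuallyEq ?_).congr_deriv ?_
  · exact Eventually.of_forall (fun s => rfl)
  · simp only [KK, id, Pi.div_apply, Function.comp]
    field_simp
    ring

lemma hcont (h : IsDick ρ) {x y a b : ℝ} (hy : 1 < y) (ha : 0 < a) (hb : b ≤ x) :
    ContinuousOn (fun t => RR ρ y (x / t)) (Set.Icc a b) := by
  intro t ht
  have ht0 : 0 < t := lt_of_lt_of_le ha ht.1
  have hx0 : 0 < x := by linarith [ht.2]
  unfold RR
  refine ContinuousWithinAt.mul ?_ ?_
  · exact ((continuousAt_const.div continuousAt_id ht0.ne')).continuousWithinAt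
  · refine ContinuousWithinAt.comp (t := Set.Ici 0) (h.cont _ (v_nonneg hy ht0 (ht.2.trans hb)))
      (vcont hx0 ht0).continuousWithinAt ?_
    intro s hs
    exact v_nonneg hy (lt_of_lt_of_le ha hs.1) (hs.2.trans hb)

lemma rv_anti (h : IsDick ρ) {x y a b : ℝ} (hy : 1 < y) (ha : 0 < a) (hb : b ≤ x) :
    AntitoneOn (fun t => rr ρ (log (x/t) / log y)) (Set.Icc a b) := by
  intro s hs t ht hst
  refine h.rr_mono ?_
  have := Real.log_pos hy
  have hs0 : 0 < s := lt_of_lt_of_le ha hs.1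
  have hx0 : 0 < x := by linarith [ht.2]
  have ht0 : 0 < t := lt_of_lt_of_le ha ht.1
  have : log (x/t) ≤ log (x/s) := by gcongr
  gcongr

lemma KK_ii (h : IsDick ρ) {x y a b : ℝ} (hy : 1 < y) (ha : 0 < a) (hab : a ≤ b) (hb : b ≤ x) :
    IntervalIntegrable (KK ρ y x) MeasureTheory.volume a b := by
  have h1 : IntervalIntegrable (fun t => rr ρ (log (x/t) / log y)) MeasureTheory.volume a b := by
    refine AntitoneOn.intervalIntegrable ?_
    rw [Set.uIcc_of_le hab]; exact h.rv_anti hy ha hb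
  have h2 : IntervalIntegrable (fun t => 1 - rr ρ (log (x/t) / log y) / log y) MeasureTheory.volume a b :=
    intervalIntegrable_const.sub (h1.div_const _)
  have h3 : ContinuousOn (fun t => x / t ^ 2 * ρ (log (x / t) / log y)) (Set.uIcc a b) := by
    rw [Set.uIcc_of_le hab]
    have := (h.hcont hy ha hb).div continuousOn_id (fun t ht => (lt_of_lt_of_le ha ht.1).ne')
    refine this.congr ?_
    intro t ht
    have := (lt_of_lt_of_le ha ht.1).ne'
    simp only [RR, id, Pi.div_apply]; field_simp
  exact h2.continuousOn_mul h3

lemma int_KK (h : IsDick ρ) {x y a b : ℝ} (hy : 1 < y) (ha : 0 < a) (hab : a ≤ b) (hb : b ≤ x) :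
    ∫ t in a..b, KK ρ y x t = RR ρ y (x/a) - RR ρ y (x/b) := by
  have := MeasureTheory.integral_eq_of_hasDerivAt_off_countable (fun t => RR ρ y (x/t))
    (fun t => - KK ρ y x t) (a := a) (b := b) (s := {x/y}) (Set.countable_singleton _)
    (by rw [Set.uIcc_of_le hab]; exact h.hcont hy ha hb)
    (by
      rw [min_eq_left hab, max_eq_right hab]
      intro t ht
      exact h.hderiv hy (by linarith [ht.1.1]) (by linarith [ht.1.2]) ht.2)
    (h.KK_ii hy ha hab hb).neg
  rw [intervalIntegral.integral_neg] at this
  linarith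

lemma int_tKK (h : IsDick ρ) {x y a b : ℝ} (hy : 1 < y) (ha : 0 < a) (hab : a ≤ b) (hb : b ≤ x) :
    ∫ t in a..b, t * KK ρ y x t = (∫ t in a..b, RR ρ y (x/t)) + a * RR ρ y (x/a) - b * RR ρ y (x/b) := by
  have c1 := h.hcont hy ha hb
  have i1 : IntervalIntegrable (fun t => RR ρ y (x/t)) MeasureTheory.volume a b := by
    rw [← Set.uIcc_of_le hab] at c1; exact c1.intervalIntegrable
  have i2 : IntervalIntegrable (fun t => t * KK ρ y x t) MeasureTheory.volume a b :=
    (h.KK_ii hy ha hab hb).continuousOn_mul continuousOn_id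
  have := MeasureTheory.integral_eq_of_hasDerivAt_off_countable (fun t => t * RR ρ y (x/t))
    (fun t => RR ρ y (x/t) - t * KK ρ y x t) (a := a) (b := b) (s := {x/y}) (Set.countable_singleton _)
    (by rw [Set.uIcc_of_le hab]; exact continuousOn_id.mul c1)
    (by
      rw [min_eq_left hab, max_eq_right hab]
      intro t ht
      refine ((hasDerivAt_id t).mul (h.hderiv hy (by linarith [ht.1.1]) (by linarith [ht.1.2]) ht.2)).congr_deriv ?_
      simp only [id]; ring)
    (i1.sub i2)
  rw [intervalIntegral.integral_sub i1 i2] at this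
  linarith

lemma int_RR (h : IsDick ρ) {x y : ℝ} (hy : 1 < y) (hx : y ≤ x) :
    ∫ t in (1:ℝ)..y, RR ρ y (x/t) = RR ρ y x * log x := by
  have hL := Real.log_pos hy
  have hx0 : 0 < x := by linarith
  set P := fun u => ∫ v in (0:ℝ)..u, ρ v with hP
  have c1 := h.hcont (x := x) hy one_pos hx
  have i1 : IntervalIntegrable (fun t => RR ρ y (x/t)) MeasureTheory.volume 1 y := by
    rw [← Set.uIcc_of_le hy.le] at c1; exact c1.intervalIntegrable
  have := intervalIntegral.integral_eq_sub_of_hasDerivAt_of_le hy.le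
    (f := fun t => -(x * log y) * P (log (x/t) / log y)) (f' := fun t => RR ρ y (x/t)) (by
      refine continuousOn_const.mul (h.int_cont.comp ?_ ?_)
      · intro t ht; exact (vcont hx0 (by linarith [ht.1])).continuousWithinAt
      · intro t ht; exact v_nonneg hy (by linarith [ht.1]) (ht.2.trans hx))
    (by
      intro t ht
      have ht0 : 0 < t := by linarith [ht.1]
      have h1 := (h.int_deriv (v_pos hy ht0 (show t < x by linarith [ht.2]))).comp t (vderiv (y := y) hx0 ht0)
      refine (h1.const_mul _).congr_deriv ?_
      simp only [RR]
      field_simp) i1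
  rw [this]
  have hu : 1 ≤ log x / log y := by
    rw [one_le_div hL]; exact Real.log_le_log (by linarith) hx
  have hm := h.mul_eq hu
  have e : (∫ v in (log x / log y-1)..log x / log y, ρ v) = P (log x / log y) - P (log x / log y-1) := by
    simp only [hP]
    rw [intervalIntegral.integral_interval_sub_left (h.ii le_rfl (by linarith)) (h.ii le_rfl (by linarith))]
  rw [e] at hm
  rw [div_one, Real.log_div hx0.ne' (by linarith), sub_div, div_self hL.ne', RR]
  have : log x = log y * (log x / log y) := by field_simp
  calc _ = x * log y * (P (log x / log y) - P (log x / log y - 1)) := by ring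
    _ = x * log y * (log x / log y * ρ (log x / log y)) := by rw [hm]
    _ = _ := by field_simp

lemma common (h : IsDick ρ) {x y : ℝ} (hy : 1 < y) (hx : y ≤ x) :
    ∑ n ∈ Finset.Ioc 0 ⌊y⌋₊, ArithmeticFunction.vonMangoldt n * RR ρ y (x / n) =
      RR ρ y x * log x + RR ρ y (x/y) * Dl y + RR ρ y x + ∫ t in (1:ℝ)..y, Dl t * KK ρ y x t := by
  have hKi := h.KK_ii (x := x) hy one_pos hy.le hx
  -- psi as sum of indicators
  have hpsi : ∀ t ∈ Set.uIcc 1 y, Chebyshev.psi t * KK ρ y x t =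
      ∑ n ∈ Finset.Ioc 0 ⌊y⌋₊, ArithmeticFunction.vonMangoldt n *
        Set.indicator (Set.Ici (n:ℝ)) (KK ρ y x) t := by
    intro t ht
    rw [Set.uIcc_of_le hy.le] at ht
    have e : Finset.Ioc 0 ⌊t⌋₊ = (Finset.Ioc 0 ⌊y⌋₊).filter (fun n : ℕ => (n:ℝ) ≤ t) := by
      ext n
      rw [Finset.mem_filter, Finset.mem_Ioc, Finset.mem_Ioc]
      have := Nat.floor_mono ht.2
      rw [← Nat.le_floor_iff (by linarith [ht.1])]
      constructor
      · rintro ⟨a, b⟩; exact ⟨⟨a, b.trans this⟩, b⟩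
      · rintro ⟨⟨a, b⟩, c⟩; exact ⟨a, c⟩
    rw [Chebyshev.psi, e, Finset.sum_filter, Finset.sum_mul]
    refine Finset.sum_congr rfl ?_
    intro n _
    rw [Set.indicator_apply]
    simp only [Set.mem_Ici]
    split_ifs <;> simp
  have hii : ∀ n : ℕ, IntervalIntegrable (Set.indicator (Set.Ici (n:ℝ)) (KK ρ y x))
      MeasureTheory.volume 1 y := by
    intro n
    rw [intervalIntegrable_iff_integrableOn_Ioc_of_le hy.le]
    exact MeasureTheory.IntegrableOn.indicator
      ((intervalIntegrable_iff_integrableOn_Ioc_of_le hy.le).1 hKi) measurableSet_Ici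
  have hval : ∀ n ∈ Finset.Ioc 0 ⌊y⌋₊, ∫ t in (1:ℝ)..y, Set.indicator (Set.Ici (n:ℝ)) (KK ρ y x) t =
      RR ρ y (x / n) - RR ρ y (x / y) := by
    intro n hn
    rw [Finset.mem_Ioc] at hn
    have hn1 : (1:ℝ) ≤ n := by exact_mod_cast hn.1
    have hny : (n:ℝ) ≤ y := (Nat.le_floor_iff (by linarith)).1 hn.2
    rw [← intervalIntegral.integral_add_adjacent_intervals (b := (n:ℝ))
      ((hii n).mono_set (by rw [Set.uIcc_of_le hn1, Set.uIcc_of_le hy.le]; exact Set.Icc_subset_Icc_right hny))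
      ((hii n).mono_set (by rw [Set.uIcc_of_le hny, Set.uIcc_of_le hy.le]; exact Set.Icc_subset_Icc_left hn1))]
    have z : ∫ t in (1:ℝ)..n, Set.indicator (Set.Ici (n:ℝ)) (KK ρ y x) t = 0 := by
      rw [intervalIntegral.integral_of_le hn1, MeasureTheory.integral_Ioc_eq_integral_Ioo]
      rw [MeasureTheory.setIntegral_congr_fun (g := fun _ => (0:ℝ)) measurableSet_Ioo]
      · simp
      · intro t ht
        exact Set.indicator_of_notMem (by simpa using ht.2) _
    have z2 : ∫ t in (n:ℝ)..y, Set.indicator (Set.Ici (n:ℝ)) (KK ρ y x) t = ∫ t in (n:ℝ)..y, KK ρ y x t := by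
      refine intervalIntegral.integral_congr ?_
      intro t ht
      rw [Set.uIcc_of_le hny] at ht
      exact Set.indicator_of_mem (by simpa using ht.1) _
    rw [z, z2, h.int_KK hy (by linarith) hny hx, zero_add]
  have hsum : ∫ t in (1:ℝ)..y, Chebyshev.psi t * KK ρ y x t =
      (∑ n ∈ Finset.Ioc 0 ⌊y⌋₊, ArithmeticFunction.vonMangoldt n * RR ρ y (x / n)) -
        Chebyshev.psi y * RR ρ y (x/y) := by
    rw [intervalIntegral.integral_congr hpsi,
      intervalIntegral.integral_finsetSum (fun n _ => (hii n).const_mul _), Chebyshev.psi, Finset.sum_mul,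
      ← Finset.sum_sub_distrib]
    refine Finset.sum_congr rfl ?_
    intro n hn
    rw [intervalIntegral.integral_const_mul, hval n hn]; ring
  have i2 : IntervalIntegrable (fun t => t * KK ρ y x t) MeasureTheory.volume 1 y :=
    hKi.continuousOn_mul continuousOn_id
  have i3 : IntervalIntegrable (fun t => Chebyshev.psi t * KK ρ y x t) MeasureTheory.volume 1 y := by
    have : IntervalIntegrable (fun t => ∑ n ∈ Finset.Ioc 0 ⌊y⌋₊, ArithmeticFunction.vonMangoldt n *
        Set.indicator (Set.Ici (n:ℝ)) (KK ρ y x) t) MeasureTheory.volume 1 y := by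
      have := IntervalIntegrable.sum (μ := MeasureTheory.volume) (a := 1) (b := y) (Finset.Ioc 0 ⌊y⌋₊)
        (f := fun n t => ArithmeticFunction.vonMangoldt n * Set.indicator (Set.Ici (n:ℝ)) (KK ρ y x) t)
        (fun n _ => (hii n).const_mul _)
      refine this.congr ?_
      intro t _
      simp
    refine this.congr ?_
    intro t ht
    exact (hpsi t (Set.uIoc_subset_uIcc ht)).symm
  have e1 : ∫ t in (1:ℝ)..y, Dl t * KK ρ y x t = (∫ t in (1:ℝ)..y, Chebyshev.psi t * KK ρ y x t) -
      ∫ t in (1:ℝ)..y, t * KK ρ y x t := by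
    rw [← intervalIntegral.integral_sub i3 i2]
    refine intervalIntegral.integral_congr ?_
    intro t _
    simp only [Dl]; ring
  rw [e1, hsum, h.int_tKK hy one_pos hy.le hx, h.int_RR hy hx, div_one, Dl]
  ring

lemma DlK_ii (h : IsDick ρ) {x y a b : ℝ} (hy : 1 < y) (ha : 0 < a) (hab : a ≤ b) (hb : b ≤ x) :
    IntervalIntegrable (fun t => Dl t * KK ρ y x t) MeasureTheory.volume a b := by
  have hK := h.KK_ii hy ha hab hb
  rw [intervalIntegrable_iff_integrableOn_Ioc_of_le hab] at hK ⊢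
  refine MeasureTheory.Integrable.bdd_mul (c := Chebyshev.psi b + b) hK Dl_measurable.aestronglyMeasurable ?_
  refine (MeasureTheory.ae_restrict_mem measurableSet_Ioc).mono ?_
  intro t ht
  rw [Real.norm_eq_abs, abs_le, Dl]
  have h1 := Chebyshev.psi_mono ht.2
  have h2 := Chebyshev.psi_nonneg t
  constructor <;> linarith [ht.1, ht.2]

end IsDick


namespace IsDick
variable {ρ : ℝ → ℝ}

lemma RR_pos (h : IsDick ρ) {x y : ℝ} (hy : 1 < y) (hx : 1 ≤ x) : 0 < RR ρ y x :=
  mul_pos (by linarith) (h.pos (div_nonneg (Real.log_nonneg hx) (Real.log_pos hy).le))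

lemma KK_eq {x y t : ℝ} (ht : 0 < t) :
    KK ρ y x t = RR ρ y (x/t) * (1 - rr ρ (log (x / t) / log y) / log y) / t := by
  rw [KK, RR]; field_simp

lemma h_le (h : IsDick ρ) {x y t : ℝ} (hy : 1 < y) (ht : 1 ≤ t) (htx : t ≤ x) :
    RR ρ y (x/t) ≤ RR ρ y x * t ^ (-(1 - rr ρ (log x / log y) / log y)) := by
  have hL := Real.log_pos hy
  have ht0 : 0 < t := by linarith
  have hx0 : 0 < x := by linarith
  have h1 := h.le_exp (a := log (x/t) / log y) (b := log x / log y) (v_nonneg hy ht0 htx) (by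
    gcongr; exact div_le_self hx0.le ht)
  rw [Real.log_div hx0.ne' ht0.ne'] at h1
  have e : exp (rr ρ (log x / log y) * (log x / log y - (log x - log t) / log y)) =
      t ^ (rr ρ (log x / log y) / log y) := by
    rw [Real.rpow_def_of_pos ht0]; congr 1; field_simp; ring
  rw [e, ← Real.log_div hx0.ne' ht0.ne'] at h1
  rw [RR, RR, show -(1 - rr ρ (log x / log y) / log y) = rr ρ (log x / log y) / log y - 1 by ring,
    Real.rpow_sub ht0, Real.rpow_one]
  calc x / t * ρ (log (x/t) / log y) ≤ x / t * (ρ (log x / log y) * t ^ (rr ρ (log x / log y) / log y)) := by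
        gcongr
    _ = _ := by ring

lemma h_ge (h : IsDick ρ) {x y t : ℝ} (hy : 1 < y) (ht : 1 ≤ t) (htx : t ≤ x) :
    RR ρ y x * t ^ (-(1 - rr ρ (log (x/t) / log y) / log y)) ≤ RR ρ y (x/t) := by
  have hL := Real.log_pos hy
  have ht0 : 0 < t := by linarith
  have hx0 : 0 < x := by linarith
  have h1 := h.exp_le (a := log (x/t) / log y) (b := log x / log y) (v_nonneg hy ht0 htx) (by
    gcongr; exact div_le_self hx0.le ht)
  have e : exp (rr ρ (log (x/t) / log y) * (log x / log y - log (x/t) / log y)) =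
      t ^ (rr ρ (log (x/t) / log y) / log y) := by
    rw [Real.rpow_def_of_pos ht0]; congr 1
    rw [show log x / log y - log (x/t)/log y = log t / log y by
      rw [Real.log_div hx0.ne' ht0.ne']; field_simp; ring]
    ring
  rw [e] at h1
  rw [RR, RR, show -(1 - rr ρ (log (x/t) / log y) / log y) = rr ρ (log (x/t) / log y) / log y - 1 by ring,
    Real.rpow_sub ht0, Real.rpow_one]
  calc _ = x / t * (ρ (log x / log y) * t ^ (rr ρ (log (x/t) / log y) / log y)) := by ring
    _ ≤ _ := by gcongr

lemma pow_close {α η lam t T : ℝ} (hα : 0 ≤ α) (h2 : lam ≤ α + η) (hη : 0 ≤ η)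
    (ht : 1 ≤ t) (htT : t ≤ T) : t ^ (-α) - η * log T ≤ t ^ (-lam) := by
  have ht0 : 0 < t := by linarith
  have hl := Real.log_nonneg ht
  have hlT : log t ≤ log T := Real.log_le_log ht0 htT
  have h3 : t ^ (-(α + η)) ≤ t ^ (-lam) := Real.rpow_le_rpow_of_exponent_le ht (by linarith)
  have h4 : t ^ (-α) ≤ 1 := Real.rpow_le_one_of_one_le_of_nonpos ht (by linarith)
  have h5 : 1 - η * log t ≤ t ^ (-η) := by
    rw [Real.rpow_def_of_pos ht0]
    have := Real.add_one_le_exp (log t * -η)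
    linarith
  have h6 : 0 < t ^ (-α) := by positivity
  rw [neg_add, Real.rpow_add ht0] at h3
  have : η * log t ≤ η * log T := by gcongr
  nlinarith [mul_nonneg hη hl]

end IsDick

lemma tail_int {T δ : ℝ} (hT : 1 ≤ T) (hδ : 0 < δ) :
    MeasureTheory.IntegrableOn (fun t : ℝ => t ^ (-1 - δ)) (Set.Ioi T) ∧
    ∫ t in Set.Ioi T, t ^ (-1 - δ) = T ^ (-δ) / δ := by
  refine ⟨integrableOn_Ioi_rpow_of_lt (by linarith) (by linarith), ?_⟩
  rw [integral_Ioi_rpow_of_lt (by linarith) (by linarith)]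
  rw [show -1 - δ + 1 = -δ by ring, neg_div_neg_eq]

lemma tail_D {T δ C α : ℝ} (hT : 1 ≤ T) (hδ : 0 < δ) (hC : ∀ t ≥ (1:ℝ), |Dl t| ≤ C * t ^ (1/2 + δ))
    (hα : 1/2 + 2 * δ ≤ α) :
    |∫ t in Set.Ioi T, Dl t * t ^ (-(α + 1))| ≤ C * (T ^ (-δ) / δ) := by
  rw [← (tail_int hT hδ).2, ← MeasureTheory.integral_const_mul, ← Real.norm_eq_abs]
  refine MeasureTheory.norm_integral_le_of_norm_le ((tail_int hT hδ).1.const_mul C) ?_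
  refine (MeasureTheory.ae_restrict_mem measurableSet_Ioi).mono ?_
  intro t ht
  have ht1 : 1 ≤ t := hT.trans (le_of_lt ht)
  have ht0 : 0 < t := by linarith
  have h1 := hC t ht1
  have h2 : t ^ (1/2 + δ) * t ^ (-(α + 1)) ≤ t ^ (-1 - δ) := by
    rw [← Real.rpow_add ht0]
    exact Real.rpow_le_rpow_of_exponent_le ht1 (by linarith)
  have hC0 : 0 ≤ C := by
    have := (abs_nonneg _).trans (hC 1 le_rfl)
    simpa using this
  rw [norm_mul, Real.norm_eq_abs, Real.norm_of_nonneg (by positivity : 0 ≤ t ^ (-(α+1)))]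
  calc _ ≤ C * t ^ (1/2 + δ) * t ^ (-(α + 1)) := by gcongr
    _ = C * (t ^ (1/2 + δ) * t ^ (-(α + 1))) := by ring
    _ ≤ _ := by gcongr

lemma tail_K {ρ : ℝ → ℝ} (h : IsDick ρ) {x y T δ C α : ℝ} (hy : 1 < y) (hx : y ≤ x) (hT : 1 ≤ T) (hTy : T ≤ y)
    (hδ : 0 < δ) (hC : ∀ t ≥ (1:ℝ), |Dl t| ≤ C * t ^ (1/2 + δ))
    (hα : 1/2 + 2 * δ ≤ α) (hαe : α = 1 - rr ρ (log x / log y) / log y) :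
    |∫ t in T..y, Dl t * KK ρ y x t| ≤ RR ρ y x * (C * (T ^ (-δ) / δ)) := by
  have hL := Real.log_pos hy
  have hR := h.RR_pos hy (show 1 ≤ x by linarith)
  have hC0 : 0 ≤ C := by
    have := (abs_nonneg _).trans (hC 1 le_rfl)
    simpa using this
  have hint := (tail_int hT hδ).1.const_mul (RR ρ y x * C)
  calc |∫ t in T..y, Dl t * KK ρ y x t| ≤ ∫ t in T..y, RR ρ y x * C * t ^ (-1 - δ) := by
        rw [← Real.norm_eq_abs]
        refine intervalIntegral.norm_integral_le_of_norm_le hTy (Eventually.of_forall ?_) ?_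
        · intro t ht
          have ht1 : 1 ≤ t := hT.trans ht.1.le
          have ht0 : 0 < t := by linarith
          have htx : t ≤ x := ht.2.trans hx
          have h1 := hC t ht1
          have hl := h.h_le hy ht1 htx
          rw [← hαe] at hl
          have hr1 := h.rr_nonneg (log (x/t) / log y)
          have hr2 : rr ρ (log (x/t) / log y) ≤ rr ρ (log x / log y) := h.rr_mono (by
            have hx0 : 0 < x := by linarith
            have : log (x/t) ≤ log x := Real.log_le_log (by positivity) (div_le_self hx0.le ht1)
            exact div_le_div_of_nonneg_right this hL.le)
          have hr3 : rr ρ (log (x/t) / log y) / log y ≤ rr ρ (log x / log y) / log y := by gcongr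
          have hr4 : 0 ≤ rr ρ (log (x/t) / log y) / log y := by positivity
          have hp := h.RR_pos hy (show 1 ≤ x / t from (one_le_div ht0).2 htx)
          have hK0 : 0 ≤ RR ρ y (x/t) * (1 - rr ρ (log (x / t) / log y) / log y) / t :=
            div_nonneg (mul_nonneg hp.le (by linarith)) ht0.le
          rw [norm_mul, Real.norm_eq_abs, Real.norm_eq_abs, IsDick.KK_eq ht0, abs_of_nonneg hK0]
          calc _ ≤ (C * t ^ (1/2 + δ)) * (RR ρ y x * t ^ (-α) * 1 / t) := by
                refine mul_le_mul h1 ?_ hK0 (by positivity)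
                refine div_le_div_of_nonneg_right ?_ ht0.le
                exact mul_le_mul hl (by linarith) (by linarith) (by positivity)
            _ = RR ρ y x * C * t ^ (1/2 + δ - α - 1) := by
                generalize (1/2 + δ : ℝ) = e
                rw [sub_eq_add_neg e α, Real.rpow_sub ht0, Real.rpow_add ht0, Real.rpow_one]; ring
            _ ≤ _ := by
                have : t ^ (1/2 + δ - α - 1) ≤ t ^ (-1 - δ) :=
                  Real.rpow_le_rpow_of_exponent_le ht1 (by linarith)
                gcongr
        · rw [intervalIntegrable_iff_integrableOn_Ioc_of_le hTy]
          exact MeasureTheory.IntegrableOn.mono_set hint Set.Ioc_subset_Ioi_self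
    _ ≤ ∫ t in Set.Ioi T, RR ρ y x * C * t ^ (-1 - δ) := by
        rw [intervalIntegral.integral_of_le hTy]
        refine MeasureTheory.setIntegral_mono_set hint ?_ (Eventually.of_forall Set.Ioc_subset_Ioi_self)
        refine (MeasureTheory.ae_restrict_mem measurableSet_Ioi).mono ?_
        intro t ht
        have ht0 : 0 < t := lt_of_lt_of_le (by linarith) (le_of_lt ht)
        simp only [Pi.zero_apply]; positivity
    _ = _ := by rw [MeasureTheory.integral_const_mul, (tail_int hT hδ).2]; ring


namespace IsDick
variable {ρ : ℝ → ℝ}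

lemma close (h : IsDick ρ) {x y T α η t : ℝ} (hy : 1 < y) (hTx : T ≤ x)
    (hα : 0 ≤ α) (hαe : α = 1 - rr ρ (log x / log y) / log y) (hη : 0 ≤ η)
    (hcl : rr ρ (log x / log y) - rr ρ (log (x/T) / log y) ≤ η * log y) (ht : 1 ≤ t) (htT : t ≤ T) :
    RR ρ y x * (t ^ (-α) - η * log T) ≤ RR ρ y (x/t) ∧ RR ρ y (x/t) ≤ RR ρ y x * t ^ (-α) ∧
    α ≤ 1 - rr ρ (log (x/t) / log y) / log y ∧ 1 - rr ρ (log (x/t) / log y) / log y ≤ α + η := by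
  have hL := Real.log_pos hy
  have htx := htT.trans hTx
  have ht0 : 0 < t := by linarith
  have hx0 : 0 < x := by linarith
  have hR := h.RR_pos hy (show 1 ≤ x by linarith)
  have hr1 : rr ρ (log (x/t) / log y) ≤ rr ρ (log x / log y) := h.rr_mono
    (div_le_div_of_nonneg_right (Real.log_le_log (by positivity) (div_le_self hx0.le ht)) hL.le)
  have hr2 : rr ρ (log (x/T) / log y) ≤ rr ρ (log (x/t) / log y) := h.rr_mono
    (div_le_div_of_nonneg_right (Real.log_le_log (div_pos hx0 (by linarith)) (by gcongr)) hL.le)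
  have h3 : rr ρ (log (x/t) / log y) / log y ≤ rr ρ (log x / log y) / log y := by gcongr
  have h4 : 1 - rr ρ (log (x/t) / log y) / log y ≤ α + η := by
    have : (rr ρ (log x / log y) - rr ρ (log (x/t) / log y)) / log y ≤ η := by
      rw [div_le_iff₀ hL]; linarith
    rw [sub_div] at this; linarith
  refine ⟨?_, ?_, by linarith, h4⟩
  · refine le_trans ?_ (h.h_ge hy ht htx)
    exact mul_le_mul_of_nonneg_left (pow_close hα h4 hη ht htT) hR.le
  · rw [hαe]; exact h.h_le hy ht htx

lemma src1 (h : IsDick ρ) {x y T α η δ : ℝ} (hy : 1 < y) (hT : 1 ≤ T) (hTx : T ≤ x)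
    (hα : 1/2 + 2 * δ ≤ α) (hδ : 0 < δ) (hαe : α = 1 - rr ρ (log x / log y) / log y) (hη : 0 ≤ η)
    (hcl : rr ρ (log x / log y) - rr ρ (log (x/T) / log y) ≤ η * log y) :
    RR ρ y x * (1/α - 2 * T ^ (-δ) - η * (log T)^2) ≤ ∫ s in (x/T)..x, RR ρ y s / s := by
  have hα0 : 0 < α := by linarith
  have hx1 : 1 ≤ x := by linarith
  have hx0 : 0 < x := by linarith
  have hT0 : 0 < T := by linarith
  have hR := h.RR_pos hy hx1
  have hxT : x / T ≤ x := div_le_self hx0.le hT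
  have hxT0 : 0 < x / T := by positivity
  have hne : (0:ℝ) ∉ Set.uIcc (x/T) x := by
    rw [Set.uIcc_of_le hxT]; intro hc; linarith [hc.1]
  have i1 : IntervalIntegrable (fun s : ℝ => s ^ (α - 1)) MeasureTheory.volume (x/T) x :=
    intervalIntegral.intervalIntegrable_rpow (Or.inr hne)
  have i2 : IntervalIntegrable (fun s : ℝ => 1 / s) MeasureTheory.volume (x/T) x :=
    intervalIntegral.intervalIntegrable_one_div (fun s hs hc => hne (hc ▸ hs)) continuousOn_id
  have e1 : ∫ s in (x/T)..x, (RR ρ y x * x ^ (-α) * s ^ (α - 1) - RR ρ y x * (η * log T) * (1 / s)) =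
      RR ρ y x * ((1 - T ^ (-α)) / α - η * (log T)^2) := by
    rw [intervalIntegral.integral_sub (i1.const_mul _) (i2.const_mul _), intervalIntegral.integral_const_mul,
      intervalIntegral.integral_const_mul, integral_rpow (Or.inl (by linarith)), integral_one_div hne]
    rw [show x / (x / T) = T by field_simp, sub_add_cancel, Real.div_rpow hx0.le hT0.le,
      Real.rpow_neg hx0.le, Real.rpow_neg hT0.le]
    have := (Real.rpow_pos_of_pos hx0 α).ne'
    have := (Real.rpow_pos_of_pos hT0 α).ne'
    field_simp
  have h1 : RR ρ y x * (1/α - 2 * T ^ (-δ) - η * (log T)^2) ≤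
      RR ρ y x * ((1 - T ^ (-α)) / α - η * (log T)^2) := by
    refine mul_le_mul_of_nonneg_left ?_ hR.le
    have : T ^ (-α) ≤ T ^ (-δ) := Real.rpow_le_rpow_of_exponent_le hT (by linarith)
    have h2 : T ^ (-α) / α ≤ T^(-δ) / (1/2) := div_le_div₀ (by positivity) this (by norm_num) (by linarith)
    rw [sub_div]; linarith
  refine h1.trans (e1 ▸ ?_)
  refine intervalIntegral.integral_mono_on hxT ((i1.const_mul _).sub (i2.const_mul _)) ?_ ?_
  · refine ContinuousOn.intervalIntegrable ?_
    rw [Set.uIcc_of_le hxT]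
    intro s hs
    have hs0 : 0 < s := lt_of_lt_of_le hxT0 hs.1
    have hs1 : 1 ≤ s := le_trans ((one_le_div hT0).2 hTx) hs.1
    refine ContinuousWithinAt.div ?_ continuousWithinAt_id hs0.ne'
    unfold RR
    refine continuousWithinAt_id.mul ?_
    refine ContinuousWithinAt.comp (t := Set.Ici 0) (h.cont _ (div_nonneg (Real.log_nonneg hs1) (Real.log_pos hy).le)) ?_ ?_
    · exact ((Real.continuousAt_log hs0.ne').div_const _).continuousWithinAt
    · intro w hw
      exact div_nonneg (Real.log_nonneg (le_trans ((one_le_div hT0).2 hTx) hw.1)) (Real.log_pos hy).le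
  · intro s hs
    have hs0 : 0 < s := lt_of_lt_of_le hxT0 hs.1
    have hc := (h.close (t := x / s) hy hTx hα0.le hαe hη hcl ((one_le_div hs0).2 hs.2)
      (by rw [div_le_iff₀ hs0]; linarith [(div_le_iff₀ hT0).1 hs.1])).1
    rw [show x / (x / s) = s by field_simp] at hc
    rw [le_div_iff₀ hs0]
    refine le_trans (le_of_eq ?_) hc
    rw [Real.div_rpow hx0.le hs0.le, Real.rpow_sub hs0, Real.rpow_one, Real.rpow_neg hs0.le]
    have := (Real.rpow_pos_of_pos hs0 α).ne'
    field_simp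

lemma src2 (h : IsDick ρ) {x y T α η δ : ℝ} (hy : 1 < y) (hT : 1 ≤ T) (hTx : T ≤ x)
    (hα : 1/2 + 2 * δ ≤ α) (hδ : 0 < δ) (hαe : α = 1 - rr ρ (log x / log y) / log y) (hη : 0 ≤ η)
    (hcl : rr ρ (log x / log y) - rr ρ (log (x/T) / log y) ≤ η * log y) :
    RR ρ y x * (α * (∫ t in (1:ℝ)..T, Dl t * t ^ (-(α+1))) - 7 * T * (η * (1 + log T))) ≤
      ∫ t in (1:ℝ)..T, Dl t * KK ρ y x t := by
  have hL := Real.log_pos hy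
  have hα0 : 0 < α := by linarith
  have hα1 : α ≤ 1 := by
    have : 0 ≤ rr ρ (log x / log y) / log y := div_nonneg (h.rr_nonneg _) hL.le
    linarith
  have hR := h.RR_pos hy (show 1 ≤ x by linarith)
  have hlT := Real.log_nonneg hT
  have i1 : IntervalIntegrable (fun t : ℝ => Dl t * t ^ (-(α+1))) MeasureTheory.volume 1 T := by
    refine (Dl_intervalIntegrable 1 T).mul_continuousOn ?_
    rw [Set.uIcc_of_le hT]
    intro s hs
    exact (Real.continuousAt_rpow_const _ _ (Or.inl (by linarith [hs.1]))).continuousWithinAt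
  have e1 : ∫ t in (1:ℝ)..T, (RR ρ y x * α * (Dl t * t ^ (-(α+1))) - RR ρ y x * (7 * (η * (1 + log T)))) =
      RR ρ y x * (α * (∫ t in (1:ℝ)..T, Dl t * t ^ (-(α+1))) - 7 * (T-1) * (η * (1 + log T))) := by
    rw [intervalIntegral.integral_sub (i1.const_mul _) intervalIntegrable_const, intervalIntegral.integral_const_mul,
      intervalIntegral.integral_const, smul_eq_mul]
    ring
  refine le_trans ?_ (e1 ▸ intervalIntegral.integral_mono_on_of_le_Ioo hT ((i1.const_mul _).sub intervalIntegrable_const)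
    (h.DlK_ii hy one_pos hT hTx) ?_)
  · refine mul_le_mul_of_nonneg_left ?_ hR.le
    have : 0 ≤ η * (1 + log T) := by positivity
    linarith
  · intro t ht
    have ht1 := ht.1
    have ht0 : 0 < t := by linarith
    obtain ⟨c1, c2, c3, c4⟩ := h.close hy hTx hα0.le hαe hη hcl ht1.le ht.2.le
    rw [KK_eq ht0]
    have hd := Dl_bd t ht1
    rw [Real.rpow_one] at hd
    set lam := 1 - rr ρ (log (x/t) / log y) / log y
    set H := RR ρ y (x/t)
    set R := RR ρ y x
    have hp : t ^ (-α) ≤ 1 := Real.rpow_le_one_of_one_le_of_nonpos ht1.le (by linarith)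
    have hHR : H ≤ R := c2.trans (by nlinarith)
    have hH : 0 < H := h.RR_pos hy ((one_le_div ht0).2 (ht.2.le.trans hTx))
    have hab : |H * lam - R * α * t ^ (-α)| ≤ R * (η * (1 + log T)) := by
      have e : H * lam - R * α * t^(-α) = H * (lam - α) - α * (R * t^(-α) - H) := by ring
      have b1 : H * (lam - α) ≤ R * η := mul_le_mul hHR (by linarith) (by linarith) hR.le
      have b2 : 0 ≤ H * (lam - α) := mul_nonneg hH.le (by linarith)
      have b3 : α * (R * t^(-α) - H) ≤ 1 * (R * (η * log T)) :=
        mul_le_mul hα1 (by linarith) (by linarith) zero_le_one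
      have b4 : 0 ≤ α * (R * t^(-α) - H) := mul_nonneg hα0.le (by linarith)
      rw [e, abs_le]
      have : 0 ≤ R * (η * log T) := by positivity
      have : 0 ≤ R * η := by positivity
      constructor <;> nlinarith
    have e2 : R * α * (Dl t * t ^ (-(α + 1))) - Dl t * (H * lam / t) = - (Dl t / t * (H * lam - R * α * t^(-α))) := by
      rw [neg_add, ← sub_eq_add_neg, Real.rpow_sub ht0, Real.rpow_one]; field_simp; ring
    have h7 : |Dl t / t| ≤ 7 := by
      rw [abs_div, abs_of_pos ht0, div_le_iff₀ ht0]; exact hd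
    have h8 : |Dl t / t * (H * lam - R * α * t^(-α))| ≤ 7 * (R * (η * (1 + log T))) := by
      rw [abs_mul]; exact mul_le_mul h7 hab (abs_nonneg _) (by norm_num)
    have := (abs_le.1 h8).1
    linarith

lemma src (h : IsDick ρ) {x y T α η δ C : ℝ} (hy : 1 < y) (hT : 1 ≤ T) (hTy : T ≤ y) (hyx : y ≤ x)
    (hC : ∀ t ≥ (1:ℝ), |Dl t| ≤ C * t ^ (1/2 + δ))
    (hα : 1/2 + 2 * δ ≤ α) (hδ : 0 < δ) (hδ2 : δ ≤ 1/4) (hαe : α = 1 - rr ρ (log x / log y) / log y) (hη : 0 ≤ η)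
    (hcl : rr ρ (log x / log y) - rr ρ (log (x/T) / log y) ≤ η * log y) :
    RR ρ y x * (log x + (1/α + 1 + α * ∫ t in Set.Ioi 1, Dl t * t^(-(α+1)))
       - ((2 + C + 2 * C / δ) * T ^ (-δ) + η * (1 + log T) * (log T + 7 * T))) ≤
      (∫ s in (x/T)..x, RR ρ y s / s) +
       ∑ n ∈ Finset.Ioc 0 ⌊y⌋₊, ArithmeticFunction.vonMangoldt n * RR ρ y (x / n) := by
  have hL := Real.log_pos hy
  have hTx := hTy.trans hyx
  have hy0 : 0 < y := by linarith
  have hα0 : 0 < α := by linarith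
  have hα1 : α ≤ 1 := by
    have : 0 ≤ rr ρ (log x / log y) / log y := div_nonneg (h.rr_nonneg _) hL.le
    linarith
  have hR := h.RR_pos hy (show 1 ≤ x by linarith)
  have hlT := Real.log_nonneg hT
  have hC0 : 0 ≤ C := by
    have := (abs_nonneg _).trans (hC 1 le_rfl)
    simpa using this
  have s1 := h.src1 hy hT hTx hα hδ hαe hη hcl
  have s2 := h.src2 hy hT hTx hα hδ hαe hη hcl
  have s3 := (abs_le.1 (tail_K h hy hyx hT hTy hδ hC hα hαe)).1
  have s4 := (abs_le.1 (tail_D hT hδ hC hα)).2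
  rw [h.common hy hyx]
  rw [← intervalIntegral.integral_add_adjacent_intervals (h.DlK_ii hy one_pos hT hTx)
    (h.DlK_ii hy (by linarith) hTy hyx)]
  have hint : MeasureTheory.IntegrableOn (fun t => Dl t * t^(-(α+1))) (Set.Ioi 1) :=
    real_integrable Dl_measurable (a := 1/2 + δ) (C := C) (fun t ht => hC t ht.le) (by linarith)
  have e1 : ∫ t in Set.Ioi 1, Dl t * t^(-(α+1)) =
      (∫ t in (1:ℝ)..T, Dl t * t^(-(α+1))) + ∫ t in Set.Ioi T, Dl t * t^(-(α+1)) := by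
    rw [intervalIntegral.integral_of_le hT, ← MeasureTheory.setIntegral_union (Set.Ioc_disjoint_Ioi le_rfl) measurableSet_Ioi
      (hint.mono_set Set.Ioc_subset_Ioi_self) (hint.mono_set (Set.Ioi_subset_Ioi hT)), Set.Ioc_union_Ioi_eq_Ioi hT]
  have s5 : - (RR ρ y x * (C * T ^ (-δ))) ≤ RR ρ y (x/y) * Dl y := by
    have b1 := h.h_le hy hy.le hyx
    rw [← hαe] at b1
    have b2 := hC y hy.le
    have b3 : 0 < RR ρ y (x/y) := h.RR_pos hy ((one_le_div hy0).2 hyx)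
    have b4 : |RR ρ y (x/y) * Dl y| ≤ (RR ρ y x * y ^ (-α)) * (C * y ^ (1/2+δ)) := by
      rw [abs_mul, abs_of_pos b3]; exact mul_le_mul b1 b2 (abs_nonneg _) (by positivity)
    have b5 : y ^ (-α) * y ^ (1/2+δ) ≤ T ^ (-δ) := by
      rw [← Real.rpow_add hy0]
      refine (Real.rpow_le_rpow_of_exponent_le hy.le (show _ ≤ -δ by linarith)).trans ?_
      exact Real.rpow_le_rpow_of_nonpos (by linarith) hTy (by linarith)
    have b6 : (RR ρ y x * y ^ (-α)) * (C * y ^ (1/2+δ)) ≤ RR ρ y x * (C * T ^ (-δ)) := by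
      calc _ = RR ρ y x * (C * (y ^ (-α) * y ^ (1/2+δ))) := by ring
        _ ≤ _ := by gcongr
    linarith [(abs_le.1 b4).1]
  have s6 : RR ρ y x * (α * ∫ t in Set.Ioi T, Dl t * t^(-(α+1))) ≤ RR ρ y x * (C * (T ^ (-δ) / δ)) := by
    refine mul_le_mul_of_nonneg_left ?_ hR.le
    have : 0 ≤ C * (T ^ (-δ) / δ) := by positivity
    nlinarith
  rw [e1]
  have e2 : 2 * C / δ * T ^ (-δ) = 2 * (C * (T ^ (-δ) / δ)) := by ring
  have e3 : RR ρ y x * (log x + (1/α + 1 + α * ((∫ t in (1:ℝ)..T, Dl t * t^(-(α+1))) + ∫ t in Set.Ioi T, Dl t * t^(-(α+1))))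
       - ((2 + C + 2 * C / δ) * T ^ (-δ) + η * (1 + log T) * (log T + 7 * T))) =
      RR ρ y x * log x + RR ρ y x + RR ρ y x * (1/α - 2 * T ^ (-δ) - η * (log T)^2)
      - RR ρ y x * (C * T ^ (-δ)) + RR ρ y x * (α * (∫ t in (1:ℝ)..T, Dl t * t ^ (-(α+1))) - 7 * T * (η * (1 + log T)))
      + RR ρ y x * (α * ∫ t in Set.Ioi T, Dl t * t^(-(α+1))) - 2 * (RR ρ y x * (C * (T ^ (-δ) / δ)))
      - RR ρ y x * (η * log T) := by ring
  have : 0 ≤ RR ρ y x * (η * log T) := by positivity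
  linarith

end IsDick


lemma exists_T {K δ c : ℝ} (hδ : 0 < δ) (hc : 0 < c) : ∃ T : ℝ, 2 ≤ T ∧ K * T ^ (-δ) ≤ c := by
  have h1 : Tendsto (fun T : ℝ => K * T ^ (-δ)) atTop (nhds (K * 0)) :=
    (tendsto_rpow_neg_atTop hδ).const_mul K
  rw [mul_zero] at h1
  exact ((h1.eventually (gt_mem_nhds hc)).and (eventually_ge_atTop 2)).exists.imp (fun T hT => ⟨hT.2, hT.1.le⟩)

namespace IsDick
variable {ρ : ℝ → ℝ}

lemma log_u_le {x y θ : ℝ} (hL : 1 ≤ log y) (hy : 1 < y) (hyx : y ≤ x) (hx : log x ≤ y ^ θ) :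
    1 ≤ log x / log y ∧ log (log x / log y) ≤ θ * log y := by
  have h1 : log y ≤ log x := Real.log_le_log (by linarith) hyx
  have h2 : 1 ≤ log x / log y := by rwa [one_le_div (by linarith)]
  refine ⟨h2, ?_⟩
  rw [← Real.log_rpow (by linarith)]
  refine Real.log_le_log (by linarith) (le_trans (div_le_self (by linarith) hL) hx)

lemma src_final (h : IsDick ρ) (hRH : RiemannHypothesis) {θ : ℝ} (hθ : 0 < θ) (hθ2 : θ < 1/2) :
    ∃ c T y1 : ℝ, 0 < c ∧ 2 ≤ T ∧ T ≤ y1 ∧ ∀ y ≥ y1, ∀ x ≥ T * y, log x ≤ y ^ θ →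
      rr ρ (log x / log y) ≤ log y ∧ RR ρ y x * log x + c * RR ρ y x ≤
      (∫ s in (x/T)..x, RR ρ y s / s) +
       ∑ n ∈ Finset.Ioc 0 ⌊y⌋₊, ArithmeticFunction.vonMangoldt n * RR ρ y (x / n) := by
  obtain ⟨δ, hδe⟩ : ∃ δ, δ = (1/2 - θ) / 6 := ⟨_, rfl⟩
  have hδ : 0 < δ := by linarith
  obtain ⟨C, hC0, hC⟩ := psi_RH hRH hδ
  obtain ⟨c0, hc0, hP⟩ := lemmaP hRH
  obtain ⟨T, hT, hT2⟩ := exists_T (K := 2 + C + 2 * C / δ) hδ (show 0 < c0 / 4 by positivity)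
  have hlT : 0 < log T := Real.log_pos (by linarith)
  obtain ⟨η, hηe⟩ : ∃ η, η = c0 / 4 / ((1 + log T) * (log T + 7 * T)) := ⟨_, rfl⟩
  have hη : 0 < η := by rw [hηe]; positivity
  have hη2 : η * (1 + log T) * (log T + 7 * T) = c0 / 4 := by rw [hηe]; field_simp
  obtain ⟨C1, hC1, hr1⟩ := h.rr_le_log (show 0 < 1/2 - θ by linarith)
  obtain ⟨C2, hC2, hr2⟩ := h.rr_le_log hη
  obtain ⟨M, hM1, hM2, hM3, hM4⟩ : ∃ M : ℝ, 1 ≤ M ∧ C1 / δ ≤ M ∧ 2 * (C2 + 1) / η ≤ M ∧ log T ≤ M :=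
    ⟨max (max 1 (C1 / δ)) (max (2 * (C2 + 1) / η) (log T)), by simp, by simp, by simp, by simp⟩
  refine ⟨c0 / 2, T, max T (exp M), by positivity, hT, le_max_left _ _, ?_⟩
  intro y hy x hx hlx
  have hTy : T ≤ y := (le_max_left _ _).trans hy
  have hy1 : 1 < y := by linarith
  have hML : M ≤ log y := by
    rw [← Real.log_exp M]; exact Real.log_le_log (exp_pos _) ((le_max_right _ _).trans hy)
  have hyx : y ≤ x := by nlinarith
  obtain ⟨hu1, hlu⟩ := log_u_le (hM1.trans hML) hy1 hyx hlx
  have hL : 0 < log y := by linarith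
  rw [div_le_iff₀ hδ] at hM2
  rw [div_le_iff₀ hη] at hM3
  have hru := hr1 _ hu1
  have hδM : M * δ ≤ log y * δ := by gcongr
  have hηM : M * η ≤ log y * η := by gcongr
  have hr3 : rr ρ (log x / log y) ≤ (1/2 - 2 * δ) * log y := by
    have : (1 + (1/2 - θ)) * log (log x / log y) ≤ (1 + (1/2-θ)) * (θ * log y) :=
      mul_le_mul_of_nonneg_left hlu (by linarith)
    have e : (1/2 - 2 * δ) - (1 + (1/2-θ)) * θ = δ + (1/2-θ)^2 := by rw [hδe]; ring
    have : 0 ≤ (1/2-θ)^2 * log y := by positivity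
    nlinarith
  have hr4 : rr ρ (log x / log y) / log y ≤ 1/2 - 2 * δ := by rwa [div_le_iff₀ hL]
  refine ⟨by nlinarith, ?_⟩
  have hT0 : 0 < T := by linarith
  have hx0 : 0 < x := by linarith
  have hcl : rr ρ (log x / log y) - rr ρ (log (x/T) / log y) ≤ η * log y := by
    have a1 : 1 ≤ log (x/T) / log y := by
      rw [one_le_div hL]; refine Real.log_le_log (by linarith) ?_
      rw [le_div_iff₀ hT0]; linarith
    have a2 : log x / log y - log (x/T) / log y ≤ 1 := by
      rw [← sub_div, Real.log_div hx0.ne' hT0.ne', div_le_one hL]; linarith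
    have a3 := hr2 _ hu1
    have a4 := h.log_le_rr a1
    have a5 : log (log x / log y) ≤ log 2 + log (log (x/T) / log y) := by
      rw [← Real.log_mul (by norm_num) (by linarith)]
      exact Real.log_le_log (by linarith) (by linarith)
    have a6 : η * log (log x / log y) ≤ η * (θ * log y) := mul_le_mul_of_nonneg_left hlu hη.le
    have a7 : log 2 ≤ 1 := by linarith [Real.log_two_lt_d9]
    have a8 : η * (θ * log y) ≤ η * (1/2 * log y) := by gcongr
    linarith
  have key := h.src hy1 (by linarith) hTy hyx hC (α := 1 - rr ρ (log x / log y) / log y) (by linarith) hδ (by linarith)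
    rfl hη.le hcl
  have hr0 : 0 ≤ rr ρ (log x / log y) / log y := div_nonneg (h.rr_nonneg _) hL.le
  have hp := hP (1 - rr ρ (log x / log y) / log y) (by linarith) (by linarith)
  refine le_trans ?_ key
  have hR := h.RR_pos hy1 (show 1 ≤ x by linarith)
  rw [mul_comm (c0/2), ← mul_add]
  refine mul_le_mul_of_nonneg_left ?_ hR.le
  linarith

end IsDick


lemma prime_cnt {y z : ℝ} (hy : 1 < y) (hz : y ≤ z) :
    (((Finset.Ioc ⌊y⌋₊ ⌊z⌋₊).filter Nat.Prime).card : ℝ) * log y ≤ Chebyshev.psi z - Chebyshev.psi y := by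
  have h1 : Chebyshev.psi z - Chebyshev.psi y = ∑ n ∈ Finset.Ioc ⌊y⌋₊ ⌊z⌋₊, ArithmeticFunction.vonMangoldt n := by
    rw [Chebyshev.psi, Chebyshev.psi, ← Finset.sum_Ioc_consecutive _ (Nat.zero_le _) (Nat.floor_mono hz)]; ring
  rw [h1]
  calc _ = ∑ n ∈ (Finset.Ioc ⌊y⌋₊ ⌊z⌋₊).filter Nat.Prime, log y := by
        rw [Finset.sum_const, nsmul_eq_mul]
    _ ≤ ∑ n ∈ (Finset.Ioc ⌊y⌋₊ ⌊z⌋₊).filter Nat.Prime, ArithmeticFunction.vonMangoldt n := by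
        refine Finset.sum_le_sum ?_
        intro p hp
        rw [Finset.mem_filter, Finset.mem_Ioc] at hp
        rw [ArithmeticFunction.vonMangoldt_apply_prime hp.2]
        exact Real.log_le_log (by linarith) ((Nat.lt_of_floor_lt hp.1.1).le)
    _ ≤ _ := Finset.sum_le_sum_of_subset_of_nonneg (Finset.filter_subset _ _)
        (fun _ _ _ => ArithmeticFunction.vonMangoldt_nonneg)

lemma base_cnt {x y : ℝ} (hy : 1 < y) (hx : y ≤ x) :
    (⌊x⌋₊ : ℝ) ≤ Psi x y + (∑ m ∈ Finset.Icc 1 ⌊x/y⌋₊, (Chebyshev.psi (x/m) - Chebyshev.psi y)) / log y := by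
  classical
  have hL := Real.log_pos hy
  have hy0 : 0 < y := by linarith
  have h1 : Finset.Icc 1 ⌊x⌋₊ ⊆ Sm x y ∪ (Finset.Icc 1 ⌊x/y⌋₊).biUnion
      (fun m => ((Finset.Ioc ⌊y⌋₊ ⌊x/m⌋₊).filter Nat.Prime).image (fun p => p * m)) := by
    intro n hn
    rw [Finset.mem_Icc] at hn
    have hnx : (n:ℝ) ≤ x := (Nat.le_floor_iff' (by omega)).1 hn.2
    rw [Finset.mem_union]
    by_cases hs : n ∈ Sm x y
    · exact Or.inl hs
    right
    rw [mem_Sm] at hs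
    push Not at hs
    obtain ⟨p, hp, ⟨m, rfl⟩, hpy⟩ := hs hn.1 hnx
    have hm : 1 ≤ m := by rcases Nat.eq_zero_or_pos m with h | h; · simp [h] at hn
                          · exact h
    have hm0 : (0:ℝ) < m := by exact_mod_cast hm
    push_cast at hnx
    rw [Finset.mem_biUnion]
    refine ⟨m, ?_, ?_⟩
    · rw [Finset.mem_Icc]
      refine ⟨hm, Nat.le_floor ?_⟩
      rw [le_div_iff₀ hy0]; nlinarith
    · rw [Finset.mem_image]
      refine ⟨p, ?_, rfl⟩
      rw [Finset.mem_filter, Finset.mem_Ioc]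
      refine ⟨⟨(Nat.floor_lt hy0.le).2 hpy, Nat.le_floor ?_⟩, hp⟩
      rw [le_div_iff₀ hm0]; exact hnx
  have h2 := (Finset.card_le_card h1).trans ((Finset.card_union_le _ _).trans
    (add_le_add le_rfl Finset.card_biUnion_le))
  rw [Nat.card_Icc, Nat.add_sub_cancel, ← Psi_eq] at h2
  have h3 : (⌊x⌋₊ : ℝ) ≤ Psi x y + ∑ m ∈ Finset.Icc 1 ⌊x/y⌋₊,
    (((((Finset.Ioc ⌊y⌋₊ ⌊x/m⌋₊).filter Nat.Prime).image (fun p => p * m)).card : ℕ) : ℝ) := by exact_mod_cast h2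
  refine h3.trans (add_le_add le_rfl ?_)
  rw [Finset.sum_div]
  refine Finset.sum_le_sum ?_
  intro m hm
  rw [Finset.mem_Icc] at hm
  have hm0 : (0:ℝ) < m := by exact_mod_cast hm.1
  have hmx : (m:ℝ) ≤ x / y := (Nat.le_floor_iff' (by omega)).1 hm.2
  rw [le_div_iff₀ hL]
  refine le_trans ?_ (prime_cnt hy (show y ≤ x / m by rw [le_div_iff₀ hm0]; rw [le_div_iff₀ hy0] at hmx; linarith))
  exact mul_le_mul_of_nonneg_right (Nat.cast_le.2 Finset.card_image_le) hL.le

noncomputable def HN (N : ℕ) : ℝ := ∑ m ∈ Finset.Icc 1 N, 1 / (m:ℝ)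

lemma HN_succ (N : ℕ) : HN (N+1) = HN N + 1 / ((N:ℝ)+1) := by
  rw [HN, HN, Finset.sum_Icc_succ_top (by omega)]; push_cast; rfl

lemma HN_step {N : ℕ} (hN : 1 ≤ N) : log N - HN N ≤ log (N+1 : ℕ) - HN (N+1) := by
  rw [HN_succ]
  have h0 : (0:ℝ) < N := by exact_mod_cast hN
  have h1 : 1 - (((N:ℝ)+1)/N)⁻¹ ≤ log (((N:ℝ)+1)/N) := Real.one_sub_inv_le_log_of_pos (by positivity)
  rw [Real.log_div (by positivity) h0.ne', inv_div] at h1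
  have e : 1 - (N:ℝ)/(N+1) = 1 / (N+1) := by field_simp; ring
  push_cast; linarith

lemma HN_le {N : ℕ} (hN : 1 ≤ N) : 0 ≤ 1 + log N - HN N ∧ (2 ≤ N → log 2 - 1/2 ≤ 1 + log N - HN N) := by
  induction N, hN using Nat.le_induction with
  | base => simp [HN]
  | succ n hn ih =>
    have := HN_step hn
    refine ⟨by linarith [ih.1], fun _ => ?_⟩
    rcases Nat.lt_or_ge n 2 with h | h
    · have : n = 1 := by omega
      subst this
      rw [HN_succ]; simp [HN]; norm_num
    · linarith [ih.2 h]

noncomputable def Ph (X : ℝ) : ℝ := X * log X - X * HN ⌊X⌋₊ + ⌊X⌋₊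

lemma Ph_ge {X : ℝ} (hX : 1 ≤ X) : 0 ≤ Ph X ∧ (2 ≤ X → 2 * (log 2 - 1/2) ≤ Ph X) := by
  have hN : 1 ≤ ⌊X⌋₊ := (Nat.one_le_floor_iff X).2 hX
  have hN0 : (0:ℝ) < ⌊X⌋₊ := by exact_mod_cast hN
  have hX0 : 0 < X := by linarith
  have h1 : 1 - (X/⌊X⌋₊)⁻¹ ≤ log (X/⌊X⌋₊) := Real.one_sub_inv_le_log_of_pos (by positivity)
  rw [Real.log_div hX0.ne' hN0.ne', inv_div] at h1
  have h2 : X * (1 + log ⌊X⌋₊ - HN ⌊X⌋₊) ≤ Ph X := by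
    have h3 := mul_le_mul_of_nonneg_left h1 hX0.le
    rw [mul_sub, mul_div_cancel₀ _ hX0.ne'] at h3
    rw [Ph]; linarith
  have h3 := HN_le hN
  refine ⟨le_trans (mul_nonneg hX0.le h3.1) h2, fun h4 => le_trans ?_ h2⟩
  have h5 := h3.2 (Nat.le_floor (by exact_mod_cast h4))
  have : 0 < log 2 - 1/2 := by linarith [Real.log_two_gt_d9]
  nlinarith

lemma Ph_pos {ε : ℝ} (hε : 0 < ε) (hε1 : ε ≤ 1) : ∃ c > 0, ∀ X ≥ 1 + ε, c ≤ Ph X := by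
  refine ⟨min (2 * (log 2 - 1/2)) (ε^2/3), ?_, ?_⟩
  · have := Real.log_two_gt_d9
    exact lt_min (by linarith) (by positivity)
  intro X hX
  rcases le_or_gt 2 X with h | h
  · exact (min_le_left _ _).trans ((Ph_ge (by linarith)).2 h)
  · refine (min_le_right _ _).trans ?_
    have hf : ⌊X⌋₊ = 1 := by rw [Nat.floor_eq_iff (by linarith)]; constructor <;> norm_num <;> linarith
    have h1 := Real.le_log_one_add_of_nonneg (show 0 ≤ X - 1 by linarith)
    rw [show 1 + (X - 1) = X by ring, div_le_iff₀ (by linarith)] at h1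
    rw [Ph, hf]
    have : HN 1 = 1 := by simp [HN]
    rw [this]; push_cast
    nlinarith

namespace IsDick
variable {ρ : ℝ → ℝ}

lemma rho_12 (h : IsDick ρ) {w : ℝ} (hw : 0 ≤ w) (hw1 : w ≤ 1) : ρ (1 + w) ≤ 1 - w + w^2/2 := by
  have e : ρ (1 + w) = 1 - log (1 + w) := by
    rw [h.eq _ (by linarith)]
    congr 1
    have : ∫ v in (1:ℝ)..(1+w), ρ (v - 1) / v = ∫ v in (1:ℝ)..(1+w), 1 / v := by
      refine intervalIntegral.integral_congr ?_
      intro v hv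
      rw [Set.uIcc_of_le (by linarith)] at hv
      simp only
      rw [h.one _ ⟨by linarith [hv.1], by linarith [hv.2]⟩]
    rw [this, integral_one_div_of_pos one_pos (by linarith), div_one]
  have h1 := Real.le_log_one_add_of_nonneg hw
  rw [div_le_iff₀ (by linarith)] at h1
  rw [e]
  nlinarith [pow_nonneg hw 3]

lemma base (h : IsDick ρ) (hRH : RiemannHypothesis) {K η : ℝ} (hK : 1 ≤ K) (hη : 0 < η) :
    ∃ y0 : ℝ, 2 ≤ y0 ∧ ∀ y ≥ y0, ∀ x, y ≤ x → x ≤ K * y →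
      RR ρ y x + y / log y * (Ph (x/y) - η) ≤ Psi x y := by
  obtain ⟨C, hC0, hC⟩ := psi_RH hRH (show (0:ℝ) < 1/4 by norm_num)
  have t1 : ∀ᶠ y : ℝ in atTop, log y ≤ η/3 * y := by
    have := Real.isLittleO_log_id_atTop.bound (show 0 < η/3 by positivity)
    filter_upwards [this, eventually_gt_atTop 1] with y hy hy1
    rw [Real.norm_eq_abs, id, Real.norm_eq_abs, abs_of_pos (show (0:ℝ) < y by linarith)] at hy
    exact (le_abs_self _).trans hy
  have t2 : ∀ᶠ y : ℝ in atTop, K * (log K)^2 / (2 * (η/3)) ≤ log y := Real.tendsto_log_atTop.eventually_ge_atTop _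
  have t2' : ∀ᶠ y : ℝ in atTop, log K ≤ log y := Real.tendsto_log_atTop.eventually_ge_atTop _
  have t3 : ∀ᶠ y : ℝ in atTop, 2 * K * (C * K) / (η/3) ≤ y ^ (1/4:ℝ) :=
    (tendsto_rpow_atTop (by norm_num)).eventually_ge_atTop _
  obtain ⟨y0, hy0⟩ := eventually_atTop.1 (t1.and (t2.and (t2'.and t3)))
  refine ⟨max 2 y0, le_max_left _ _, ?_⟩
  intro y hy x hyx hxK
  obtain ⟨a1, a2, a3, a4⟩ := hy0 y ((le_max_right _ _).trans hy)
  have hy2 : 2 ≤ y := (le_max_left _ _).trans hy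
  have hL : 0 < log y := Real.log_pos (by linarith)
  have hyp : 0 < y := by linarith
  have hxp : 0 < x := by linarith
  obtain ⟨X, hX⟩ : ∃ X, X = x / y := ⟨_, rfl⟩
  have hxX : x = X * y := by rw [hX]; field_simp
  have hX1 : 1 ≤ X := by rw [hX, one_le_div hyp]; exact hyx
  have hXK : X ≤ K := by rw [hX, div_le_iff₀ hyp]; exact hxK
  have hlX := Real.log_nonneg hX1
  have hlXK : log X ≤ log K := Real.log_le_log (by linarith) hXK
  have hR : RR ρ y x ≤ x * (1 - log X / log y + (log X / log y)^2/2) := by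
    rw [RR, show log x / log y = 1 + log X / log y by
      rw [hxX, Real.log_mul (by linarith) (by linarith)]; field_simp; ring]
    refine mul_le_mul_of_nonneg_left (h.rho_12 (by positivity) ?_) hxp.le
    rw [div_le_one hL]; linarith
  have hb := base_cnt (show 1 < y by linarith) hyx
  rw [← hX] at hb ⊢
  have hN : (⌊X⌋₊ : ℝ) ≤ X := Nat.floor_le (by linarith)
  have hE : ∀ z, 1 ≤ z → z ≤ K * y → |Dl z| ≤ C * K * y ^ (3/4:ℝ) := by
    intro z hz hz2
    refine (hC z hz).trans ?_
    rw [show (1/2 + 1/4 : ℝ) = 3/4 by norm_num, mul_assoc]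
    refine mul_le_mul_of_nonneg_left ?_ hC0.le
    calc z ^ (3/4:ℝ) ≤ (K * y) ^ (3/4:ℝ) := by gcongr
      _ = K ^ (3/4:ℝ) * y ^ (3/4:ℝ) := Real.mul_rpow (by linarith) hyp.le
      _ ≤ K ^ (1:ℝ) * y ^ (3/4:ℝ) := by
          gcongr
          · norm_num
      _ = _ := by rw [Real.rpow_one]
  set E := C * K * y ^ (3/4:ℝ) with hEd
  have hE0 : 0 ≤ E := by positivity
  have hS : ∑ m ∈ Finset.Icc 1 ⌊X⌋₊, (Chebyshev.psi (x/m) - Chebyshev.psi y) ≤ x * HN ⌊X⌋₊ - ⌊X⌋₊ * y + ⌊X⌋₊ * (2 * E) := by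
    calc _ ≤ ∑ m ∈ Finset.Icc 1 ⌊X⌋₊, (x * (1 / (m:ℝ)) - y + 2 * E) := by
          refine Finset.sum_le_sum ?_
          intro m hm
          rw [Finset.mem_Icc] at hm
          have hm1 : (1:ℝ) ≤ m := by exact_mod_cast hm.1
          have hmX : (m:ℝ) ≤ X := (Nat.le_floor_iff' (by omega)).1 hm.2
          have hym : y ≤ x / m := by rw [le_div_iff₀ (by linarith), hxX]; nlinarith
          have b1 := (abs_le.1 (hE (x/m) (by linarith) ((div_le_self hxp.le hm1).trans hxK))).2
          have b2 := (abs_le.1 (hE y (by linarith) (by nlinarith))).1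
          rw [Dl] at b1 b2
          rw [mul_one_div]; linarith
      _ = _ := by
          rw [Finset.sum_add_distrib, Finset.sum_sub_distrib, ← Finset.mul_sum, Finset.sum_const, Finset.sum_const,
            Nat.card_Icc, Nat.add_sub_cancel, nsmul_eq_mul, nsmul_eq_mul, HN]
  have hEy : X * (2 * E) ≤ η / 3 * y := by
    rw [div_le_iff₀ (by positivity)] at a4
    have e : y = y ^ (3/4:ℝ) * y ^ (1/4:ℝ) := by
      rw [← Real.rpow_add hyp]; norm_num
    calc X * (2 * E) ≤ K * (2 * E) := by gcongr
      _ = (2 * K * (C * K)) * y ^ (3/4:ℝ) := by rw [hEd]; ring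
      _ ≤ (y ^ (1/4:ℝ) * (η/3)) * y ^ (3/4:ℝ) := by gcongr
      _ = η/3 * (y ^ (3/4:ℝ) * y ^ (1/4:ℝ)) := by ring
      _ = _ := by rw [← e]
  have hq : x * (log X)^2 / (2 * log y) ≤ η/3 * y := by
    rw [div_le_iff₀ (by positivity)] at a2 ⊢
    have : X * (log X)^2 ≤ K * (log K)^2 := by gcongr
    rw [hxX]
    nlinarith
  have hfl : x - 1 ≤ ⌊x⌋₊ := by linarith [Nat.lt_floor_add_one x]
  have hS2 := div_le_div_of_nonneg_right hS hL.le
  have hne : ⌊X⌋₊ * (2 * E) ≤ X * (2 * E) := by gcongr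
  -- multiply by log y
  have k1 : (x - 1) * log y ≤ Psi x y * log y + (x * HN ⌊X⌋₊ - ⌊X⌋₊ * y + ⌊X⌋₊ * (2 * E)) := by
    have : x - 1 ≤ Psi x y + (x * HN ⌊X⌋₊ - ⌊X⌋₊ * y + ⌊X⌋₊ * (2 * E)) / log y := by linarith
    have := mul_le_mul_of_nonneg_right this hL.le
    rwa [add_mul, div_mul_cancel₀ _ hL.ne'] at this
  have k2 : RR ρ y x * log y ≤ x * log y - x * log X + x * (log X)^2 / (2 * log y) := by
    refine (mul_le_mul_of_nonneg_right hR hL.le).trans (le_of_eq ?_)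
    field_simp
  have k3 : y * Ph X = x * log X - x * HN ⌊X⌋₊ + ⌊X⌋₊ * y := by rw [Ph, hxX]; ring
  refine le_of_mul_le_mul_right ?_ hL
  rw [add_mul, show y / log y * (Ph X - η) * log y = y * Ph X - y * η by field_simp]
  linarith

/-- small arguments -/
lemma small {z y : ℝ} (hz : z ≤ y) : z - 1 ≤ (Psi z y : ℝ) := by
  rcases le_or_gt z 0 with h0 | h0
  · have : (0:ℝ) ≤ Psi z y := by positivity
    linarith
  have h1 : Finset.Icc 1 ⌊z⌋₊ ⊆ Sm z y := by
    intro n hn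
    rw [Finset.mem_Icc] at hn
    have hnz := (Nat.le_floor_iff' (by omega)).1 hn.2
    refine mem_Sm.2 ⟨hn.1, hnz, fun p _ hd => ?_⟩
    have : (p:ℝ) ≤ n := by exact_mod_cast Nat.le_of_dvd (by omega) hd
    linarith
  have h2 := Finset.card_le_card h1
  rw [Nat.card_Icc, Nat.add_sub_cancel, ← Psi_eq] at h2
  have : (⌊z⌋₊ : ℝ) ≤ Psi z y := by exact_mod_cast h2
  linarith [Nat.lt_floor_add_one z]

lemma RR_small (h : IsDick ρ) {z y : ℝ} (hy : 1 < y) (hz1 : 1 ≤ z) (hz : z ≤ y) : RR ρ y z = z := by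
  rw [RR, h.one _ ⟨div_nonneg (Real.log_nonneg hz1) (Real.log_pos hy).le, ?_⟩, mul_one]
  rw [div_le_one (Real.log_pos hy)]
  exact Real.log_le_log (by linarith) hz

end IsDick


lemma psi_le7 {t : ℝ} (ht : 0 ≤ t) : Chebyshev.psi t ≤ 7 * t := by
  have := Chebyshev.psi_le_const_mul_self ht
  have h4 : Real.log 4 ≤ 3 := by
    rw [show (4:ℝ) = 2 * 2 by norm_num, Real.log_mul (by norm_num) (by norm_num)]
    linarith [Real.log_two_lt_d9]
  nlinarith

lemma Ioc_smooth {y : ℝ} (hy : 0 ≤ y) : ∀ d ∈ Finset.Ioc 0 ⌊y⌋₊, 1 ≤ d ∧ ∀ p : ℕ, p.Prime → p ∣ d → (p:ℝ) ≤ y := by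
  intro d hd
  rw [Finset.mem_Ioc] at hd
  refine ⟨hd.1, fun p _ hpd => ?_⟩
  exact (Nat.le_floor_iff hy).1 ((Nat.le_of_dvd hd.1 hpd).trans hd.2)

lemma ge_two_of_vM {n : ℕ} (h : ArithmeticFunction.vonMangoldt n ≠ 0) : 2 ≤ n := by
  by_contra hc
  interval_cases n <;> simp at h

namespace IsDick
variable {ρ : ℝ → ℝ}

lemma RRdiv_ii (h : IsDick ρ) {y a b : ℝ} (hy : 1 < y) (ha : 1 ≤ a) (hab : a ≤ b) :
    IntervalIntegrable (fun s => RR ρ y s / s) MeasureTheory.volume a b := by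
  refine ContinuousOn.intervalIntegrable ?_
  rw [Set.uIcc_of_le hab]
  intro s hs
  have hs1 : 1 ≤ s := ha.trans hs.1
  have hs0 : 0 < s := by linarith
  refine ContinuousWithinAt.div ?_ continuousWithinAt_id hs0.ne'
  unfold RR
  refine continuousWithinAt_id.mul ?_
  refine ContinuousWithinAt.comp (t := Set.Ici 0) (h.cont _ (div_nonneg (Real.log_nonneg hs1) (Real.log_pos hy).le)) ?_ ?_
  · exact ((Real.continuousAt_log hs0.ne').div_const _).continuousWithinAt
  · intro w hw
    exact div_nonneg (Real.log_nonneg (ha.trans hw.1)) (Real.log_pos hy).le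

/-- lower bound for the integral part -/
lemma int_part (h : IsDick ρ) {x y T η : ℝ} (hy : 1 < y) (hT : 2 ≤ T) (hTx : T ≤ x) (hη : 0 < η) (hη1 : η ≤ 1)
    (hr : rr ρ (log x / log y) ≤ log y)
    (hf : ∀ z, x / T ≤ z → z ≤ x / (1 + η) → RR ρ y z ≤ Psi z y) :
    (∫ s in (x/T)..x, RR ρ y s / s) - η * RR ρ y x ≤ ∫ t in (1:ℝ)..x, (Psi t y : ℝ) / t := by
  have hL := Real.log_pos hy
  have hx0 : 0 < x := by linarith
  have hR := h.RR_pos hy (show 1 ≤ x by linarith)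
  have hT0 : 0 < T := by linarith
  have a1 : 1 ≤ x / T := (one_le_div hT0).2 hTx
  have a2 : x / T ≤ x / (1 + η) := by gcongr; linarith
  have a3 : x / (1 + η) ≤ x := div_le_self hx0.le (by linarith)
  have a0 : 0 < x / (1+η) := by positivity
  have p : ∀ a b : ℝ, 1 ≤ a → a ≤ b → 0 ≤ ∫ t in a..b, (Psi t y : ℝ) / t := by
    intro a b ha hab
    refine intervalIntegral.integral_nonneg hab ?_
    intro t ht
    have : 0 ≤ t := by linarith [ht.1]
    positivity
  rw [← intervalIntegral.integral_add_adjacent_intervals (Psi_ii y 1 (x/T) one_pos (by linarith))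
    (Psi_ii y (x/T) x (by linarith) hx0),
    ← intervalIntegral.integral_add_adjacent_intervals (Psi_ii y (x/T) (x/(1+η)) (by linarith) a0)
    (Psi_ii y (x/(1+η)) x a0 hx0),
    ← intervalIntegral.integral_add_adjacent_intervals (h.RRdiv_ii hy a1 a2) (h.RRdiv_ii hy (a1.trans a2) a3)]
  have b1 := p 1 (x/T) le_rfl a1
  have b2 := p (x/(1+η)) x (a1.trans a2) a3
  have b3 : (∫ s in (x/T)..(x/(1+η)), RR ρ y s / s) ≤ ∫ t in (x/T)..(x/(1+η)), (Psi t y : ℝ) / t := by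
    refine intervalIntegral.integral_mono_on a2 (h.RRdiv_ii hy a1 a2) (Psi_ii y _ _ (by linarith) a0) ?_
    intro s hs
    exact div_le_div_of_nonneg_right (hf s hs.1 hs.2) (by linarith [hs.1])
  have b4 : (∫ s in (x/(1+η))..x, RR ρ y s / s) ≤ η * RR ρ y x := by
    have : (∫ s in (x/(1+η))..x, RR ρ y s / s) ≤ ∫ s in (x/(1+η))..x, RR ρ y x / (x / (1+η)) := by
      refine intervalIntegral.integral_mono_on a3 (h.RRdiv_ii hy (a1.trans a2) a3) intervalIntegrable_const ?_
      intro s hs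
      have hs0 : 0 < s := by linarith [hs.1]
      refine div_le_div₀ hR.le ?_ a0 hs.1
      have c1 := h.h_le (t := x/s) hy ((one_le_div hs0).2 hs.2) (div_le_self hx0.le (by linarith [hs.1]))
      rw [show x / (x / s) = s by field_simp] at c1
      refine c1.trans (mul_le_of_le_one_right hR.le ?_)
      refine Real.rpow_le_one_of_one_le_of_nonpos ((one_le_div hs0).2 hs.2) ?_
      have : rr ρ (log x / log y) / log y ≤ 1 := by rwa [div_le_one hL]
      linarith
    refine this.trans (le_of_eq ?_)
    rw [intervalIntegral.integral_const, smul_eq_mul]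
    field_simp; ring
  linarith

lemma stepD (h : IsDick ρ) {x y T η c K η2 ε : ℝ} (hy : 3 ≤ y) (hT : 2 ≤ T) (hK : 2 * T ≤ K) (hKx : K * y ≤ x)
    (hη : 0 < η) (hη1 : η ≤ 1) (hηc : η ≤ c / 2) (hη2 : 0 < η2) (hc : 0 < c) (hε : ε ≤ 1)
    (hl : 7 / K + 7 * η2 ≤ c / 2 * ρ 3)
    (hr : rr ρ (log x / log y) ≤ log y)
    (hs : RR ρ y x * log x + c * RR ρ y x ≤ (∫ s in (x/T)..x, RR ρ y s / s) +
       ∑ n ∈ Finset.Ioc 0 ⌊y⌋₊, ArithmeticFunction.vonMangoldt n * RR ρ y (x / n))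
    (hb : ∀ z, y ≤ z → z ≤ 2 * y → RR ρ y z - η2 * y ≤ Psi z y)
    (hf : ∀ z, (1 + ε) * y ≤ z → z ≤ x / (1 + η) → RR ρ y z ≤ Psi z y) :
    RR ρ y x ≤ Psi x y := by
  have hy1 : 1 < y := by linarith
  have hy0 : 0 < y := by linarith
  have hL := Real.log_pos hy1
  have hT0 : 0 < T := by linarith
  have h2T : 2 * T * y ≤ x := le_trans (by gcongr) hKx
  have hx3 : 3 ≤ x := by nlinarith
  have hx0 : 0 < x := by linarith
  have hyx : y ≤ x := by nlinarith
  have hR := h.RR_pos hy1 (show 1 ≤ x by linarith)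
  have hK0 : 0 < K := by linarith
  have hlx : 0 < log x := Real.log_pos (by linarith)
  have i1 := h.int_part hy1 hT (by nlinarith) hη hη1 hr (fun z hz hz2 => hf z (by
    refine le_trans ?_ hz
    rw [le_div_iff₀ hT0]; nlinarith [mul_nonneg (sub_nonneg.2 hε) (mul_pos hy0 hT0).le]) hz2)
  have i2 := Psi_ineq (show 1 ≤ x by linarith) _ (Ioc_smooth hy0.le)
  have i3 : (∑ n ∈ Finset.Ioc 0 ⌊y⌋₊, ArithmeticFunction.vonMangoldt n * RR ρ y (x / n)) - c / 2 * RR ρ y x ≤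
      ∑ n ∈ Finset.Ioc 0 ⌊y⌋₊, ArithmeticFunction.vonMangoldt n * (Psi (x / n) y : ℝ) := by
    have hz : ∀ n ∈ Finset.Ioc 0 ⌊y⌋₊, (0:ℝ) < n ∧ x / y ≤ x / n := by
      intro n hn
      rw [Finset.mem_Ioc] at hn
      have : (0:ℝ) < n := by exact_mod_cast hn.1
      refine ⟨this, ?_⟩
      have : (n:ℝ) ≤ y := (Nat.le_floor_iff hy0.le).1 hn.2
      gcongr
    have hhalf : ∀ n : ℕ, 2 ≤ n → x / n ≤ x / (1+η) := by
      intro n hn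
      have : (2:ℝ) ≤ n := by exact_mod_cast hn
      gcongr; linarith
    rcases le_or_gt x (y^3) with hx3 | hx3
    · -- with loss
      have hu3 : ρ 3 ≤ ρ (log x / log y) := by
        refine h.anti (div_nonneg hlx.le hL.le) ?_
        rw [div_le_iff₀ hL]
        have := Real.log_le_log hx0 hx3
        rwa [Real.log_pow] at this
      have key : ∀ n ∈ Finset.Ioc 0 ⌊y⌋₊, ArithmeticFunction.vonMangoldt n * RR ρ y (x / n) ≤
          ArithmeticFunction.vonMangoldt n * (Psi (x / n) y : ℝ) + (ArithmeticFunction.vonMangoldt n +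
            η2 * y * (if (n:ℝ) ≤ x / y then ArithmeticFunction.vonMangoldt n else 0)) := by
        intro n hn
        obtain ⟨hn0, hzn⟩ := hz n hn
        have hv : 0 ≤ ArithmeticFunction.vonMangoldt n := ArithmeticFunction.vonMangoldt_nonneg
        have hif : 0 ≤ η2 * y * (if (n:ℝ) ≤ x / y then ArithmeticFunction.vonMangoldt n else 0) := by
          have : (0:ℝ) ≤ (if (n:ℝ) ≤ x / y then ArithmeticFunction.vonMangoldt n else 0) := by split_ifs <;> simp
          positivity
        rcases eq_or_ne (ArithmeticFunction.vonMangoldt n) 0 with h0 | h0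
        · simp [h0]
        have hn2 := hhalf n (ge_two_of_vM h0)
        rcases le_or_gt ((1+ε) * y) (x/n) with hc1 | hc1
        · have := mul_le_mul_of_nonneg_left (hf _ hc1 hn2) hv
          linarith
        rcases le_or_gt y (x/n) with hc2 | hc2
        · have hny : (n:ℝ) ≤ x / y := by
            rw [le_div_iff₀ hy0]; rw [le_div_iff₀ hn0] at hc2; linarith
          rw [if_pos hny]
          have := mul_le_mul_of_nonneg_left (hb _ hc2 (by nlinarith)) hv
          nlinarith
        · have hx1 : 1 ≤ x / n := le_trans ((one_le_div hy0).2 hyx) hzn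
          rw [h.RR_small hy1 hx1 hc2.le]
          have := mul_le_mul_of_nonneg_left (small hc2.le) hv
          linarith
      have key2 := Finset.sum_le_sum key
      rw [Finset.sum_add_distrib, Finset.sum_add_distrib, ← Finset.mul_sum, ← Finset.sum_filter] at key2
      have s1 : ∑ n ∈ Finset.Ioc 0 ⌊y⌋₊, ArithmeticFunction.vonMangoldt n ≤ 7 * y := psi_le7 hy0.le
      have s2 : ∑ n ∈ (Finset.Ioc 0 ⌊y⌋₊).filter (fun n : ℕ => (n:ℝ) ≤ x / y), ArithmeticFunction.vonMangoldt n ≤ 7 * (x / y) := by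
        refine le_trans ?_ (psi_le7 (show 0 ≤ x / y by positivity))
        rw [Chebyshev.psi]
        refine Finset.sum_le_sum_of_subset_of_nonneg ?_ (fun _ _ _ => ArithmeticFunction.vonMangoldt_nonneg)
        intro n hn
        rw [Finset.mem_filter, Finset.mem_Ioc] at hn
        rw [Finset.mem_Ioc]
        exact ⟨hn.1.1, Nat.le_floor hn.2⟩
      have s3 : η2 * y * (7 * (x / y)) = 7 * η2 * x := by field_simp
      have s4 := mul_le_mul_of_nonneg_left s2 (show 0 ≤ η2 * y by positivity)
      have s5 : 7 * y ≤ 7 / K * x := by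
        rw [div_mul_eq_mul_div, le_div_iff₀ hK0]; linarith
      have s6 : (7 / K + 7 * η2) * x ≤ c / 2 * RR ρ y x := by
        calc _ ≤ (c / 2 * ρ 3) * x := by gcongr
          _ ≤ (c / 2 * ρ (log x / log y)) * x := by gcongr
          _ = _ := by rw [RR]; ring
      linarith
    · have : ∑ n ∈ Finset.Ioc 0 ⌊y⌋₊, ArithmeticFunction.vonMangoldt n * RR ρ y (x / n) ≤
          ∑ n ∈ Finset.Ioc 0 ⌊y⌋₊, ArithmeticFunction.vonMangoldt n * (Psi (x / n) y : ℝ) := by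
        refine Finset.sum_le_sum ?_
        intro n hn
        obtain ⟨hn0, hzn⟩ := hz n hn
        rcases eq_or_ne (ArithmeticFunction.vonMangoldt n) 0 with h0 | h0
        · simp [h0]
        refine mul_le_mul_of_nonneg_left (hf _ (le_trans ?_ hzn) (hhalf n (ge_two_of_vM h0))) ArithmeticFunction.vonMangoldt_nonneg
        rw [le_div_iff₀ hy0]; nlinarith [mul_pos hy0 hy0]
      have : 0 < c / 2 * RR ρ y x := by positivity
      linarith
  have i4 : η * RR ρ y x ≤ c / 2 * RR ρ y x := by gcongr
  refine le_of_mul_le_mul_right ?_ hlx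
  linarith

theorem thmD (h : IsDick ρ) (hRH : RiemannHypothesis) {θ ε : ℝ} (hθ : 0 < θ) (hθ2 : θ < 1/2) (hε : 0 < ε) (hε1 : ε ≤ 1) :
    ∃ y0 : ℝ, 3 ≤ y0 ∧ ∀ y ≥ y0, ∀ x, (1 + ε) * y ≤ x → log x ≤ y ^ θ → RR ρ y x ≤ Psi x y := by
  obtain ⟨c, T, y1, hc, hT, hTy1, hsrc⟩ := h.src_final hRH hθ hθ2
  have hρ3 := h.pos (show (0:ℝ) ≤ 3 by norm_num)
  obtain ⟨η2, hη2e⟩ : ∃ η2, η2 = c / 4 * ρ 3 / 7 := ⟨_, rfl⟩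
  obtain ⟨K, hKT, hK7⟩ : ∃ K, 2 * T ≤ K ∧ 7 / (c/4 * ρ 3) ≤ K := ⟨max (2*T) (7 / (c/4 * ρ 3)), le_max_left _ _, le_max_right _ _⟩
  have hη2 : 0 < η2 := by rw [hη2e]; positivity
  obtain ⟨η, hη, hη1, hηc⟩ : ∃ η, 0 < η ∧ η ≤ 1 ∧ η ≤ c/2 := ⟨min 1 (c/2), by positivity, min_le_left _ _, min_le_right _ _⟩
  have hK0 : 0 < K := by linarith
  have hl : 7 / K + 7 * η2 ≤ c / 2 * ρ 3 := by
    have : 7 / K ≤ c/4 * ρ 3 := by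
      rw [div_le_iff₀ hK0]; rw [div_le_iff₀ (by positivity)] at hK7; linarith
    rw [hη2e]; linarith
  obtain ⟨φ, hφ, hPh⟩ := Ph_pos hε hε1
  obtain ⟨ya, _, hba⟩ := h.base hRH (show 1 ≤ K by linarith) hφ
  obtain ⟨yb, _, hbb⟩ := h.base hRH (show (1:ℝ) ≤ 2 by norm_num) hη2
  refine ⟨max (max 3 y1) (max ya yb), (le_max_left _ _).trans (le_max_left _ _), ?_⟩
  intro y hy
  have hy3 : 3 ≤ y := ((le_max_left _ _).trans (le_max_left _ _)).trans hy
  have hyy1 : y1 ≤ y := ((le_max_right _ _).trans (le_max_left _ _)).trans hy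
  have hya : ya ≤ y := ((le_max_left _ _).trans (le_max_right _ _)).trans hy
  have hyb : yb ≤ y := ((le_max_right _ _).trans (le_max_right _ _)).trans hy
  have hy0 : 0 < y := by linarith
  have hL1 : 1 ≤ log y := by
    rw [Real.le_log_iff_exp_le hy0]; linarith [Real.exp_one_lt_d9]
  have hb : ∀ z, y ≤ z → z ≤ 2 * y → RR ρ y z - η2 * y ≤ Psi z y := by
    intro z hz hz2
    have h1 := hbb y hyb z hz hz2
    have h2 := (Ph_ge ((one_le_div hy0).2 hz)).1
    have h3 : y / log y * (-η2) ≤ y / log y * (Ph (z/y) - η2) := by gcongr; linarith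
    have h4 : y / log y * η2 ≤ y * η2 := by gcongr; exact div_le_self hy0.le hL1
    linarith
  have main : ∀ k : ℕ, ∀ x, (1 + ε) * y ≤ x → x ≤ K * y * (1 + η) ^ k → log x ≤ y ^ θ → RR ρ y x ≤ Psi x y := by
    intro k
    induction k with
    | zero =>
      intro x hx1 hx2 _
      rw [pow_zero, mul_one] at hx2
      have hyx : y ≤ x := by nlinarith
      have h1 := hba y hya x hyx hx2
      have h2 := hPh (x/y) (by rw [ge_iff_le, le_div_iff₀ hy0]; exact hx1)
      have : 0 ≤ y / log y * (Ph (x/y) - φ) := mul_nonneg (by positivity) (by linarith)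
      linarith
    | succ k ih =>
      intro x hx1 hx2 hx3
      rcases le_or_gt x (K * y * (1 + η) ^ k) with hxk | hxk
      · exact ih x hx1 hxk hx3
      have hKx : K * y ≤ x := by
        have : 1 ≤ (1 + η) ^ k := one_le_pow₀ (by linarith)
        have : K * y ≤ K * y * (1 + η)^k := le_mul_of_one_le_right (by positivity) this
        linarith
      have hTx : T * y ≤ x := le_trans (by nlinarith) hKx
      obtain ⟨s1, s2⟩ := hsrc y hyy1 x hTx hx3
      have hx0 : 0 < x := by nlinarith
      refine h.stepD hy3 hT hKT hKx hη hη1 hηc hη2 hc hε1 hl s1 s2 hb ?_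
      intro z hz1 hz2
      have hz0 : 0 < z := by nlinarith
      refine ih z hz1 (hz2.trans ?_) (le_trans (Real.log_le_log hz0 (hz2.trans (div_le_self hx0.le (by linarith)))) hx3)
      rw [div_le_iff₀ (by linarith)]
      rw [pow_succ] at hx2; linarith
  intro x hx1 hx2
  obtain ⟨k, hk⟩ := pow_unbounded_of_one_lt (x / (K * y)) (show 1 < 1 + η by linarith)
  refine main k x hx1 ?_ hx2
  rw [div_lt_iff₀ (by positivity)] at hk; linarith

end IsDick


namespace IsDick
variable {ρ : ℝ → ℝ}

lemma log_div_y {x y : ℝ} (hy : 1 < y) (hx : 0 < x) : log (x/y) / log y = log x / log y - 1 := by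
  have hL := (Real.log_pos hy).ne'
  rw [Real.log_div hx.ne' (by linarith)]; field_simp

lemma rat1 (h : IsDick ρ) {x y : ℝ} (hy : 1 < y) (hyx : y ≤ x) :
    RR ρ y (x/y) * y = RR ρ y x * (log x / log y) * rr ρ (log x / log y) := by
  have hx0 : 0 < x := by linarith
  have h1 : 1 ≤ log x / log y := (one_le_div (Real.log_pos hy)).2 (Real.log_le_log (by linarith) hyx)
  rw [RR, RR, log_div_y hy hx0, h.rr_mul h1]
  have : y ≠ 0 := by linarith
  field_simp

lemma errE (h : IsDick ρ) {x y C δ : ℝ} (hy : 1 < y) (hyx : y ≤ x) (hδ : 0 < δ) (hδ2 : δ ≤ 1/4)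
    (hC : ∀ t ≥ (1:ℝ), |Dl t| ≤ C * t ^ (1/2 + δ))
    (h3 : rr ρ (log x / log y) ≤ 3 * log y)
    (hβ : (1/2 - 2 * δ) * log y ≤ rr ρ (log (x/y) / log y)) :
    (1 - 3 * (1 + C + 4 * C / δ) * y ^ (-(1/2) + 2 * δ)) * (RR ρ y x * log x) ≤
      ∑ n ∈ Finset.Ioc 0 ⌊y⌋₊, ArithmeticFunction.vonMangoldt n * RR ρ y (x / n) := by
  have hL := Real.log_pos hy
  have hy0 : 0 < y := by linarith
  have hx0 : 0 < x := by linarith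
  have hR := h.RR_pos hy (show 1 ≤ x by linarith)
  have hRy := h.RR_pos hy ((one_le_div hy0).2 hyx)
  have hC0 : 0 ≤ C := by
    have := (abs_nonneg _).trans (hC 1 le_rfl)
    simpa using this
  rw [h.common hy hyx]
  obtain ⟨R1, hR1⟩ : ∃ R1, R1 = RR ρ y (x/y) := ⟨_, rfl⟩
  obtain ⟨Y, hY⟩ : ∃ Y, Y = y ^ (1/2 + 2 * δ) := ⟨_, rfl⟩
  have hY0 : 0 < Y := by rw [hY]; positivity
  rw [← hR1] at hRy ⊢
  -- comparison
  have cmp : ∀ t, 1 ≤ t → t ≤ y → RR ρ y (x/t) ≤ R1 * (Y * t ^ (-(1/2) - 2 * δ)) := by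
    intro t ht hty
    have ht0 : 0 < t := by linarith
    have c1 := h.h_ge (x := x/t) (t := y/t) hy ((one_le_div ht0).2 hty) (by gcongr)
    rw [show x / t / (y / t) = x / y by field_simp, ← hR1] at c1
    have hyt : 1 ≤ y / t := (one_le_div ht0).2 hty
    have c2 : (y/t) ^ (-(1/2 + 2 * δ)) ≤ (y/t) ^ (-(1 - rr ρ (log (x/y) / log y) / log y)) := by
      refine Real.rpow_le_rpow_of_exponent_le hyt ?_
      have : 1/2 - 2 * δ ≤ rr ρ (log (x/y) / log y) / log y := by rwa [le_div_iff₀ hL]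
      linarith
    have hp := h.RR_pos hy (show 1 ≤ x / t from (one_le_div ht0).2 (hty.trans hyx))
    have c3 := (mul_le_mul_of_nonneg_left c2 hp.le).trans c1
    have c4 : (y/t) ^ (-(1/2 + 2 * δ)) * (Y * t ^ (-(1/2) - 2 * δ)) = 1 := by
      rw [Real.div_rpow hy0.le ht0.le, hY, show -(1/2) - 2 * δ = -(1/2 + 2 * δ) by ring, Real.rpow_neg hy0.le]
      have := (Real.rpow_pos_of_pos ht0 (-(1/2 + 2 * δ))).ne'
      have := (Real.rpow_pos_of_pos hy0 (1/2 + 2 * δ)).ne'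
      generalize (1/2 + 2 * δ) = e at *
      field_simp
    calc RR ρ y (x/t) = RR ρ y (x/t) * (y/t) ^ (-(1/2 + 2 * δ)) * (Y * t ^ (-(1/2) - 2 * δ)) := by
          rw [mul_assoc, c4, mul_one]
      _ ≤ _ := by gcongr
  have b1 : RR ρ y x ≤ R1 * Y := by
    have := cmp 1 le_rfl hy.le
    simpa using this
  have b2 : |R1 * Dl y| ≤ R1 * (C * Y) := by
    rw [abs_mul, abs_of_pos hRy]
    refine mul_le_mul_of_nonneg_left ((hC y hy.le).trans ?_) hRy.le
    refine mul_le_mul_of_nonneg_left ?_ hC0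
    rw [hY]; exact Real.rpow_le_rpow_of_exponent_le hy.le (by linarith)
  have b3 : |∫ t in (1:ℝ)..y, Dl t * KK ρ y x t| ≤ R1 * Y * (4 * C / δ) := by
    have hint := (tail_int le_rfl hδ).1.const_mul (R1 * Y * (4 * C))
    calc _ ≤ ∫ t in (1:ℝ)..y, R1 * Y * (4 * C) * t ^ (-1 - δ) := by
          rw [← Real.norm_eq_abs]
          refine intervalIntegral.norm_integral_le_of_norm_le hy.le (Eventually.of_forall ?_) ?_
          · intro t ht
            have ht1 := ht.1.le
            have ht0 : 0 < t := by linarith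
            have htx := ht.2.trans hyx
            have c1 := cmp t ht1 ht.2
            have hp := h.RR_pos hy (show 1 ≤ x / t from (one_le_div ht0).2 htx)
            have hr1 := h.rr_nonneg (log (x/t) / log y)
            have hr2 : rr ρ (log (x/t) / log y) ≤ rr ρ (log x / log y) := h.rr_mono
              (div_le_div_of_nonneg_right (Real.log_le_log (by positivity) (div_le_self hx0.le ht1)) hL.le)
            have hlam : |1 - rr ρ (log (x/t) / log y) / log y| ≤ 4 := by
              have d1 : 0 ≤ rr ρ (log (x/t) / log y) / log y := by positivity
              have d2 : rr ρ (log (x/t) / log y) / log y ≤ 3 := by rw [div_le_iff₀ hL]; linarith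
              rw [abs_le]; constructor <;> linarith
            rw [norm_mul, Real.norm_eq_abs, Real.norm_eq_abs, KK_eq ht0, abs_div, abs_mul, abs_of_pos hp, abs_of_pos ht0]
            calc _ ≤ (C * t ^ (1/2+δ)) * (R1 * (Y * t ^ (-(1/2) - 2 * δ)) * 4 / t) := by
                  refine mul_le_mul (hC t ht1) ?_ (by positivity) (by positivity)
                  refine div_le_div_of_nonneg_right ?_ ht0.le
                  exact mul_le_mul c1 hlam (abs_nonneg _) (by positivity)
              _ = _ := by
                  have e9 : t ^ (1/2+δ) * t ^ (-(1/2) - 2 * δ) / t = t ^ (-1 - δ) := by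
                    rw [← Real.rpow_add ht0, show 1/2 + δ + (-(1/2) - 2 * δ) = -δ by ring, show -1 - δ = -δ - 1 by ring,
                      Real.rpow_sub_one ht0.ne']
                  rw [← e9]
                  generalize t ^ (1/2+δ) = a
                  generalize t ^ (-(1/2) - 2 * δ) = b
                  ring
          · rw [intervalIntegrable_iff_integrableOn_Ioc_of_le hy.le]
            exact MeasureTheory.IntegrableOn.mono_set hint Set.Ioc_subset_Ioi_self
      _ ≤ ∫ t in Set.Ioi 1, R1 * Y * (4 * C) * t ^ (-1 - δ) := by
          rw [intervalIntegral.integral_of_le hy.le]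
          refine MeasureTheory.setIntegral_mono_set hint ?_ (Eventually.of_forall Set.Ioc_subset_Ioi_self)
          refine (MeasureTheory.ae_restrict_mem measurableSet_Ioi).mono ?_
          intro t ht
          have ht0 : 0 < t := lt_trans one_pos ht
          simp only [Pi.zero_apply]; positivity
      _ = _ := by rw [MeasureTheory.integral_const_mul, (tail_int le_rfl hδ).2, Real.one_rpow]; ring
  have b4 : R1 * y ≤ 3 * (RR ρ y x * log x) := by
    rw [hR1, h.rat1 hy hyx]
    have hlx : 0 ≤ log x := Real.log_nonneg (by linarith)
    calc _ ≤ RR ρ y x * (log x / log y) * (3 * log y) := by gcongr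
      _ = _ := by field_simp
  have b5 : R1 * Y ≤ 3 * (RR ρ y x * log x) * y ^ (-(1/2) + 2 * δ) := by
    have e : Y = y * y ^ (-(1/2) + 2 * δ) := by
      rw [hY, show 1/2 + 2 * δ = 1 + (-(1/2) + 2 * δ) by ring, Real.rpow_add hy0, Real.rpow_one]
    rw [e, ← mul_assoc]; gcongr
  have b6 : R1 * Y * (1 + C + 4 * C / δ) ≤ 3 * (RR ρ y x * log x) * y ^ (-(1/2) + 2 * δ) * (1 + C + 4 * C / δ) := by
    gcongr
  have d1 := (abs_le.1 b2).1
  have d2 := (abs_le.1 b3).1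
  have e7 : (1 - 3 * (1 + C + 4 * C / δ) * y ^ (-(1/2) + 2 * δ)) * (RR ρ y x * log x) =
    RR ρ y x * log x - 3 * (RR ρ y x * log x) * y ^ (-(1/2) + 2 * δ) * (1 + C + 4 * C / δ) := by ring
  rw [e7]
  have hRY : 0 < R1 * Y := by positivity
  linarith

lemma gainE (h : IsDick ρ) {x y : ℝ} (hy : 2 ≤ y) (hyx : y * y ≤ x)
    (h3 : rr ρ (log x / log y) ≤ 3 * log y)
    (hβ : log y / 2 ≤ rr ρ (log (x/y) / log y)) (hψ : y / 4 ≤ Chebyshev.psi y - Chebyshev.psi (y/2)) :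
    log x / (512 * y) * (RR ρ y x * log x) ≤
      ∑ n ∈ Finset.Ioc ⌊y/2⌋₊ ⌊y⌋₊, ArithmeticFunction.vonMangoldt n * RR ρ y (x / ((n^2 : ℕ) : ℝ)) := by
  have hy1 : 1 < y := by linarith
  have hL := Real.log_pos hy1
  have hy0 : 0 < y := by linarith
  have hx0 : 0 < x := by nlinarith
  have hyx1 : y ≤ x := by nlinarith
  have hR := h.RR_pos hy1 (show 1 ≤ x by linarith)
  have hlx : 0 ≤ log x := Real.log_nonneg (by linarith)
  have hyxy : y ≤ x / y := by rwa [le_div_iff₀ hy0]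
  have hR2 := h.RR_pos hy1 (show 1 ≤ x / y / y from (one_le_div hy0).2 hyxy)
  have r1 := h.rat1 hy1 hyx1
  have r2 := h.rat1 hy1 hyxy
  rw [log_div_y hy1 hx0] at r2
  rw [log_div_y hy1 hx0] at hβ
  have hu2 : 2 ≤ log x / log y := by
    rw [le_div_iff₀ hL]
    have := Real.log_le_log (by positivity) hyx
    rw [Real.log_mul hy0.ne' hy0.ne'] at this; linarith
  have hmono := h.rr_mono (show log x / log y - 1 ≤ log x / log y by linarith)
  have k1 : RR ρ y x * (log x)^2 / 8 ≤ RR ρ y (x/y/y) * y ^ 2 := by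
    have e : RR ρ y (x/y/y) * y ^ 2 = RR ρ y x * (log x / log y) * rr ρ (log x / log y) * ((log x / log y - 1) * rr ρ (log x / log y - 1)) := by
      rw [← r1, pow_two, ← mul_assoc, r2]; ring
    rw [e]
    have e2 : RR ρ y x * (log x)^2 / 8 = RR ρ y x * (log x / log y) * (log y / 2) * ((log x / log y / 2) * (log y / 2)) := by
      field_simp; ring
    rw [e2]
    have : log y / 2 ≤ rr ρ (log x / log y) := hβ.trans hmono
    have : log x / log y / 2 ≤ log x / log y - 1 := by linarith
    have : 0 ≤ rr ρ (log x / log y) := h.rr_nonneg _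
    have : 0 ≤ log x / log y - 1 := by linarith
    gcongr
  have k2 : ∀ n ∈ Finset.Ioc ⌊y/2⌋₊ ⌊y⌋₊, ArithmeticFunction.vonMangoldt n * (RR ρ y (x/y/y) / 16) ≤
      ArithmeticFunction.vonMangoldt n * RR ρ y (x / ((n^2 : ℕ) : ℝ)) := by
    intro n hn
    rw [Finset.mem_Ioc] at hn
    have hn1 : y / 2 < n := Nat.lt_of_floor_lt hn.1
    have hn2 : (n:ℝ) ≤ y := (Nat.le_floor_iff hy0.le).1 hn.2
    have hn0 : (0:ℝ) < n := by linarith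
    refine mul_le_mul_of_nonneg_left ?_ ArithmeticFunction.vonMangoldt_nonneg
    push_cast
    have hn3 : (n:ℝ)^2 ≤ x := by nlinarith
    have ht1 : 1 ≤ y^2 / (n:ℝ)^2 := by rw [one_le_div (by positivity)]; gcongr
    have ht4 : y^2 / (n:ℝ)^2 ≤ 4 := by rw [div_le_iff₀ (by positivity)]; nlinarith
    have c1 := h.h_le (x := x / (n:ℝ)^2) (t := y^2 / (n:ℝ)^2) hy1 ht1 (by
      refine div_le_div_of_nonneg_right ?_ (by positivity); nlinarith)
    rw [show x / (n:ℝ)^2 / (y^2 / (n:ℝ)^2) = x / y / y by field_simp] at c1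
    have hp := h.RR_pos hy1 (show 1 ≤ x / (n:ℝ)^2 from (one_le_div (by positivity)).2 hn3)
    have hr2 : rr ρ (log (x/(n:ℝ)^2) / log y) ≤ rr ρ (log x / log y) := h.rr_mono
      (div_le_div_of_nonneg_right (Real.log_le_log (by positivity) (div_le_self hx0.le (by
        have : (1:ℝ) ≤ n := by exact_mod_cast (show 1 ≤ n by omega)
        nlinarith))) hL.le)
    have d2 : rr ρ (log (x/(n:ℝ)^2) / log y) / log y ≤ 3 := by rw [div_le_iff₀ hL]; linarith
    have c2 : (y^2 / (n:ℝ)^2) ^ (-(1 - rr ρ (log (x/(n:ℝ)^2) / log y) / log y)) ≤ 16 := by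
      calc _ ≤ (y^2 / (n:ℝ)^2) ^ (2:ℝ) := Real.rpow_le_rpow_of_exponent_le ht1 (by linarith)
        _ = (y^2 / (n:ℝ)^2) ^ 2 := by rw [Real.rpow_two]
        _ ≤ 4 ^ 2 := by gcongr
        _ = 16 := by norm_num
    have := mul_le_mul_of_nonneg_left c2 hp.le
    linarith
  refine le_trans ?_ (Finset.sum_le_sum k2)
  rw [← Finset.sum_mul]
  have k3 : ∑ n ∈ Finset.Ioc ⌊y/2⌋₊ ⌊y⌋₊, ArithmeticFunction.vonMangoldt n = Chebyshev.psi y - Chebyshev.psi (y/2) := by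
    rw [Chebyshev.psi, Chebyshev.psi, ← Finset.sum_Ioc_consecutive _ (Nat.zero_le _) (Nat.floor_mono (by linarith : y/2 ≤ y))]; ring
  rw [k3]
  calc _ = RR ρ y x * (log x)^2 / 8 / (64 * y) := by field_simp; ring
    _ ≤ RR ρ y (x/y/y) * y ^ 2 / (64 * y) := by gcongr
    _ = y / 4 * (RR ρ y (x/y/y) / 16) := by field_simp; ring
    _ ≤ _ := by gcongr

end IsDick


namespace IsDick
variable {ρ : ℝ → ℝ}

lemma Psi_int_nonneg {x y : ℝ} (hx : 1 ≤ x) : 0 ≤ ∫ t in (1:ℝ)..x, (Psi t y : ℝ) / t :=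
  intervalIntegral.integral_nonneg hx (fun t ht => div_nonneg (Nat.cast_nonneg _) (by linarith [ht.1]))

lemma low_sum {x y W c : ℝ} (hW : y ≤ W) (hy : 1 < y) (hx : 0 < x)
    (hf : ∀ z, x / W ≤ z → z ≤ x / 2 → c * RR ρ y z ≤ Psi z y) :
    c * ∑ n ∈ Finset.Ioc 0 ⌊y⌋₊, ArithmeticFunction.vonMangoldt n * RR ρ y (x / n) ≤
      ∑ n ∈ Finset.Ioc 0 ⌊y⌋₊, ArithmeticFunction.vonMangoldt n * (Psi (x / n) y : ℝ) := by
  rw [Finset.mul_sum]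
  refine Finset.sum_le_sum fun n hn => ?_
  rw [Finset.mem_Ioc] at hn
  by_cases h0 : ArithmeticFunction.vonMangoldt n = 0
  · simp [h0]
  have h2 : (2:ℝ) ≤ n := by exact_mod_cast ge_two_of_vM h0
  have hny : (n:ℝ) ≤ y := (Nat.le_floor_iff (by linarith)).1 hn.2
  have := hf (x / n) (by gcongr; linarith) (by gcongr)
  rw [mul_left_comm]
  exact mul_le_mul_of_nonneg_left this ArithmeticFunction.vonMangoldt_nonneg

lemma S1 (h : IsDick ρ) {x y C δ W c : ℝ} (hy : 1 < y) (hyx : y ≤ x) (hδ : 0 < δ) (hδ2 : δ ≤ 1/4)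
    (hC : ∀ t ≥ (1:ℝ), |Dl t| ≤ C * t ^ (1/2 + δ))
    (h3 : rr ρ (log x / log y) ≤ 3 * log y)
    (hβ : (1/2 - 2 * δ) * log y ≤ rr ρ (log (x/y) / log y)) (hW : y ≤ W) (hc : 0 ≤ c)
    (hf : ∀ z, x / W ≤ z → z ≤ x / 2 → c * RR ρ y z ≤ Psi z y) :
    c * (1 - 3 * (1 + C + 4 * C / δ) * y ^ (-(1/2) + 2 * δ)) * RR ρ y x ≤ Psi x y := by
  have hx : 0 < x := by linarith
  have hlx : 0 < log x := Real.log_pos (by linarith)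
  have e := mul_le_mul_of_nonneg_left (h.errE hy hyx hδ hδ2 hC h3 hβ) hc
  have i1 := low_sum hW hy hx hf
  have i2 := Psi_ineq (show 1 ≤ x by linarith) _ (Ioc_smooth (show 0 ≤ y by linarith))
  have i3 := Psi_int_nonneg (y := y) (show 1 ≤ x by linarith)
  refine le_of_mul_le_mul_right ?_ hlx
  linarith

lemma S2 (h : IsDick ρ) {x y C δ c : ℝ} (hy : 4 ≤ y) (hyx : y * y ≤ x) (hδ : 0 < δ) (hδ2 : δ ≤ 1/4)
    (hC : ∀ t ≥ (1:ℝ), |Dl t| ≤ C * t ^ (1/2 + δ))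
    (h3 : rr ρ (log x / log y) ≤ 3 * log y)
    (hβ : log y / 2 ≤ rr ρ (log (x/y) / log y)) (hψ : y / 4 ≤ Chebyshev.psi y - Chebyshev.psi (y/2)) (hc : 0 ≤ c)
    (hf : ∀ z, x / y ^ 2 ≤ z → z ≤ x / 2 → c * RR ρ y z ≤ Psi z y) :
    c * (1 - 3 * (1 + C + 4 * C / δ) * y ^ (-(1/2) + 2 * δ) + log x / (512 * y)) * RR ρ y x ≤ Psi x y := by
  have hx : 0 < x := by nlinarith
  have hyx1 : y ≤ x := by nlinarith
  have hlx : 0 < log x := Real.log_pos (by linarith)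
  have hL : 0 < log y := Real.log_pos (by linarith)
  have e1 := mul_le_mul_of_nonneg_left (h.errE (by linarith) hyx1 hδ hδ2 hC h3 (by nlinarith)) hc
  have e2 := mul_le_mul_of_nonneg_left (h.gainE (by linarith) hyx h3 hβ hψ) hc
  have i1 := low_sum (show y ≤ y ^ 2 by nlinarith) (by linarith) hx hf
  have hI : ∀ n ∈ Finset.Ioc ⌊y/2⌋₊ ⌊y⌋₊, y / 2 < n ∧ (n:ℝ) ≤ y := fun n hn => by
    rw [Finset.mem_Ioc] at hn
    exact ⟨Nat.lt_of_floor_lt hn.1, (Nat.le_floor_iff (by linarith)).1 hn.2⟩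
  have hdis : Disjoint (Finset.Ioc 0 ⌊y⌋₊) ((Finset.Ioc ⌊y/2⌋₊ ⌊y⌋₊).image (· ^ 2)) := by
    rw [Finset.disjoint_right]
    intro m hm hm2
    obtain ⟨n, hn, rfl⟩ := Finset.mem_image.1 hm
    have h1 := (hI n hn).1
    rw [Finset.mem_Ioc] at hm2
    have h2 := (Nat.le_floor_iff (show 0 ≤ y by linarith)).1 hm2.2
    push_cast at h2
    nlinarith
  have i2 := Psi_ineq (y := y) (show 1 ≤ x by linarith) (Finset.Ioc 0 ⌊y⌋₊ ∪ (Finset.Ioc ⌊y/2⌋₊ ⌊y⌋₊).image (· ^ 2)) (by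
    intro d hd
    rcases Finset.mem_union.1 hd with hd | hd
    · exact Ioc_smooth (by linarith) d hd
    · obtain ⟨n, hn, rfl⟩ := Finset.mem_image.1 hd
      have hn0 : 0 < n := by rw [Finset.mem_Ioc] at hn; omega
      refine ⟨Nat.one_le_pow _ _ hn0, fun p hp hpd => ?_⟩
      have := Nat.le_of_dvd hn0 (hp.dvd_of_dvd_pow hpd)
      exact le_trans (by exact_mod_cast this) (hI n hn).2)
  rw [Finset.sum_union hdis, Finset.sum_image (fun a _ b _ hab => Nat.pow_left_injective (n := 2) (by norm_num) hab)] at i2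
  have i4 : c * ∑ n ∈ Finset.Ioc ⌊y/2⌋₊ ⌊y⌋₊, ArithmeticFunction.vonMangoldt n * RR ρ y (x / ((n^2 : ℕ) : ℝ)) ≤
      ∑ n ∈ Finset.Ioc ⌊y/2⌋₊ ⌊y⌋₊, ArithmeticFunction.vonMangoldt (n^2) * (Psi (x / ((n^2 : ℕ) : ℝ)) y : ℝ) := by
    rw [Finset.mul_sum]
    refine Finset.sum_le_sum fun n hn => ?_
    obtain ⟨h1, h2⟩ := hI n hn
    rw [ArithmeticFunction.vonMangoldt_apply_pow (by norm_num), mul_left_comm]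
    refine mul_le_mul_of_nonneg_left (hf _ ?_ ?_) ArithmeticFunction.vonMangoldt_nonneg
    · push_cast
      have : (0:ℝ) < n := by linarith
      gcongr
    · push_cast
      gcongr
      nlinarith
  have i3 := Psi_int_nonneg (y := y) (show 1 ≤ x by linarith)
  refine le_of_mul_le_mul_right ?_ hlx
  linarith

end IsDick

lemma dyad {f R : ℝ → ℝ} {W X Xm A q c : ℝ} (hW : 0 < W) (hX : 0 < X) (hR : ∀ z ≥ A, 0 ≤ R z) (hAX : A ≤ X / W)
    (hq0 : 0 ≤ q) (hq : q ≤ 1) (S : ∀ x, X < x → x ≤ Xm → ∀ c, 0 ≤ c →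
      (∀ z, x / W ≤ z → z ≤ x / 2 → c * R z ≤ f z) → c * q * R x ≤ f x)
    (hc : 0 ≤ c) (h0 : ∀ z, A ≤ z → z ≤ X → c * R z ≤ f z) :
    ∀ k : ℕ, ∀ x, A ≤ x → x ≤ X * 2 ^ k → x ≤ Xm → c * q ^ k * R x ≤ f x := by
  intro k
  induction k with
  | zero => intro x hA hx _; simpa using h0 x hA (by simpa using hx)
  | succ k ih =>
    intro x hA hx hm
    rcases le_or_gt x (X * 2 ^ k) with hk | hk
    · refine le_trans ?_ (ih x hA hk hm)
      have := pow_le_pow_of_le_one hq0 hq (Nat.le_succ k)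
      exact mul_le_mul_of_nonneg_right (mul_le_mul_of_nonneg_left this hc) (hR x hA)
    · have hXx : X < x := lt_of_le_of_lt (le_mul_of_one_le_right hX.le (one_le_pow₀ (by norm_num))) hk
      have := S x hXx hm (c * q ^ k) (by positivity) (fun z h1 h2 => ih z
        (hAX.trans (le_trans (by gcongr) h1)) (by rw [pow_succ] at hx; linarith) (by linarith))
      rwa [pow_succ, ← mul_assoc]

lemma climb {f R : ℝ → ℝ} {W Xa Xb Xm A q g : ℝ} (hW : 2 ≤ W) (hXa : 0 < Xa) (hab : Xa ≤ Xb)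
    (hR : ∀ z ≥ A, 0 ≤ R z) (hA : A ≤ Xa / W) (hq0 : 0 ≤ q) (hq : q ≤ 1) (hg : 0 ≤ g) (hbm : Xb ≤ Xm)
    (S1 : ∀ x, Xa < x → x ≤ Xm → ∀ c, 0 ≤ c →
      (∀ z, x / W ≤ z → z ≤ x / 2 → c * R z ≤ f z) → c * q * R x ≤ f x)
    (S2 : ∀ x, Xb < x → x ≤ Xm → ∀ c, 0 ≤ c →
      (∀ z, x / W ≤ z → z ≤ x / 2 → c * R z ≤ f z) → c * (1 + g) * R x ≤ f x)
    (h0 : ∀ z, A ≤ z → z ≤ Xa → R z ≤ f z) (J : ℕ) (hJ : Xb ≤ Xa * 2 ^ J) :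
    ∀ K : ℕ, ∀ x, Xb * W ^ K ≤ x → x ≤ Xm → q ^ J * (1 + g) ^ K * R x ≤ f x := by
  have hW0 : 0 < W := by linarith
  have hXb : 0 < Xb := by linarith
  have hAa : A ≤ Xa := hA.trans (div_le_self hXa.le (by linarith))
  have hAb : A ≤ Xb / W := hA.trans (by gcongr)
  have a1 : ∀ z, A ≤ z → z ≤ Xb → q ^ J * R z ≤ f z := by
    intro z h1 h2
    have := dyad hW0 hXa hR hA hq0 hq S1 zero_le_one (by simpa using h0) J z h1 (by linarith) (by linarith)
    simpa using this
  have a2 : ∀ z, A ≤ z → z ≤ Xm → q ^ J * R z ≤ f z := by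
    intro z h1 h2
    obtain ⟨k, hk⟩ := pow_unbounded_of_one_lt (z / Xb) (one_lt_two (α := ℝ))
    have := dyad (q := 1) hW0 hXb hR hAb zero_le_one le_rfl (fun x hx1 hx2 c hc hz => by
      refine le_trans ?_ (S2 x hx1 hx2 c hc hz)
      refine mul_le_mul_of_nonneg_right (mul_le_mul_of_nonneg_left (by linarith) hc) (hR x (by linarith)))
      (show 0 ≤ q ^ J by positivity) a1 k z h1 (by rw [div_lt_iff₀ hXb] at hk; linarith) h2
    simpa using this
  intro K
  induction K with
  | zero => intro x h1 h2; simpa using a2 x (by simp at h1; linarith) h2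
  | succ K ih =>
    intro x h1 h2
    have hp : (1:ℝ) ≤ W ^ K := one_le_pow₀ (by linarith)
    have := S2 x (by rw [pow_succ] at h1; have := mul_le_mul hp hW (by norm_num) (by positivity); nlinarith) h2
      (q ^ J * (1 + g) ^ K) (by positivity)
      (fun z h3 h4 => ih z (by rw [pow_succ, ← mul_assoc, ← le_div_iff₀ hW0] at h1; linarith) (by
        have : 0 < x := lt_of_lt_of_le (by positivity) h1
        linarith))
    rwa [pow_succ, ← mul_assoc]


lemma beat {E g T L : ℝ} {J K : ℕ} (hE : 0 ≤ E) (hE2 : E ≤ 1/2) (hg : 0 ≤ g) (hg1 : g ≤ 1) (hT : 0 ≤ T) (hL : 0 < L)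
    (hJ : (J:ℝ) ≤ 3 * T) (hK : T / (4 * L) ≤ K) (h : 48 * E * L ≤ g) : 1 ≤ (1 - E) ^ J * (1 + g) ^ K := by
  have hq : 0 < 1 - E := by linarith
  have l1 : -(2 * E) ≤ log (1 - E) := by
    refine le_trans ?_ (Real.one_sub_inv_le_log_of_pos hq)
    have : (1 - E)⁻¹ ≤ 1 + 2 * E := by rw [inv_le_iff_one_le_mul₀ hq]; nlinarith
    linarith
  have l2 : g / 2 ≤ log (1 + g) := by
    refine le_trans ?_ (Real.le_log_one_add_of_nonneg hg)
    rw [le_div_iff₀ (by linarith)]; nlinarith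
  have hp : 0 < (1 - E) ^ J * (1 + g) ^ K := by positivity
  rw [← Real.log_nonneg_iff hp, Real.log_mul (by positivity) (by positivity), Real.log_pow, Real.log_pow]
  have m1 : (J:ℝ) * -(2*E) ≤ J * log (1 - E) := mul_le_mul_of_nonneg_left l1 (Nat.cast_nonneg _)
  have m2 : (K:ℝ) * (g/2) ≤ K * log (1 + g) := mul_le_mul_of_nonneg_left l2 (Nat.cast_nonneg _)
  have m3 : (J:ℝ) * (2*E) ≤ 3 * T * (2 * E) := mul_le_mul_of_nonneg_right hJ (by positivity)
  have m4 : T / (4 * L) * (g/2) ≤ K * (g/2) := mul_le_mul_of_nonneg_right hK (by positivity)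
  have m5 : T / (4 * L) * ((48 * E * L)/2) ≤ T / (4 * L) * (g/2) := by gcongr
  have m6 : T / (4 * L) * ((48 * E * L)/2) = 3 * T * (2 * E) := by field_simp; ring
  linarith

lemma ev_facts {a C C' C3 yD : ℝ} (ha : 0 < a) (ha1 : a ≤ 1/4) : ∀ᶠ y : ℝ in atTop,
    yD ≤ y ∧ 4 ≤ y ∧ 2 * (C' + 1) ≤ log y ∧ 1 ≤ log y ∧ 2 * log y ≤ y ^ (a/8) ∧ 8 * C ≤ y ^ (1/2 - a/8) ∧
    512 * (3 * C3 + 1) ≤ y ^ (a/4) ∧ 144 * |C3| * log y ≤ y ^ (a/4) ∧ 6 * C3 ≤ y ^ (1/2 - a/2) ∧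
    4 * log y ≤ y ^ (1/2 - a/8) := by
  have lo : ∀ b : ℝ, 0 < b → ∀ M : ℝ, 0 ≤ M → ∀ᶠ y : ℝ in atTop, M * log y ≤ y ^ b := by
    intro b hb M hM
    filter_upwards [(isLittleO_log_rpow_atTop hb).bound (show 0 < (M+1)⁻¹ by positivity), eventually_ge_atTop 1] with y h1 h2
    have hlog := Real.log_nonneg h2
    rw [Real.norm_of_nonneg hlog, Real.norm_of_nonneg (by positivity), ← div_eq_inv_mul, le_div_iff₀ (by positivity)] at h1
    linarith
  have te : ∀ b : ℝ, 0 < b → ∀ M : ℝ, ∀ᶠ y : ℝ in atTop, M ≤ y ^ b := fun b hb M =>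
    (tendsto_rpow_atTop hb).eventually_ge_atTop M
  filter_upwards [eventually_ge_atTop yD, eventually_ge_atTop 4, Real.tendsto_log_atTop.eventually_ge_atTop (2 * (C' + 1)),
    Real.tendsto_log_atTop.eventually_ge_atTop 1, lo (a/8) (by linarith) 2 (by norm_num), te (1/2 - a/8) (by linarith) (8 * C),
    te (a/4) (by linarith) (512 * (3 * C3 + 1)), lo (a/4) (by linarith) (144 * |C3|) (by positivity),
    te (1/2 - a/2) (by linarith) (6 * C3), lo (1/2 - a/8) (by linarith) 4 (by norm_num)] with y h1 h2 h3 h4 h5 h6 h7 h8 h9 h10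
  exact ⟨h1, h2, h3, h4, h5, h6, h7, h8, h9, h10⟩

namespace IsDick
variable {ρ : ℝ → ℝ}

set_option maxHeartbeats 2000000 in
theorem thmE (h : IsDick ρ) (hRH : RiemannHypothesis) {a : ℝ} (ha : 0 < a) (ha1 : a ≤ 1/4) :
    ∃ y0 : ℝ, 4 ≤ y0 ∧ ∀ y ≥ y0, ∀ x, 0 < x → 2 * y ^ (1/2 + a) ≤ log x → log x ≤ 2 * y ^ 2 * log y → RR ρ y x ≤ Psi x y := by
  obtain ⟨C, hC0, hC⟩ := psi_RH hRH (show 0 < a/8 by linarith)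
  obtain ⟨yD, -, hD⟩ := h.thmD hRH (θ := 1/2 - a/8) (ε := 1) (by linarith) (by linarith) one_pos le_rfl
  obtain ⟨C', hC'0, hC'⟩ := h.rr_le_log (show (0:ℝ) < 1/4 by norm_num)
  obtain ⟨C3, hC3⟩ : ∃ C3, C3 = 1 + C + 4 * C / (a/8) := ⟨_, rfl⟩
  have hC31 : 1 ≤ C3 := by rw [hC3]; have : 0 < 4 * C / (a/8) := by positivity
                           linarith
  obtain ⟨y0, hy0⟩ := eventually_atTop.1 (ev_facts (C := C) (C' := C') (C3 := C3) (yD := yD) ha ha1)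
  refine ⟨max y0 4, le_max_right _ _, fun y hy x hx hx1 hx2 => ?_⟩
  obtain ⟨f1, f2, f3, f4, f5, f6, f7, f8, f9, f10⟩ := hy0 y ((le_max_left _ _).trans hy)
  rw [abs_of_pos (by linarith)] at f8
  have hyp : 0 < y := by linarith
  have hL : 0 < log y := by linarith
  obtain ⟨L, hLe⟩ : ∃ L, L = log y := ⟨_, rfl⟩
  obtain ⟨H, hH⟩ : ∃ H, H = y ^ (1/2:ℝ) := ⟨_, rfl⟩
  obtain ⟨P, hP⟩ : ∃ P, P = y ^ (a/4) := ⟨_, rfl⟩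
  obtain ⟨Q, hQ⟩ : ∃ Q, Q = y ^ (a/8) := ⟨_, rfl⟩
  have hH0 : 0 < H := by rw [hH]; positivity
  have hP0 : 0 < P := by rw [hP]; positivity
  have hQ0 : 0 < Q := by rw [hQ]; positivity
  have pQ : P = Q * Q := by rw [hP, hQ, ← Real.rpow_add hyp]; ring_nf
  have pT : y ^ (1/2 + a) = H * P ^ 4 := by
    rw [hP, hH, ← Real.rpow_natCast, ← Real.rpow_mul hyp.le, ← Real.rpow_add hyp]; congr 1; push_cast; ring
  have pA : y ^ (1/2 - a/8) = H / Q := by rw [hH, hQ, ← Real.rpow_sub hyp]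
  have pE : y ^ (-(1/2) + 2 * (a/8)) = P / H := by rw [hH, hP, ← Real.rpow_sub hyp]; ring_nf
  have p2 : y ^ (1/2 - a/2) = H / P ^ 2 := by
    rw [hP, hH, ← Real.rpow_natCast, ← Real.rpow_mul hyp.le, ← Real.rpow_sub hyp]; congr 1; push_cast; ring
  have pB : y ^ (1/2 - 2 * (a/8)) = H / P := by rw [hH, hP, ← Real.rpow_sub hyp]; ring_nf
  have pH : y = H * H := by rw [hH, ← Real.rpow_add hyp]; norm_num
  rw [← hQ] at f5
  rw [pA] at f6 f10
  rw [← hP] at f7 f8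
  rw [p2, le_div_iff₀ (by positivity)] at f9
  rw [pT] at hx1
  rw [← hLe] at hx2 hL f3 f4 f5 f8 f10
  have hP1 : 1 ≤ P := by linarith
  have hQ1 : 1 ≤ Q := by linarith
  have hHP2 : 6 * P ^ 2 ≤ H := by linarith [mul_le_mul_of_nonneg_right hC31 (sq_nonneg P)]
  have hP2 : P ≤ P ^ 2 := le_self_pow₀ hP1 two_ne_zero
  have hHP : 6 * P ≤ H := by linarith
  have hPL : 144 * L ≤ P := by linarith [mul_le_mul_of_nonneg_right hC31 hL.le]
  obtain ⟨T, hT⟩ : ∃ T, T = H * P ^ 4 := ⟨_, rfl⟩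
  obtain ⟨E, hE⟩ : ∃ E, E = 3 * C3 * (P / H) := ⟨_, rfl⟩
  obtain ⟨g, hg⟩ : ∃ g, g = P ^ 2 / H := ⟨_, rfl⟩
  have hP4 : P ≤ P ^ 4 := le_self_pow₀ hP1 (by norm_num)
  have hTHP : H * P ≤ T := by rw [hT]; gcongr
  have hE0 : 0 ≤ E := by rw [hE]; positivity
  have hE2 : E ≤ 1/2 := by
    rw [hE, ← mul_div_assoc, div_le_iff₀ hH0]; linarith [mul_le_mul_of_nonneg_left hP2 (show 0 ≤ C3 by linarith)]
  have hg0 : 0 ≤ g := by rw [hg]; positivity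
  have hg1 : g ≤ 1 := by rw [hg, div_le_one hH0]; linarith [sq_nonneg P]
  have hT1 : 144 * L ≤ T := by linarith [le_mul_of_one_le_left hP0.le (show 1 ≤ H by linarith)]
  have hAT : H / Q ≤ T := by
    refine (div_le_self hH0.le hQ1).trans ?_
    exact (le_mul_of_one_le_right hH0.le hP1).trans hTHP
  have hψ : y / 4 ≤ Chebyshev.psi y - Chebyshev.psi (y/2) := by
    have d1 := (abs_le.1 (hC y (by linarith))).1
    have d2 := (abs_le.1 (hC (y/2) (by linarith))).2
    have d3 : (y/2) ^ (1/2 + a/8) ≤ y ^ (1/2 + a/8) := by gcongr; linarith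
    have d4 : y ^ (1/2 + a/8) = H * Q := by rw [hH, hQ, ← Real.rpow_add hyp]
    have d5 := mul_le_mul_of_nonneg_left d3 hC0.le
    rw [d4] at d1 d5
    rw [le_div_iff₀ hQ0] at f6
    have d6 : 8 * (C * (H * Q)) ≤ y := by rw [pH]; linarith [mul_le_mul_of_nonneg_right f6 hH0.le]
    simp only [Dl] at d1 d2
    linarith
  -- rr bounds
  have hr3 : ∀ z, 0 < z → y ≤ z → log z ≤ 2 * y ^ 2 * L → rr ρ (log z / log y) ≤ 3 * log y := by
    intro z hz hyz hzl
    rw [← hLe]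
    have u1 : 1 ≤ log z / L := by rw [one_le_div hL, hLe]; exact Real.log_le_log hyp hyz
    have u2 : log z / L ≤ 2 * y ^ 2 := by rwa [div_le_iff₀ hL]
    have u3 := Real.log_le_log (by linarith) u2
    rw [Real.log_mul (by norm_num) (by positivity), Real.log_pow, ← hLe] at u3
    have := hC' _ u1
    have := Real.log_two_lt_d9
    push_cast at u3
    linarith
  have hbig : ∀ z b B : ℝ, 0 < z → B = y ^ b → B + 1 ≤ log z / L → 1 ≤ B → b * L ≤ rr ρ (log (z/y) / log y) := by
    intro z b B hz hB hu hB1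
    rw [log_div_y (by linarith) hz, ← hLe]
    refine le_trans ?_ (h.log_le_rr (by linarith))
    rw [hLe, ← Real.log_rpow hyp, ← hB]
    rw [← hLe]
    exact Real.log_le_log (by linarith) (by linarith)
  have lA : ∀ z, 0 < z → H / Q ≤ log z → (1/2 - 2 * (a/8)) * L ≤ rr ρ (log (z/y) / log y) := by
    intro z hz hz1
    refine hbig z _ _ hz pB.symm ?_ (by rw [one_le_div hP0]; linarith)
    rw [le_div_iff₀ hL]
    refine le_trans ?_ hz1
    have : H / P + 1 ≤ 2 * (H / P) := by
      have : 1 ≤ H / P := by rw [one_le_div hP0]; linarith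
      linarith
    calc _ ≤ 2 * (H / P) * L := by gcongr
      _ = H / P * (2 * L) := by ring
      _ ≤ H / P * Q := by gcongr
      _ = H / Q := by rw [pQ]; field_simp
  have lB : ∀ z, 0 < z → T ≤ log z → L / 2 ≤ rr ρ (log (z/y) / log y) := by
    intro z hz hz1
    have := hbig z (1/2) H hz hH (by
      rw [le_div_iff₀ hL]; linarith [mul_le_mul_of_nonneg_left hPL hH0.le, le_mul_of_one_le_left hL.le (show 1 ≤ H by linarith)]) (by linarith)
    linarith
  have yle : ∀ z, 0 < z → 4 * L ≤ log z → y * y * y * y ≤ z := by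
    intro z hz h4
    rw [← Real.log_le_log_iff (by positivity) hz, Real.log_mul (by positivity) (by positivity), Real.log_mul (by positivity) (by positivity),
      Real.log_mul (by positivity) (by positivity), ← hLe]; linarith
  have hy2 : y * 16 ≤ y * y * y := by linarith [mul_le_mul_of_nonneg_left (mul_le_mul f2 f2 (by norm_num) hyp.le) hyp.le]
  have hyW : y ≤ y ^ 2 := le_self_pow₀ (by linarith) two_ne_zero
  have hyy1 : y * y ≤ y * y * y := le_mul_of_one_le_right (by positivity) (by linarith)
  have hy3 : y * y * y ≤ y * y * y * y := le_mul_of_one_le_right (by positivity) (by linarith)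
  have key := climb (f := fun z => (Psi z y : ℝ)) (R := RR ρ y) (W := y ^ 2) (Xa := exp (H / Q)) (Xb := exp T)
    (Xm := exp (2 * y ^ 2 * L)) (A := 2 * y) (q := 1 - E) (g := g) (by linarith) (Real.exp_pos _) (Real.exp_le_exp.2 hAT)
    (fun z hz => (h.RR_pos (by linarith) (by linarith)).le)
    (by
      rw [le_div_iff₀ (by positivity)]
      have := yle (exp (H/Q)) (Real.exp_pos _) (by rw [Real.log_exp]; exact f10)
      linarith [mul_le_mul_of_nonneg_right f2 (show 0 ≤ y * y * y by positivity), show 0 < y * y * y by positivity])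
    (by linarith) (by linarith) hg0
    (by
      rw [Real.exp_le_exp, hT]
      have := hx1.trans hx2
      have : 0 < H * P ^ 4 := by positivity
      linarith)
    (by
      intro z h1 h2 c hc hz
      have hz0 : 0 < z := (Real.exp_pos _).trans h1
      have h1' : H / Q ≤ log z := by rw [Real.le_log_iff_exp_le hz0]; exact h1.le
      have h2' : log z ≤ 2 * y ^ 2 * L := by rw [Real.log_le_iff_le_exp hz0]; exact h2
      have hyz : y ≤ z := by linarith [yle z hz0 (f10.trans h1')]
      have := h.S1 (δ := a/8) (W := y^2) (by linarith) hyz (by linarith) (by linarith) hC (hr3 z hz0 hyz h2')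
        (by have := lA z hz0 h1'; rwa [hLe] at this) hyW hc hz
      rwa [← hC3, pE, ← hE] at this)
    (by
      intro z h1 h2 c hc hz
      have hz0 : 0 < z := (Real.exp_pos _).trans h1
      have h1' : T ≤ log z := by rw [Real.le_log_iff_exp_le hz0]; exact h1.le
      have h2' : log z ≤ 2 * y ^ 2 * L := by rw [Real.log_le_iff_le_exp hz0]; exact h2
      have hyy := yle z hz0 (f10.trans (hAT.trans h1'))
      have hyz : y ≤ z := by linarith
      have hyyz : y * y ≤ z := by linarith
      have s2 := h.S2 (δ := a/8) f2 hyyz (by linarith) (by linarith) hC (hr3 z hz0 hyz h2')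
        (by have := lB z hz0 h1'; rwa [hLe] at this) hψ hc hz
      rw [← hC3, pE, ← hE] at s2
      refine le_trans ?_ s2
      have hR := h.RR_pos (show 1 < y by linarith) (show 1 ≤ z by linarith)
      refine mul_le_mul_of_nonneg_right (mul_le_mul_of_nonneg_left ?_ hc) hR.le
      have g1 : T / (512 * y) ≤ log z / (512 * y) := by gcongr
      have g2 : T / (512 * y) = P ^ 4 / 512 / H := by rw [hT, pH]; field_simp
      have g3 : E + g ≤ P ^ 4 / 512 / H := by
        rw [hE, hg, ← mul_div_assoc, ← add_div]
        refine div_le_div_of_nonneg_right ?_ hH0.le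
        have w1 : 512 * (3 * C3 + 1) * P ^ 2 ≤ P * P ^ 2 := by gcongr
        have w2 : P * P ^ 2 ≤ P ^ 4 := by
          rw [show P ^ 4 = P * P ^ 2 * P by ring]; exact le_mul_of_one_le_right (by positivity) hP1
        have w3 : C3 * P ≤ C3 * P ^ 2 := by gcongr
        linarith
      linarith)
    (by
      intro z h1 h2
      have hz0 : 0 < z := by linarith
      refine hD y f1 z (by linarith) ?_
      rw [pA, Real.log_le_iff_le_exp hz0]; exact h2)
    ⌈2 * T⌉₊
    (by
      have hc := Nat.le_ceil (2 * T)
      have : exp T ≤ 2 ^ ⌈2 * T⌉₊ := by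
        rw [← Real.log_le_log_iff (Real.exp_pos _) (by positivity), Real.log_exp, Real.log_pow]
        have := Real.log_two_gt_d9
        linarith [mul_le_mul hc (show 1/2 ≤ log 2 by linarith) (by norm_num) (Nat.cast_nonneg _)]
      refine this.trans (le_mul_of_one_le_left (by positivity) ?_)
      exact Real.one_le_exp (by positivity))
    ⌊T / (2 * L)⌋₊ x
    (by
      have hf := Nat.floor_le (show 0 ≤ T / (2 * L) from div_nonneg (by linarith) (by linarith))
      rw [← Real.log_le_log_iff (by positivity) hx, Real.log_mul (by positivity) (by positivity), Real.log_exp, Real.log_pow, Real.log_pow, ← hLe]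
      rw [le_div_iff₀ (by positivity)] at hf
      push_cast
      linarith)
    (by rw [← Real.log_le_iff_le_exp hx]; exact hx2)
  have hx1' : 1 ≤ x := by
    rw [← Real.log_nonneg_iff hx]; refine le_trans ?_ hx1; positivity
  have hR := h.RR_pos (show 1 < y by linarith) hx1'
  refine le_trans (le_mul_of_one_le_left hR.le ?_) key
  refine beat (T := T) (L := L) hE0 hE2 hg0 hg1 (by linarith) hL ?_ ?_ ?_
  · have := Nat.ceil_lt_add_one (show 0 ≤ 2 * T by linarith)
    linarith
  · have hf := Nat.lt_floor_add_one (T / (2 * L))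
    have : T / (2 * L) = 2 * (T / (4 * L)) := by field_simp; ring
    have : 1 ≤ T / (4 * L) := by rw [one_le_div (by positivity)]; linarith
    linarith
  · rw [hE, hg, ← mul_div_assoc, le_div_iff₀ hH0]
    have : 48 * (3 * C3 * P / H) * L * H = 144 * C3 * L * P := by field_simp; ring
    rw [this, pow_two]; gcongr

end IsDick


lemma IsDick.tailF {ρ : ℝ → ℝ} (h : IsDick ρ) {x y : ℝ} (hy : 2 ≤ y) (hx : 1 ≤ x) (hxy : 2 * y ^ 2 * log y ≤ log x) :
    x * ρ (log x / log y) ≤ Psi x y := by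
  have hL : 0 < log y := Real.log_pos (by linarith)
  have hx0 : 0 < x := by linarith
  obtain ⟨u, hu⟩ : ∃ u, u = log x / log y := ⟨_, rfl⟩
  have hu1 : 2 * y ^ 2 ≤ u := by rwa [hu, le_div_iff₀ hL]
  have hu2 : 2 ≤ u := by nlinarith
  have h1 := h.rho_le hu2
  have h2 : 2 * log y ≤ log (u/2) := by
    have := Real.log_le_log (show 0 < y ^ 2 by positivity) (show y ^ 2 ≤ u / 2 by linarith)
    rwa [Real.log_pow] at this
  have h3 : x ≤ exp (log (u/2) * (u/2)) := by
    rw [← Real.log_le_iff_le_exp hx0]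
    calc log x = 2 * log y * (u/2) := by rw [hu]; field_simp
      _ ≤ _ := by gcongr
  have h4 : (1:ℝ) ≤ Psi x y := by exact_mod_cast one_le_Psi hx
  rw [← hu]
  have := mul_le_mul_of_nonneg_left h3 (h.pos (show 0 ≤ u by linarith)).le
  linarith

/-- Under RH, Pomerance's inequality `Ψ(x,y) ≥ x ρ(log x/log y)` holds for `x` large in the
ranges `(log x)^{2+ε} ≤ y ≤ (1-ε)x` and `2 ≤ y ≤ (log x)^{2-ε}`.
The Dickman function `ρ` is characterized by the hypotheses. -/
theorem stmt3 (ρ : ℝ → ℝ) (hρ_cont : ContinuousOn ρ (Set.Ici 0))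
    (hρ_one : ∀ t ∈ Set.Icc (0 : ℝ) 1, ρ t = 1)
    (hρ_eq : ∀ t ≥ (1 : ℝ), ρ t = 1 - ∫ v in (1 : ℝ)..t, ρ (v - 1) / v)
    (hRH : RiemannHypothesis) (ε : ℝ) (hε : 0 < ε) :
    ∃ x₀ : ℝ, ∀ x ≥ x₀, ∀ y : ℝ,
      (((Real.log x) ^ (2 + ε) ≤ y ∧ y ≤ (1 - ε) * x) ∨
        (2 ≤ y ∧ y ≤ (Real.log x) ^ (2 - ε))) →
      x * ρ (Real.log x / Real.log y) ≤ (Psi x y : ℝ) := by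
  have h : IsDick ρ := ⟨hρ_cont, hρ_one, hρ_eq⟩
  have r1 : ∃ B : ℝ, ∀ x, 1 ≤ x → B ≤ log x → 1 ≤ log x → ∀ y, (log x) ^ (2 + ε) ≤ y → y ≤ (1 - ε) * x →
      x * ρ (log x / log y) ≤ (Psi x y : ℝ) := by
    rcases le_or_gt 1 ε with h1 | h1
    · refine ⟨1, fun x hx _ hl y hy1 hy2 => ?_⟩
      have : 0 < (log x) ^ (2 + ε) := Real.rpow_pos_of_pos (by linarith) _
      nlinarith
    · obtain ⟨y0, h3, hD⟩ := h.thmD hRH (θ := 1 / (2 + ε)) (by positivity)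
        (by rw [div_lt_div_iff₀ (by linarith) (by norm_num)]; linarith) hε h1.le
      refine ⟨y0, fun x hx hB hl y hy1 hy2 => ?_⟩
      have hly : log x ≤ (log x) ^ (2 + ε) := by
        have := Real.rpow_le_rpow_of_exponent_le hl (show 1 ≤ 2 + ε by linarith)
        rwa [Real.rpow_one] at this
      refine hD y (by linarith) x ?_ ?_
      · nlinarith [sq_nonneg ε]
      · have := Real.rpow_le_rpow (by positivity) hy1 (show 0 ≤ 1 / (2 + ε) by positivity)
        rwa [← Real.rpow_mul (by linarith), mul_one_div_cancel (by linarith), Real.rpow_one] at this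
  have r2 : ∃ B : ℝ, ∀ x, 1 ≤ x → B ≤ log x → 1 ≤ log x → ∀ y, 2 ≤ y → y ≤ (log x) ^ (2 - ε) →
      x * ρ (log x / log y) ≤ (Psi x y : ℝ) := by
    rcases le_or_gt 2 ε with h1 | h1
    · refine ⟨1, fun x hx _ hl y hy1 hy2 => ?_⟩
      have := Real.rpow_le_one_of_one_le_of_nonpos hl (show 2 - ε ≤ 0 by linarith)
      linarith
    · obtain ⟨y0, h4, hE⟩ := h.thmE hRH (a := ε/8) (by linarith) (by linarith)
      obtain ⟨y1, hy1⟩ := eventually_atTop.1 ((tendsto_rpow_atTop (show 0 < ε/8 by linarith)).eventually_ge_atTop 2)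
      obtain ⟨Y, hY0, hY1⟩ : ∃ Y, y0 ≤ Y ∧ y1 ≤ Y := ⟨max y0 y1, le_max_left _ _, le_max_right _ _⟩
      refine ⟨2 * Y ^ 2 * log Y, fun x hx hB hl y hy2 hyx => ?_⟩
      have hly : 0 < log y := Real.log_pos (by linarith)
      rcases le_or_gt (2 * y ^ 2 * log y) (log x) with hc | hc
      · exact h.tailF hy2 hx hc
      have hYy : Y ≤ y := by
        by_contra hcon
        push Not at hcon
        have : log y ≤ log Y := Real.log_le_log (by linarith) hcon.le
        have : 2 * y ^ 2 * log y ≤ 2 * Y ^ 2 * log Y := by gcongr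
        linarith
      refine hE y (hY0.trans hYy) x (by linarith) ?_ hc.le
      have hy0 : 0 < y := by linarith
      have q1 := Real.rpow_le_rpow hy0.le hyx (show 0 ≤ 1 / (2 - ε) from div_nonneg zero_le_one (by linarith))
      rw [← Real.rpow_mul (by linarith), mul_one_div_cancel (by linarith), Real.rpow_one] at q1
      refine le_trans ?_ q1
      have q2 : y ^ (1/2 + ε/8 + ε/8) ≤ y ^ (1 / (2 - ε)) := by
        refine Real.rpow_le_rpow_of_exponent_le (by linarith) ?_
        rw [le_div_iff₀ (by linarith)]
        nlinarith [sq_nonneg ε]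
      refine le_trans ?_ q2
      rw [Real.rpow_add hy0 (1/2 + ε/8), mul_comm]
      exact mul_le_mul_of_nonneg_left (hy1 y (hY1.trans hYy)) (by positivity)
  obtain ⟨B1, h1⟩ := r1
  obtain ⟨B2, h2⟩ := r2
  obtain ⟨x0, hx0⟩ := eventually_atTop.1 ((eventually_ge_atTop (1:ℝ)).and
    ((Real.tendsto_log_atTop.eventually_ge_atTop B1).and ((Real.tendsto_log_atTop.eventually_ge_atTop B2).and
      (Real.tendsto_log_atTop.eventually_ge_atTop 1))))
  refine ⟨x0, fun x hx y hxy => ?_⟩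
  obtain ⟨a1, a2, a3, a4⟩ := hx0 x hx
  rcases hxy with ⟨h3, h4⟩ | ⟨h3, h4⟩
  · exact h1 x a1 a2 a4 y h3 h4
  · exact h2 x a1 a3 a4 y h3 h4
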